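/- Fix, for every (β,s)∈Δ⁺×ℕ, a choice of the decomposition used in defining the root vector X_{β,s}. Then the ordered monomials {X_h}_{h∈𝓗} form a basis of Y_ħ^>(g) as a ℚ[ħ]-module. -/

import Mathlib

set_option synthInstance.maxHeartbeats 1000000
set_option maxHeartbeats 1600000

noncomputable section
open scoped BigOperators DirectSum

/-! ### Base field ℚ(v) and quantum numbers -/

/-- the base field `ℚ(v)`. -/
abbrev KK : Type := RatFunc ℚ
/-- the variable `v ∈ ℚ(v)`. -/
def vv : KK := RatFunc.X
/-- integer powers of `v`. -/
def vpow (m : ℤ) : KK := vv ^ m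
/-- the quantum integer `[m]_u = (uᵐ - u⁻ᵐ)/(u - u⁻¹)`. -/
def qInt (u : KK) (m : ℕ) : KK := (u ^ (m : ℤ) - u ^ (-(m : ℤ))) / (u - u⁻¹)
/-- the quantum factorial `[m]_u!`. -/
def qFact (u : KK) (m : ℕ) : KK := ∏ k ∈ Finset.range m, qInt u (k + 1)
/-- the quantum binomial coefficient. -/
def qBinom (u : KK) (m k : ℕ) : KK := qFact u m / (qFact u k * qFact u (m - k))
/-- `⟨m⟩_v = vᵐ - v⁻ᵐ`. -/
def qBrack (m : ℕ) : KK := vpow (m : ℤ) - vpow (-(m : ℤ))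
/-- the sign `ε ∈ {+,-}` as `±1`. -/
def sgn (ε : Bool) : ℤ := if ε then 1 else -1
/-- `l` is an integer power of `v`. -/
def IsVpow (l : KK) : Prop := ∃ m : ℤ, l = vpow m

/-! ### Cartan data of types `C_n` and `D_n` (1-based indices) -/

/-- the Cartan matrix of type `C_n` (1-based indices). -/
def aC (n i j : ℕ) : ℤ :=
  if i = j then 2 else if i + 1 = n ∧ j = n then -2
  else if i + 1 = j ∨ j + 1 = i then -1 else 0
/-- the symmetrizing integers `d_i` of type `C_n`. -/
def dC (n i : ℕ) : ℕ := if i = n then 2 else 1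
/-- the Cartan matrix of type `D_n` (1-based indices). -/
def aD (n i j : ℕ) : ℤ :=
  if i = j then 2
  else if (i + 1 = j ∧ j + 1 ≤ n) ∨ (j + 1 = i ∧ i + 1 ≤ n) then -1
  else if (i + 2 = n ∧ j = n) ∨ (j + 2 = n ∧ i = n) then -1 else 0
/-- the symmetrizing integers `d_i` of type `D_n` (all equal to `1`). -/
def dD (n i : ℕ) : ℕ := 1

/-! ### The positive subalgebra of the quantum loop algebra, for Cartan data `(A, Dd)` -/

section Ualg
variable (n : ℕ) (A : ℕ → ℕ → ℤ) (Dd : ℕ → ℕ)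

/-- the free `ℚ(v)`-algebra on generators `e_{i,r}`, `i ∈ I`, `r ∈ ℤ`. -/
abbrev FA := FreeAlgebra KK (Fin n × ℤ)
/-- the free generator `e_{i,r}`. -/
def fg (i : Fin n) (r : ℤ) : FA n := FreeAlgebra.ι KK (i, r)

/-- the `z^{-r₁}⋯z^{-r_m}w^{-t}`-coefficient of the Serre relation between colors `i ≠ j`. -/
def serreElt (i j : Fin n) (m : ℕ) (r : Fin m → ℤ) (t : ℤ) : FA n :=
  ∑ σ : Equiv.Perm (Fin m), ∑ k ∈ Finset.range (m + 1),
    ((-1 : KK) ^ k * qBinom (vpow (Dd (i.1 + 1))) m k) •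
      (((List.ofFn fun l => fg n i (r (σ l))).take k
        ++ fg n j t :: (List.ofFn fun l => fg n i (r (σ l))).drop k).prod)

/-- the defining relations of `U_v^>(Lg)` in the new Drinfeld realization: the coefficients of
`(z - v_i^{a_ij} w) e_i(z) e_j(w) = (v_i^{a_ij} z - w) e_j(w) e_i(z)` and of the Serre relations. -/
inductive URel : FA n → FA n → Prop
  | loop (i j : Fin n) (r s : ℤ) :
      URel (fg n i (r + 1) * fg n j s
             - vpow ((Dd (i.1 + 1) : ℤ) * A (i.1 + 1) (j.1 + 1)) • (fg n i r * fg n j (s + 1)))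
           (vpow ((Dd (i.1 + 1) : ℤ) * A (i.1 + 1) (j.1 + 1)) • (fg n j s * fg n i (r + 1))
             - fg n j (s + 1) * fg n i r)
  | serre (i j : Fin n) (hij : i ≠ j) (r : Fin (1 - A (i.1 + 1) (j.1 + 1)).toNat → ℤ) (t : ℤ) :
      URel (serreElt n Dd i j _ r t) 0

/-- the positive subalgebra `U_v^>(Lg)` of the quantum loop algebra. -/
abbrev UA := RingQuot (URel n A Dd)
/-- the generator `e_{i,r}` of `U_v^>(Lg)`. -/
def ug (i : Fin n) (r : ℤ) : UA n A Dd := RingQuot.mkAlgHom KK (URel n A Dd) (fg n i r)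
/-- the generator `e_{i,r}` with a 1-based index `1 ≤ i ≤ n` (and junk value `0` otherwise). -/
def g1 (i : ℕ) (r : ℤ) : UA n A Dd := if h : 1 ≤ i ∧ i ≤ n then ug n A Dd ⟨i - 1, by omega⟩ r else 0

end Ualg

/-! ### `q`-brackets, ordered monomials, and ℤ[v,v⁻¹]-forms -/

section Aux
variable {B : Type} [Ring B] [Module KK B]

/-- the `u`-commutator `[x,y]_u = xy - u · yx`. -/
def qcm (u : KK) (x y : B) : B := x * y - u • (y * x)

/-- the iterated `q`-bracket `[⋯[[g i₁ s₁, g i₂ s₂]_{λ₁}, g i₃ s₃]_{λ₂}, ⋯]_{λ_{ℓ-1}}`. -/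
def chainE (g : ℕ → ℤ → B) (w : List ℕ) (ss : List ℤ) (ls : List KK) : B :=
  match w, ss with
  | i :: w', s :: ss' =>
      ((w'.zip ss').zip ls).foldl
        (fun acc p => acc * g p.1.1 p.1.2 - p.2 • (g p.1.1 p.1.2 * acc)) (g i s)
  | _, _ => 0
end Aux

section Mon
variable {B : Type} [Ring B] {ι : Type} [LinearOrder ι]
/-- the ordered monomial `∏→ (E p)^(h p)`, the product taken in increasing order of `p`. -/
def ordMon (E : ι → B) (h : ι →₀ ℕ) : B := ((h.support.sort (· ≤ ·)).map (fun p => E p ^ h p)).prod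
end Mon

/-- the subring `ℤ[v,v⁻¹] ⊆ ℚ(v)`. -/
def Rint : Subring KK := Subring.closure {vv, vv⁻¹}

section Forms
variable {B : Type} [Ring B] [Algebra KK B]
/-- the `ℤ[v,v⁻¹]`-subalgebra of a `ℚ(v)`-algebra generated by a set `X`, realized as the subring
generated by `X` together with the central scalars `v^{±1}`. -/
def zvForm (X : Set B) : Subring B :=
  Subring.closure ({algebraMap KK B vv, algebraMap KK B vv⁻¹} ∪ X)
end Forms

/-! ### Positive roots of type `C_n` with the fixed convex (lexicographic) order -/

section RootsC
variable (n : ℕ)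

/-- Positive roots of type `C_n`, encoded as lexicographically ordered pairs `(i,t)`:
`[i,i+t]` for `i+t<n` or `i=n`; `[i,n,i]` for `i+t=n`, `i<n`; `[i,n]` for `i+t=n+1`;
`[i,n,j]` with `j = 2n+1-i-t` for `i+t ≥ n+2`.  The induced linear order is exactly the
convex order coming from standard Lyndon words. -/
def IsPosRootC (p : Fin (n + 1) ×ₗ Fin (2 * n + 1)) : Prop :=
  1 ≤ ((ofLex p).1 : ℕ) ∧ (((ofLex p).1 : ℕ) = n → ((ofLex p).2 : ℕ) = 0) ∧
    ((ofLex p).2 : ℕ) + 2 * ((ofLex p).1 : ℕ) ≤ 2 * n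

instance : DecidablePred (IsPosRootC n) := fun p => by unfold IsPosRootC; infer_instance

/-- the set `Δ⁺` of positive roots of type `C_n`, with its convex linear order. -/
abbrev PosRootC := {p : Fin (n + 1) ×ₗ Fin (2 * n + 1) // IsPosRootC n p}

variable {n}
/-- the first index `i` of a positive root. -/
def ri (β : PosRootC n) : ℕ := ((ofLex β.1).1 : ℕ)
/-- the offset `t` of a positive root within its block. -/
def rt (β : PosRootC n) : ℕ := ((ofLex β.1).2 : ℕ)

/-- multiplicity of `α_c` (1-based color `c`) in the positive root `β` (type `C_n`). -/
def nuC (β : PosRootC n) (c : ℕ) : ℕ :=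
  let i := ri β; let t := rt β
  if i + t < n ∨ i = n then (if i ≤ c ∧ c ≤ i + t then 1 else 0)
  else if i + t = n then (if i ≤ c ∧ c ≤ n - 1 then 2 else if c = n then 1 else 0)
  else if i + t = n + 1 then (if i ≤ c ∧ c ≤ n then 1 else 0)
  else (if i ≤ c ∧ c < 2 * n + 1 - i - t then 1
        else if 2 * n + 1 - i - t ≤ c ∧ c ≤ n - 1 then 2
        else if c = n then 1 else 0)

/-- standard Lyndon word (list of 1-based simple-root indices) of `β` (type `C_n`). -/
def wordC (β : PosRootC n) : List ℕ :=
  let i := ri β; let t := rt β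
  if i + t < n ∨ i = n then List.range' i (t + 1)
  else if i + t = n then List.range' i (n - i) ++ List.range' i (n - i) ++ [n]
  else if i + t = n + 1 then List.range' i (n - i + 1)
  else List.range' i (n - i + 1) ++ (List.range' (2 * n + 1 - i - t) (n - (2 * n + 1 - i - t))).reverse

/-- the height `|β|` of a positive root (type `C_n`). -/
def heightC (β : PosRootC n) : ℕ := (wordC β).length

/-- `β` is a root of the form `[i,n,i]`. -/
def isINI (β : PosRootC n) : Prop := ri β + rt β = n ∧ ri β < n
instance (β : PosRootC n) : Decidable (isINI β) := by unfold isINI; infer_instance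
end RootsC

/-! ### Positive roots of type `D_n` with the fixed convex (lexicographic) order -/

section RootsD
variable (n : ℕ)

/-- Positive roots of type `D_n`, encoded as lexicographically ordered pairs `(i,t)`:
`[i,i+t]` for `i+t<n` or `i=n`; `[i,n]` for `i+t=n`; `[i,n,n-1]` for `i+t=n+1`;
`[i,n,j]` with `j = 2n-i-t` for `i+t ≥ n+2`.  The induced linear order is exactly the
convex order coming from standard Lyndon words. -/
def IsPosRootD (p : Fin (n + 1) ×ₗ Fin (2 * n + 1)) : Prop :=
  1 ≤ ((ofLex p).1 : ℕ) ∧ (n - 1 ≤ ((ofLex p).1 : ℕ) → ((ofLex p).2 : ℕ) = 0) ∧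
    (((ofLex p).2 : ℕ) = 0 ∨ ((ofLex p).2 : ℕ) + 2 * ((ofLex p).1 : ℕ) + 1 ≤ 2 * n)

instance : DecidablePred (IsPosRootD n) := fun p => by unfold IsPosRootD; infer_instance

/-- the set `Δ⁺` of positive roots of type `D_n`, with its convex linear order. -/
abbrev PosRootD := {p : Fin (n + 1) ×ₗ Fin (2 * n + 1) // IsPosRootD n p}

variable {n}
/-- the first index `i` of a positive root. -/
def riD (β : PosRootD n) : ℕ := ((ofLex β.1).1 : ℕ)
/-- the offset `t` of a positive root within its block. -/
def rtD (β : PosRootD n) : ℕ := ((ofLex β.1).2 : ℕ)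

/-- multiplicity of `α_c` (1-based color `c`) in the positive root `β` (type `D_n`). -/
def nuD (β : PosRootD n) (c : ℕ) : ℕ :=
  let i := riD β; let t := rtD β
  if i + t < n ∨ i = n then (if i ≤ c ∧ c ≤ i + t then 1 else 0)
  else if i + t = n then (if (i ≤ c ∧ c ≤ n - 2) ∨ c = n then 1 else 0)
  else if i + t = n + 1 then (if i ≤ c ∧ c ≤ n then 1 else 0)
  else (if i ≤ c ∧ c < 2 * n - i - t then 1
        else if 2 * n - i - t ≤ c ∧ c ≤ n - 2 then 2
        else if c = n - 1 ∨ c = n then 1 else 0)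

/-- standard Lyndon word (list of 1-based simple-root indices) of `β` (type `D_n`). -/
def wordD (β : PosRootD n) : List ℕ :=
  let i := riD β; let t := rtD β
  if i + t < n ∨ i = n then List.range' i (t + 1)
  else if i + t = n then List.range' i (n - 1 - i) ++ [n]
  else if i + t = n + 1 then List.range' i (n - 1 - i) ++ [n, n - 1]
  else List.range' i (n - 1 - i) ++ [n] ++ (List.range' (2 * n - i - t) (n - (2 * n - i - t))).reverse

/-- the height `|β|` of a positive root (type `D_n`). -/
def heightD (β : PosRootD n) : ℕ := (wordD β).length

/-- `β` is a root of the form `[i,n,j]` with `i < j ≤ n-2`. -/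
def isSpecD (β : PosRootD n) : Prop := n + 2 ≤ riD β + rtD β
instance (β : PosRootD n) : Decidable (isSpecD β) := by unfold isSpecD; infer_instance
end RootsD

/-! ### The positive subalgebra of the Yangian, for Cartan data `(A, Dd)` -/

/-- the base ring `ℚ[ħ]`. -/
abbrev RH : Type := Polynomial ℚ
/-- the formal parameter `ħ`. -/
def hbar : RH := Polynomial.X

section Yang
variable (n : ℕ) (A : ℕ → ℕ → ℤ) (Dd : ℕ → ℕ)

/-- the free `ℚ[ħ]`-algebra on generators `x_{i,r}`, `i ∈ I`, `r ∈ ℕ`. -/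
abbrev FAY := FreeAlgebra RH (Fin n × ℕ)
/-- the free generator `x_{i,r}`. -/
def fy (i : Fin n) (r : ℕ) : FAY n := FreeAlgebra.ι RH (i, r)

/-- the defining relations of the positive subalgebra `Y_ħ^>(g)` of the Yangian. -/
inductive YRel : FAY n → FAY n → Prop
  | loop (i j : Fin n) (r s : ℕ) :
      YRel ((fy n i (r + 1) * fy n j s - fy n j s * fy n i (r + 1))
              - (fy n i r * fy n j (s + 1) - fy n j (s + 1) * fy n i r))
           ((Polynomial.C (((Dd (i.1 + 1) : ℚ) * (A (i.1 + 1) (j.1 + 1) : ℚ)) / 2) * hbar) •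
              (fy n i r * fy n j s + fy n j s * fy n i r))
  | serre (i j : Fin n) (hij : i ≠ j)
      (ss : Fin (1 - A (i.1 + 1) (j.1 + 1)).toNat → ℕ) (r : ℕ) :
      YRel (∑ σ : Equiv.Perm (Fin (1 - A (i.1 + 1) (j.1 + 1)).toNat),
              (List.ofFn fun l => fy n i (ss (σ l))).foldr (fun a b => a * b - b * a) (fy n j r)) 0

/-- the positive subalgebra `Y_ħ^>(g)` of the Yangian. -/
abbrev YA := RingQuot (YRel n A Dd)
/-- the generator `x_{i,r}` of `Y_ħ^>(g)`. -/
def yg (i : Fin n) (r : ℕ) : YA n A Dd := RingQuot.mkAlgHom RH (YRel n A Dd) (fy n i r)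
/-- the generator `x_{i,r}` with a 1-based index `1 ≤ i ≤ n` (and junk value `0` otherwise). -/
def gy1 (i : ℕ) (r : ℕ) : YA n A Dd :=
  if h : 1 ≤ i ∧ i ≤ n then yg n A Dd ⟨i - 1, by omega⟩ r else 0
end Yang

/-- the iterated commutator `[⋯[[g i₁ s₁, g i₂ s₂], g i₃ s₃], ⋯, g i_ℓ s_ℓ]`. -/
def chainY {B : Type} [Ring B] (g : ℕ → ℕ → B) (w : List ℕ) (ss : List ℕ) : B :=
  match w, ss with
  | i :: w', s :: ss' =>
      (w'.zip ss').foldl (fun acc p => acc * g p.1 p.2 - g p.1 p.2 * acc) (g i s)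
  | _, _ => 0

section YangC
variable (n : ℕ)
/-- the positive subalgebra of the Yangian of type `C_n`. -/
abbrev YC := YA n (aC n) (dC n)
/-- generators with 1-based indices (type `C_n`). -/
def genYC : ℕ → ℕ → YC n := gy1 n (aC n) (dC n)

variable {n}
/-- the specific root vector `X̃_{β,s}` of type `C_n`. -/
def xTildeC (β : PosRootC n) (s : ℕ) : YC n :=
  if isINI β then
    (let Ach := chainY (genYC (n := n)) (List.range' (ri β) (n - ri β))
        (List.replicate (n - ri β) 0)
     let Bch := Ach * genYC (n := n) n s - genYC (n := n) n s * Ach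
     Ach * Bch - Bch * Ach)
  else chainY (genYC (n := n)) (wordC β) (s :: List.replicate ((wordC β).length - 1) 0)

/-- `E` is a Yangian root vector `X_{β,s}` for a root of "chain" type, for some decomposition
`s = s₁ + ⋯ + s_ℓ` with `s_k ∈ ℕ`. -/
def IsRVYCchain (β : PosRootC n) (s : ℕ) (E : YC n) : Prop :=
  ∃ ss : List ℕ, ss.length = (wordC β).length ∧ ss.sum = s ∧
    E = chainY (genYC (n := n)) (wordC β) ss

/-- `E` is a Yangian root vector `X_{β,s}` of type `C_n` for some choice of decompositions. -/
def IsRVYC (β : PosRootC n) (s : ℕ) (E : YC n) : Prop :=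
  if isINI β then
    ∃ (β₁ β₂ : PosRootC n) (s₁ s₂ : ℕ) (E₁ E₂ : YC n),
      (ri β₁ = ri β ∧ ri β₁ + rt β₁ + 1 = n) ∧ (ri β₂ = ri β ∧ ri β₂ + rt β₂ = n + 1) ∧
      IsRVYCchain β₁ s₁ E₁ ∧ IsRVYCchain β₂ s₂ E₂ ∧
      s = s₁ + s₂ ∧ E = E₁ * E₂ - E₂ * E₁
  else IsRVYCchain β s E
end YangC

section YangD
variable (n : ℕ)
/-- the positive subalgebra of the Yangian of type `D_n`. -/
abbrev YD := YA n (aD n) (dD n)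
/-- generators with 1-based indices (type `D_n`). -/
def genYD : ℕ → ℕ → YD n := gy1 n (aD n) (dD n)

variable {n}
/-- the specific root vector `X̃_{β,s}` of type `D_n`. -/
def xTildeD (β : PosRootD n) (s : ℕ) : YD n :=
  chainY (genYD (n := n)) (wordD β) (s :: List.replicate ((wordD β).length - 1) 0)

/-- `E` is a Yangian root vector `X_{β,s}` of type `D_n` for some choice of decompositions. -/
def IsRVYD (β : PosRootD n) (s : ℕ) (E : YD n) : Prop :=
  ∃ ss : List ℕ, ss.length = (wordD β).length ∧ ss.sum = s ∧
    E = chainY (genYD (n := n)) (wordD β) ss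
end YangD

/-! ### Current relations of type `A` -/

section TypeA
variable {L : Type*} [LieRing L]

/-- The iterated bracket `⁅⋯⁅e i s, e (i+1) 0⁆, ⋯, e (i+l) 0⁆`. -/
def strF (e : ℕ → ℕ → L) (i : ℕ) : ℕ → ℕ → L
  | 0, s => e i s
  | l + 1, s => ⁅strF e i l s, e (i + l + 1) 0⁆

/-- The relations of the current algebra of type `A_N` for the elements `e i r`, `1 ≤ i ≤ N`. -/
structure CurrentA (e : ℕ → ℕ → L) (N : ℕ) : Prop where
  two : ∀ x : L, x + x = 0 → x = 0
  shift : ∀ i r s, 1 ≤ i → i + 1 ≤ N → ⁅e i (r + 1), e (i + 1) s⁆ = ⁅e i r, e (i + 1) (s + 1)⁆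
  comm : ∀ i j r s, 1 ≤ i → i ≤ N → 1 ≤ j → j ≤ N → j ≠ i + 1 → i ≠ j + 1 → ⁅e i r, e j s⁆ = 0
  serre_up : ∀ i r s t, 1 ≤ i → i + 1 ≤ N → ⁅e i r, ⁅e i s, e (i + 1) t⁆⁆ = 0
  serre_down : ∀ i r s t, 1 ≤ i → i + 1 ≤ N → ⁅e (i + 1) r, ⁅e (i + 1) s, e i t⁆⁆ = 0

theorem lie_swap (x y : L) : ⁅x, y⁆ = -⁅y, x⁆ := (lie_skew x y).symm

theorem lie_lie_right (x y z : L) : ⁅⁅x, y⁆, z⁆ = ⁅⁅x, z⁆, y⁆ + ⁅x, ⁅y, z⁆⁆ := by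
  rw [leibniz_lie x y z, lie_swap y ⁅x, z⁆]; abel

theorem lie_lie_of_comm {x y z : L} (h : ⁅x, z⁆ = 0) : ⁅⁅x, y⁆, z⁆ = ⁅x, ⁅y, z⁆⁆ := by
  rw [lie_lie_right, h, zero_lie, zero_add]

theorem lie_lie_comm {x y z : L} (h : ⁅y, z⁆ = 0) : ⁅⁅x, y⁆, z⁆ = ⁅⁅x, z⁆, y⁆ := by
  rw [lie_lie_right, h, lie_zero, add_zero]

theorem lie_left_comm {x y z : L} (h : ⁅x, y⁆ = 0) : ⁅x, ⁅y, z⁆⁆ = ⁅y, ⁅x, z⁆⁆ := by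
  rw [leibniz_lie, h, zero_lie, zero_add]

theorem lie_comm_zero {x y : L} (h : ⁅x, y⁆ = 0) : ⁅y, x⁆ = 0 := by
  rw [lie_swap, h, neg_zero]

theorem lie_lie_zero {x y z : L} (h : ⁅x, z⁆ = 0) (h' : ⁅y, z⁆ = 0) : ⁅⁅x, y⁆, z⁆ = 0 := by
  rw [lie_lie_right, h, h', zero_lie, lie_zero, add_zero]

/-- If a bilinear expression is unchanged by moving one unit of the exponent, it depends only on
the total exponent. -/
theorem shift_total {α : Type*} {f : ℕ → ℕ → α} (h : ∀ r s, f (r + 1) s = f r (s + 1))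
    (a b : ℕ) : f a b = f (a + b) 0 := by
  induction b generalizing a with
  | zero => rfl
  | succ b ih => rw [← h, ih]; congr 1; omega

namespace CurrentA
variable {e : ℕ → ℕ → L} {N : ℕ}

theorem shift_add (h : CurrentA e N) {i : ℕ} (hi : 1 ≤ i) (hN : i + 1 ≤ N) (a b : ℕ) :
    ⁅e i a, e (i + 1) b⁆ = ⁅e i (a + b), e (i + 1) 0⁆ :=
  shift_total (f := fun a b => ⁅e i a, e (i + 1) b⁆) (fun r s => h.shift i r s hi hN) a b

/-- The bracket of `strF e i l s` with a generator. -/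
theorem strF_table (h : CurrentA e N) (l : ℕ) : ∀ i k s r, 1 ≤ i → i + l ≤ N → 1 ≤ k → k ≤ N →
    (k = i + l + 1 → ⁅strF e i l s, e k r⁆ = strF e i (l + 1) (s + r)) ∧
    (k + 1 = i → ⁅strF e i l s, e k r⁆ = -strF e k (l + 1) (s + r)) ∧
    (k ≠ i + l + 1 → k + 1 ≠ i → ⁅strF e i l s, e k r⁆ = 0) := by
  induction l using Nat.strong_induction_on with
  | _ l IH =>
  match l with
  | 0 =>
    intro i k s r hi hN hk hkN
    refine ⟨?_, ?_, ?_⟩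
    · rintro rfl
      exact h.shift_add hi hkN s r
    · rintro rfl
      show ⁅e (k + 1) s, e k r⁆ = -⁅e k (s + r), e (k + 1) 0⁆
      rw [lie_swap, h.shift_add hk (by omega), add_comm r s]
    · intro h1 h2
      exact h.comm i k s r hi (by omega) hk hkN (by omega) (by omega)
  | l + 1 =>
    intro i k s r hi hN hk hkN
    have top : ∀ s r, ⁅strF e i l s, e (i + l + 1) r⁆ = strF e i (l + 1) (s + r) := fun s r =>
      (IH l (by omega) i (i + l + 1) s r hi (by omega) (by omega) (by omega)).1 rfl
    have expand : ⁅strF e i (l + 1) s, e k r⁆ = ⁅⁅strF e i l s, e k r⁆, e (i + l + 1) 0⁆ +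
        ⁅strF e i l s, ⁅e (i + l + 1) 0, e k r⁆⁆ := lie_lie_right _ _ _
    refine ⟨?_, ?_, ?_⟩
    · intro hkj
      have hk' : k = i + l + 1 + 1 := by omega
      subst hk'
      have z : ∀ s r, ⁅strF e i l s, e (i + l + 1 + 1) r⁆ = 0 := fun s r =>
        (IH l (by omega) i _ s r hi (by omega) hk hkN).2.2 (by omega) (by omega)
      rw [expand, z, zero_lie, zero_add, h.shift_add (by omega) hkN, ← lie_lie_of_comm (z _ _),
        top, zero_add]
      rfl
    · rintro rfl
      rw [expand, (IH l (by omega) (k + 1) k s r hi (by omega) hk hkN).2.1 rfl,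
        h.comm (k + 1 + l + 1) k 0 r (by omega) (by omega) hk hkN (by omega) (by omega),
        lie_zero, add_zero, neg_lie]
      show _ = -⁅strF e k (l + 1) (s + r), e (k + (l + 1) + 1) 0⁆
      rw [show k + (l + 1) + 1 = k + 1 + l + 1 by omega]
    · intro h1 h2
      by_cases hkj : k = i + l + 1
      · subst hkj
        match l with
        | 0 =>
          show ⁅⁅e i s, e (i + 1) 0⁆, e (i + 1) r⁆ = 0
          rw [lie_swap, lie_swap (e i s), lie_neg, neg_neg, h.serre_down i r 0 s hi hkN]
        | m + 1 =>
          have z : ∀ s r, ⁅strF e i m s, e (i + m + 1 + 1) r⁆ = 0 := fun s r =>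
            (IH m (by omega) i _ s r hi (by omega) hk hkN).2.2 (by omega) (by omega)
          show ⁅⁅⁅strF e i m s, e (i + m + 1) 0⁆, e (i + m + 1 + 1) 0⁆, e (i + m + 1 + 1) r⁆ = 0
          have sz : ⁅⁅e (i + m + 1) 0, e (i + m + 1 + 1) 0⁆, e (i + m + 1 + 1) r⁆ = 0 := by
            rw [lie_swap, lie_swap (e (i + m + 1) 0), lie_neg, neg_neg]
            exact h.serre_down _ _ _ _ (by omega) hkN
          rw [lie_lie_of_comm (z _ _), lie_lie_of_comm (z _ _), sz, lie_zero]
      by_cases hk1 : k = i + l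
      · have hz : ∀ s r, ⁅strF e i l s, e k r⁆ = 0 := fun s r =>
          (IH l (by omega) i k s r hi (by omega) hk hkN).2.2 (by omega) h2
        have e1 : ⁅strF e i (l + 1) s, e k r⁆ = ⁅strF e i (l + 1) (s + r), e k 0⁆ := by
          have sh : ⁅e (i + l + 1) 0, e k r⁆ = ⁅e (i + l + 1) r, e k 0⁆ := by
            subst hk1
            rw [lie_swap, h.shift_add hk hN, lie_swap (e _ r), h.shift_add hk hN 0 r, zero_add,
              add_zero]
          rw [expand, hz, zero_lie, zero_add, sh, ← lie_lie_of_comm (hz s 0), top]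
        have e2 : ⁅strF e i (l + 1) s, e k r⁆ = -⁅strF e i (l + 1) (s + r), e k 0⁆ := by
          match l, hk1 with
          | 0, hk1 =>
            have : ∀ s r, ⁅strF e i (0 + 1) s, e k r⁆ = 0 := by
              intro s r
              rw [show k = i from hk1]
              show ⁅⁅e i s, e (i + 1) 0⁆, e i r⁆ = 0
              rw [lie_swap, h.serre_up i r s 0 hi hN, neg_zero]
            rw [this, this, neg_zero]
          | m + 1, hk1 =>
            have hk' : k = i + m + 1 := by omega
            subst hk'
            have z : ∀ s r, ⁅strF e i m s, e (i + m + 1 + 1) r⁆ = 0 := fun s r =>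
              (IH m (by omega) i _ s r hi (by omega) (by omega) (by omega)).2.2
                (by omega) (by omega)
            have t' : ∀ s r, ⁅strF e i m s, e (i + m + 1) r⁆ = strF e i (m + 1) (s + r) :=
              fun s r => (IH m (by omega) i (i + m + 1) s r hi (by omega) (by omega) (by omega)).1 rfl
            show ⁅⁅⁅strF e i m s, e (i + m + 1) 0⁆, e (i + m + 1 + 1) 0⁆, e (i + m + 1) r⁆ =
              -⁅⁅strF e i (m + 1) (s + r), e (i + m + 1 + 1) 0⁆, e (i + m + 1) 0⁆
            have sz : ⁅⁅e (i + m + 1) 0, e (i + m + 1 + 1) 0⁆, e (i + m + 1) r⁆ = 0 := by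
              rw [lie_swap, h.serre_up _ _ _ _ (by omega) (by omega), neg_zero]
            rw [lie_lie_of_comm (z _ _), lie_lie_comm sz, t',
              lie_lie_of_comm (hz _ _), lie_swap (e (i + m + 1 + 1) 0), lie_neg, neg_neg]
        exact h.two _ (by nth_rw 1 [e1]; rw [e2]; abel)
      · rw [expand, (IH l (by omega) i k s r hi (by omega) hk hkN).2.2 (by omega) h2, zero_lie,
          h.comm (i + l + 1) k 0 r (by omega) (by omega) hk hkN (by omega) (by omega), lie_zero,
          add_zero]

theorem strF_lie_next (h : CurrentA e N) {i l : ℕ} (hi : 1 ≤ i) (hN : i + l + 1 ≤ N) (s r : ℕ) :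
    ⁅strF e i l s, e (i + l + 1) r⁆ = strF e i (l + 1) (s + r) :=
  (h.strF_table l i _ s r hi (by omega) (by omega) hN).1 rfl

theorem strF_lie_prev (h : CurrentA e N) {k l : ℕ} (hk : 1 ≤ k) (hN : k + 1 + l ≤ N) (s r : ℕ) :
    ⁅strF e (k + 1) l s, e k r⁆ = -strF e k (l + 1) (s + r) :=
  (h.strF_table l (k + 1) k s r (by omega) hN hk (by omega)).2.1 rfl

theorem strF_lie_other (h : CurrentA e N) {i l k : ℕ} (hi : 1 ≤ i) (hN : i + l ≤ N) (hk : 1 ≤ k)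
    (hkN : k ≤ N) (h1 : k ≠ i + l + 1) (h2 : k + 1 ≠ i) (s r : ℕ) :
    ⁅strF e i l s, e k r⁆ = 0 :=
  (h.strF_table l i k s r hi hN hk hkN).2.2 h1 h2

theorem strF_comm (h : CurrentA e N) {i l j : ℕ} (hi : 1 ≤ i) (hN : i + l ≤ N) (hij : i ≤ j)
    (m : ℕ) (hm : j + m ≤ i + l) (s r : ℕ) : ⁅strF e i l s, strF e j m r⁆ = 0 := by
  induction m generalizing r with
  | zero => exact h.strF_lie_other hi hN (by omega) (by omega) (by omega) (by omega) s r
  | succ m ih =>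
    show ⁅_, ⁅strF e j m r, e (j + m + 1) 0⁆⁆ = 0
    rw [leibniz_lie, ih (by omega), zero_lie, zero_add,
      h.strF_lie_other hi hN (by omega) (by omega) (by omega) (by omega), lie_zero]

end CurrentA

/-- The string of letters `i, …, N`. -/
def topF (e : ℕ → ℕ → L) (N i s : ℕ) : L := strF e i (N - i) s

theorem topF_self (e : ℕ → ℕ → L) (N s : ℕ) : topF e N N s = e N s := by
  simp [topF, strF]

namespace CurrentA
variable {e : ℕ → ℕ → L} {N : ℕ}

theorem lie_topF (h : CurrentA e N) {k i : ℕ} (hk : 1 ≤ k) (hkN : k ≤ N) (hi : 1 ≤ i)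
    (hiN : i ≤ N) (r s : ℕ) :
    ⁅e k r, topF e N i s⁆ = if i = k + 1 then topF e N k (r + s) else 0 := by
  rw [lie_swap]
  split_ifs with hik
  · subst hik
    rw [topF, topF, h.strF_lie_prev hk (by omega), neg_neg, add_comm r s]
    congr 1; omega
  · rw [topF, h.strF_lie_other hi (by omega) hk hkN (by omega) (by omega), neg_zero]

theorem topF_comm (h : CurrentA e N) {i j : ℕ} (hi : 1 ≤ i) (hiN : i ≤ N) (hj : 1 ≤ j)
    (hjN : j ≤ N) (r s : ℕ) : ⁅topF e N i r, topF e N j s⁆ = 0 := by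
  rcases le_total i j with hij | hij
  · exact h.strF_comm hi (by omega) hij _ (by omega) r s
  · exact lie_comm_zero (h.strF_comm hj (by omega) hij _ (by omega) s r)

theorem topF_last (h : CurrentA e N) {i : ℕ} (hi : 1 ≤ i) (hiN : i + 1 ≤ N) (r s : ℕ) :
    ⁅strF e i (N - 1 - i) r, e N s⁆ = topF e N i (r + s) := by
  have := h.strF_lie_next (l := N - 1 - i) hi (by omega) r s
  rw [show i + (N - 1 - i) + 1 = N by omega, show N - 1 - i + 1 = N - i by omega] at this
  exact this

end CurrentA
end TypeA

/-! ### Current relations of type `C` -/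

section TypeC
variable {L : Type*} [LieRing L]

/-- The relations of the current algebra of type `C_{N+1}` (positive part). -/
structure CurrentC (e : ℕ → ℕ → L) (N : ℕ) : Prop extends CurrentA e N where
  pos : 1 ≤ N
  three : ∀ x : L, x + x + x = 0 → x = 0
  shift_last : ∀ r s, ⁅e N (r + 1), e (N + 1) s⁆ = ⁅e N r, e (N + 1) (s + 1)⁆
  comm_last : ∀ k r s, 1 ≤ k → k + 1 ≤ N → ⁅e k r, e (N + 1) s⁆ = 0
  comm_self : ∀ r s, ⁅e (N + 1) r, e (N + 1) s⁆ = 0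
  serre_last : ∀ r s t, ⁅e (N + 1) r, ⁅e (N + 1) s, e N t⁆⁆ = 0
  serre_cubic : ∀ t, ⁅e N 0, ⁅e N 0, ⁅e N 0, e (N + 1) t⁆⁆⁆ = 0

/-- The root vectors of the roots `[i,n,j]` in type `C`. -/
def tC (e : ℕ → ℕ → L) (N i j s : ℕ) : L := ⁅topF e N i 0, topF e (N + 1) j s⁆

namespace CurrentC
variable {e : ℕ → ℕ → L} {N : ℕ}

theorem strF_lie_last (h : CurrentC e N) {i : ℕ} (hi : 1 ≤ i) (l : ℕ) (hl : i + l + 1 ≤ N)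
    (s r : ℕ) : ⁅strF e i l s, e (N + 1) r⁆ = 0 := by
  induction l generalizing s with
  | zero => exact h.comm_last i s r hi hl
  | succ l ih =>
    exact lie_lie_zero (ih (by omega) s) (h.comm_last (i + l + 1) 0 r (by omega) (by omega))

theorem topF_lie_last (h : CurrentC e N) {i : ℕ} (hi : 1 ≤ i) (hN : i ≤ N) (a b : ℕ) :
    ⁅topF e N i a, e (N + 1) b⁆ = topF e (N + 1) i (a + b) := by
  have key : ⁅topF e N i a, e (N + 1) b⁆ = ⁅topF e N i (a + b), e (N + 1) 0⁆ := by
    have sh : ∀ a b, ⁅e N a, e (N + 1) b⁆ = ⁅e N (a + b), e (N + 1) 0⁆ :=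
      shift_total (f := fun a b => ⁅e N a, e (N + 1) b⁆) h.shift_last
    rcases hN.eq_or_lt with rfl | hlt
    · rw [topF_self, topF_self, sh]
    · have z := h.strF_lie_last hi (N - 1 - i) (by omega)
      rw [← add_zero a, ← h.topF_last hi hlt, add_zero, ← h.topF_last hi hlt,
        lie_lie_of_comm (z _ _), lie_lie_of_comm (z _ _), sh, sh b 0, zero_add, add_zero]
  rw [key]
  show _ = strF e i (N + 1 - i) (a + b)
  rw [show N + 1 - i = N - i + 1 by omega]
  show _ = ⁅_, e (i + (N - i) + 1) 0⁆
  rw [show i + (N - i) + 1 = N + 1 by omega]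
  rfl

theorem lie_topF_succ (h : CurrentC e N) {k i : ℕ} (hk : 1 ≤ k) (hi : 1 ≤ i) (hiN : i ≤ N + 1)
    (hkN : k + 1 ≤ N ∨ k = N ∧ i = N + 1) (r s : ℕ) :
    ⁅e k r, topF e (N + 1) i s⁆ = if i = k + 1 then topF e (N + 1) k (r + s) else 0 := by
  rcases hiN.eq_or_lt with rfl | hlt
  · rw [topF_self]
    rcases hkN with hk' | ⟨rfl, -⟩
    · rw [if_neg (by omega), h.comm_last k r s hk hk']
    · rw [if_pos rfl, ← h.topF_lie_last hk le_rfl, topF_self]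
  · have hk' : k + 1 ≤ N := by omega
    rw [← add_zero s, ← h.topF_lie_last hi (by omega), leibniz_lie, h.comm_last k r 0 hk hk',
      lie_zero, add_zero, h.lie_topF hk (by omega) hi (by omega)]
    split_ifs
    · rw [h.topF_lie_last hk (by omega)]; simp
    · rw [zero_lie]

theorem lie_last_topF_succ (h : CurrentC e N) {i : ℕ} (hi : 1 ≤ i) (hN : i ≤ N + 1) (r s : ℕ) :
    ⁅e (N + 1) r, topF e (N + 1) i s⁆ = 0 := by
  obtain ⟨d, hd⟩ : ∃ d, i + d = N + 1 := ⟨N + 1 - i, by omega⟩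
  induction d generalizing i s with
  | zero =>
    rw [show i = N + 1 by omega, topF_self, h.comm_self]
  | succ d ih =>
    match d with
    | 0 =>
      obtain rfl : i = N := by omega
      rw [← add_zero s, ← h.topF_lie_last hi le_rfl, topF_self, lie_swap (e i s), lie_neg,
        h.serre_last, neg_zero]
    | d + 1 =>
      have := congrArg (fun x => ⁅e i 0, x⁆) (ih (i := i + 1) (by omega) (by omega) s (by omega))
      simp only [lie_zero] at this
      rw [lie_left_comm (h.comm_last i 0 r hi (by omega)),
        h.lie_topF_succ hi (by omega) (by omega) (by omega), if_pos rfl, zero_add] at this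
      exact this

theorem topF_lie_topF (h : CurrentC e N) {i j : ℕ} (hi : 1 ≤ i) (hiN : i ≤ N) (hj : 1 ≤ j)
    (hjN : j ≤ N) (a b c : ℕ) :
    ⁅topF e N i a, topF e (N + 1) j (b + c)⁆ = ⁅topF e N j b, topF e (N + 1) i (a + c)⁆ := by
  rw [← h.topF_lie_last hj hjN, lie_left_comm (h.topF_comm hi hiN hj hjN a b),
    h.topF_lie_last hi hiN]

theorem tC_symm (h : CurrentC e N) {i j : ℕ} (hi : 1 ≤ i) (hiN : i ≤ N) (hj : 1 ≤ j)
    (hjN : j ≤ N) (s : ℕ) : tC e N i j s = tC e N j i s := by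
  have := h.topF_lie_topF hi hiN hj hjN 0 0 s
  rwa [zero_add] at this

theorem tC_split (h : CurrentC e N) {i j : ℕ} (hi : 1 ≤ i) (hiN : i ≤ N) (hj : 1 ≤ j)
    (hjN : j ≤ N) (a b : ℕ) :
    ⁅topF e N i a, topF e (N + 1) j b⁆ = tC e N i j (a + b) := by
  rw [h.tC_symm hi hiN hj hjN]
  have := h.topF_lie_topF hi hiN hj hjN a 0 b
  rwa [zero_add] at this

theorem lie_tC (h : CurrentC e N) {k i j : ℕ} (hk : 1 ≤ k) (hkN : k + 1 ≤ N) (hi : 1 ≤ i)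
    (hiN : i ≤ N) (hj : 1 ≤ j) (hjN : j ≤ N) (r s : ℕ) :
    ⁅e k r, tC e N i j s⁆ = (if i = k + 1 then tC e N k j (r + s) else 0) +
      if j = k + 1 then tC e N i k (r + s) else 0 := by
  rw [tC, leibniz_lie, h.lie_topF hk (by omega) hi hiN,
    h.lie_topF_succ hk hj (by omega) (Or.inl hkN)]
  congr 1
  · split_ifs
    · rw [h.tC_split hk (by omega) hj hjN, add_zero]
    · rw [zero_lie]
  · split_ifs
    · rw [h.tC_split hi hiN hk (by omega), zero_add]
    · rw [lie_zero]

theorem topF_lie_tC_swap (h : CurrentC e N) {i j k : ℕ} (hi : 1 ≤ i) (hiN : i ≤ N) (hj : 1 ≤ j)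
    (hjN : j ≤ N) (hk : 1 ≤ k) (hkN : k ≤ N) (r s : ℕ) :
    ⁅topF e N i r, tC e N j k s⁆ = ⁅topF e N j 0, tC e N i k (r + s)⁆ := by
  rw [tC, lie_left_comm (h.topF_comm hi hiN hj hjN r 0), h.tC_split hi hiN hk hkN]

theorem topF_zero_lie_tC (h : CurrentC e N) (d : ℕ) : ∀ i j k s, 1 ≤ i → i ≤ N → 1 ≤ j → j ≤ N →
    1 ≤ k → k ≤ N → (N - i) + (N - j) + (N - k) = d → ⁅topF e N i 0, tC e N j k s⁆ = 0 := by
  induction d with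
  | zero =>
    intro i j k s hi hiN hj hjN hk hkN hd
    obtain rfl : i = N := by omega
    obtain rfl : j = i := by omega
    obtain rfl : k = j := by omega
    rw [tC, ← zero_add s, ← h.topF_lie_last hi le_rfl 0 s, topF_self]
    exact h.serre_cubic s
  | succ d ih =>
    have main : ∀ i j k s, 1 ≤ i → i + 1 ≤ N → 1 ≤ j → j ≤ N → 1 ≤ k → k ≤ N →
        (N - i) + (N - j) + (N - k) = d + 1 → ⁅topF e N i 0, tC e N j k s⁆ = 0 := by
      intro i j k s hi hiN hj hjN hk hkN hd
      have h1 := congrArg (fun x => ⁅e i 0, x⁆)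
        (ih (i + 1) j k s (by omega) hiN hj hjN hk hkN (by omega))
      simp only [lie_zero] at h1
      rw [leibniz_lie, h.lie_topF hi (by omega) (by omega) hiN, if_pos rfl,
        h.lie_tC hi hiN hj hjN hk hkN, lie_add, add_zero, zero_add] at h1
      have e1 : ⁅topF e N (i + 1) 0, if j = i + 1 then tC e N i k s else 0⁆ =
          if j = i + 1 then ⁅topF e N i 0, tC e N j k s⁆ else 0 := by
        split_ifs with hji
        · rw [h.topF_lie_tC_swap (by omega) hiN hi (by omega) hk hkN, zero_add, hji]
        · rw [lie_zero]
      have e2 : ⁅topF e N (i + 1) 0, if k = i + 1 then tC e N j i s else 0⁆ =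
          if k = i + 1 then ⁅topF e N i 0, tC e N j k s⁆ else 0 := by
        split_ifs with hji
        · rw [h.tC_symm hj hjN hi (by omega), h.topF_lie_tC_swap (by omega) hiN hi (by omega) hj hjN,
            zero_add, hji, h.tC_symm (by omega) hiN hj hjN]
        · rw [lie_zero]
      rw [e1, e2] at h1
      split_ifs at h1
      · exact h.three _ (by rw [← h1]; abel)
      · exact h.two _ (by rw [← h1]; abel)
      · exact h.two _ (by rw [← h1]; abel)
      · simpa using h1
    intro i j k s hi hiN hj hjN hk hkN hd
    by_cases h1 : i + 1 ≤ N
    · exact main i j k s hi h1 hj hjN hk hkN hd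
    by_cases h2 : j + 1 ≤ N
    · rw [h.topF_lie_tC_swap hi hiN hj hjN hk hkN]
      exact main j i k _ hj h2 hi hiN hk hkN (by omega)
    · rw [h.tC_symm hj hjN hk hkN, h.topF_lie_tC_swap hi hiN hk hkN hj hjN]
      exact main k i j _ hk (by omega) hi hiN hj hjN (by omega)

theorem topF_lie_tC (h : CurrentC e N) {i j k : ℕ} (hi : 1 ≤ i) (hiN : i ≤ N) (hj : 1 ≤ j)
    (hjN : j ≤ N) (hk : 1 ≤ k) (hkN : k ≤ N) (r s : ℕ) :
    ⁅topF e N i r, tC e N j k s⁆ = 0 := by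
  rw [h.topF_lie_tC_swap hi hiN hj hjN hk hkN]
  exact h.topF_zero_lie_tC _ j i k _ hj hjN hi hiN hk hkN rfl

theorem lie_last_tC (h : CurrentC e N) {i j : ℕ} (hi : 1 ≤ i) (hiN : i ≤ N) (hj : 1 ≤ j)
    (hjN : j ≤ N) (r s : ℕ) : ⁅e (N + 1) r, tC e N i j s⁆ = 0 := by
  have gg : ∀ {i j} (_ : 1 ≤ i) (_ : i ≤ N) (_ : 1 ≤ j) (_ : j ≤ N) (a b : ℕ),
      ⁅topF e (N + 1) i a, topF e (N + 1) j b⁆ = ⁅tC e N i j (a + b), e (N + 1) 0⁆ := by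
    intro i j hi hiN hj hjN a b
    rw [← add_zero a, ← h.topF_lie_last hi hiN, add_zero,
      lie_lie_comm (h.lie_last_topF_succ hj (by omega) _ _), h.tC_split hi hiN hj hjN]
  rw [tC, leibniz_lie, h.lie_last_topF_succ hj (by omega), lie_zero, add_zero, lie_swap (e _ r),
    h.topF_lie_last hi hiN, neg_lie, gg hi hiN hj hjN, neg_eq_zero]
  apply h.two
  nth_rw 1 [← gg hi hiN hj hjN, lie_swap, gg hj hjN hi hiN, h.tC_symm hj hjN hi hiN,
    add_comm s]
  exact neg_add_cancel _

end CurrentC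
end TypeC

/-! ### Current relations of type `D` -/

section TypeD
variable {L : Type*} [LieRing L]

/-- The generators with the two end nodes `N` and `N + 1` of type `D_{N+1}` identified with the
second one. -/
def altE (e : ℕ → ℕ → L) (N k r : ℕ) : L := if k = N then e (N + 1) r else e k r

/-- The relations of the current algebra of type `D_{N+1}` (positive part). -/
structure CurrentD (e : ℕ → ℕ → L) (N : ℕ) : Prop extends CurrentA e N where
  pos : 1 ≤ N
  alt : CurrentA (altE e N) N
  comm_last : ∀ r s, ⁅e N r, e (N + 1) s⁆ = 0

/-- The root vectors of the roots `[i,n]` in type `D`. -/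
def gD (e : ℕ → ℕ → L) (N i s : ℕ) : L := topF (altE e N) N i s

/-- The root vectors of the roots `[i,n,j]` in type `D`. -/
def tD (e : ℕ → ℕ → L) (N i j s : ℕ) : L := ⁅topF e N i 0, gD e N j s⁆

theorem strF_altE (e : ℕ → ℕ → L) {N i : ℕ} (l : ℕ) (hN : i + l + 1 ≤ N) (s : ℕ) :
    strF (altE e N) i l s = strF e i l s := by
  induction l with
  | zero => exact if_neg (by omega)
  | succ l ih =>
    show ⁅strF (altE e N) i l s, altE e N (i + l + 1) 0⁆ = ⁅strF e i l s, e (i + l + 1) 0⁆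
    rw [ih (by omega), altE, if_neg (by omega)]

theorem gD_self (e : ℕ → ℕ → L) (N s : ℕ) : gD e N N s = e (N + 1) s := by
  rw [gD, topF_self, altE, if_pos rfl]

namespace CurrentD
variable {e : ℕ → ℕ → L} {N : ℕ}

theorem gD_last (h : CurrentD e N) {i : ℕ} (hi : 1 ≤ i) (hiN : i + 1 ≤ N) (r s : ℕ) :
    ⁅strF e i (N - 1 - i) r, e (N + 1) s⁆ = gD e N i (r + s) := by
  rw [gD, ← h.alt.topF_last hi hiN, strF_altE _ _ (by omega), altE, if_pos rfl]

theorem strF_lie_last (h : CurrentD e N) {i l : ℕ} (hi : 1 ≤ i) (hl : i + l + 2 ≤ N) (s r : ℕ) :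
    ⁅strF e i l s, e (N + 1) r⁆ = 0 := by
  have := h.alt.strF_lie_other (i := i) (l := l) (k := N) hi (by omega) h.pos le_rfl (by omega)
    (by omega) s r
  rwa [strF_altE _ _ (by omega), altE, if_pos rfl] at this

theorem lie_gD (h : CurrentD e N) {k i : ℕ} (hk : 1 ≤ k) (hkN : k + 1 ≤ N) (hi : 1 ≤ i)
    (hiN : i ≤ N) (r s : ℕ) :
    ⁅e k r, gD e N i s⁆ = if i = k + 1 then gD e N k (r + s) else 0 := by
  have := h.alt.lie_topF hk (by omega) hi hiN r s
  rwa [altE, if_neg (by omega)] at this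

theorem gD_comm (h : CurrentD e N) {i j : ℕ} (hi : 1 ≤ i) (hiN : i ≤ N) (hj : 1 ≤ j)
    (hjN : j ≤ N) (r s : ℕ) : ⁅gD e N i r, gD e N j s⁆ = 0 :=
  h.alt.topF_comm hi hiN hj hjN r s

theorem lie_last_gD (h : CurrentD e N) {i : ℕ} (hi : 1 ≤ i) (hiN : i ≤ N) (r s : ℕ) :
    ⁅e (N + 1) r, gD e N i s⁆ = 0 := by
  rw [← gD_self e N r]; exact h.gD_comm h.pos le_rfl hi hiN r s

/-- In type `A`, truncated strings commute with full strings. -/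
theorem _root_.CurrentA.strF_comm_topF {e : ℕ → ℕ → L} {N : ℕ} (h : CurrentA e N) {i j : ℕ}
    (hi : 1 ≤ i) (hiN : i + 1 ≤ N) (hj : 1 ≤ j) (hjN : j + 1 ≤ N) (r s : ℕ) :
    ⁅strF e i (N - 1 - i) r, topF e N j s⁆ = 0 := by
  have main : ∀ {i j} (_ : 1 ≤ i) (_ : i + 1 ≤ N) (_ : j ≤ i) (_ : 1 ≤ j) (r s : ℕ),
      ⁅strF e i (N - 1 - i) r, topF e N j s⁆ = 0 := fun {i j} hi hiN hji hj r s =>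
    lie_comm_zero (h.strF_comm hj (by omega) hji _ (by omega) s r)
  rcases le_total j i with hji | hij
  · exact main hi hiN hji hj r s
  · have cc : ⁅strF e i (N - 1 - i) r, strF e j (N - 1 - j) s⁆ = 0 :=
      h.strF_comm hi (by omega) hij _ (by omega) r s
    rw [← add_zero s, ← h.topF_last hj hjN, lie_left_comm cc, h.topF_last hi hiN, main hj hjN hij hi]

theorem strF_comm_gD (h : CurrentD e N) {i j : ℕ} (hi : 1 ≤ i) (hiN : i + 1 ≤ N) (hj : 1 ≤ j)
    (hjN : j + 1 ≤ N) (r s : ℕ) : ⁅strF e i (N - 1 - i) r, gD e N j s⁆ = 0 := by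
  rw [← strF_altE e (N := N) (i := i) (N - 1 - i) (by omega)]
  exact h.alt.strF_comm_topF hi hiN hj hjN r s

theorem topF_lie_gD (h : CurrentD e N) {i j : ℕ} (hi : 1 ≤ i) (hiN : i + 1 ≤ N) (hj : 1 ≤ j)
    (hjN : j + 1 ≤ N) (a a' b c : ℕ) :
    ⁅topF e N i (a + a'), gD e N j (b + c)⁆ = -⁅topF e N j (b + a'), gD e N i (a + c)⁆ := by
  rw [← h.gD_last hj hjN,
    lie_left_comm (lie_comm_zero (h.strF_comm_topF hj hjN hi hiN _ _)),
    ← h.topF_last hi hiN, lie_lie_comm (h.comm_last _ _), h.gD_last hi hiN, leibniz_lie,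
    h.strF_comm_gD hj hjN hi hiN, zero_lie, zero_add, h.topF_last hj hjN, lie_swap]

theorem topF_lie_last (h : CurrentD e N) {i : ℕ} (hi : 1 ≤ i) (hiN : i + 1 ≤ N) (a a' c : ℕ) :
    ⁅topF e N i (a + a'), e (N + 1) c⁆ = -⁅e N a', gD e N i (a + c)⁆ := by
  rw [← h.topF_last hi hiN, lie_lie_comm (h.comm_last _ _), h.gD_last hi hiN, lie_swap]

theorem tD_split_swap (h : CurrentD e N) {i j : ℕ} (hi : 1 ≤ i) (hiN : i ≤ N) (hj : 1 ≤ j)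
    (hjN : j ≤ N) (a b : ℕ) :
    ⁅topF e N i a, gD e N j b⁆ = -tD e N j i (a + b) := by
  rcases hiN.eq_or_lt with rfl | hi'
  · rcases hjN.eq_or_lt with rfl | hj'
    · rw [tD, topF_self, gD_self, topF_self, gD_self, h.comm_last, h.comm_last, neg_zero]
    · have := h.topF_lie_last hj hj' b a 0
      have h2 := h.topF_lie_last hj hj' 0 0 (a + b)
      have h3 := h.topF_lie_last hj hj' (a + b) 0 0
      have h4 := h.topF_lie_last hj hj' b 0 a
      have h5 := h.topF_lie_last hj hj' 0 b a
      have h6 := h.topF_lie_last hj hj' 0 (a + b) 0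
      rw [tD, topF_self, gD_self]
      simp only [add_zero, zero_add, add_comm b a] at *
      rw [h2, neg_neg, ← neg_inj, ← this, h3]
  · rcases hjN.eq_or_lt with rfl | hj'
    · have h1 := h.topF_lie_last hi hi' a 0 b
      rw [tD, topF_self, gD_self, ← h1, add_zero]
    · have h1 := h.topF_lie_gD hi hi' hj hj' a 0 0 b
      simpa only [zero_add, add_zero, tD] using h1

theorem tD_antisymm (h : CurrentD e N) {i j : ℕ} (hi : 1 ≤ i) (hiN : i ≤ N) (hj : 1 ≤ j)
    (hjN : j ≤ N) (s : ℕ) : tD e N i j s = -tD e N j i s := by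
  rw [tD, h.tD_split_swap hi hiN hj hjN, zero_add]

theorem tD_split (h : CurrentD e N) {i j : ℕ} (hi : 1 ≤ i) (hiN : i ≤ N) (hj : 1 ≤ j)
    (hjN : j ≤ N) (a b : ℕ) :
    ⁅topF e N i a, gD e N j b⁆ = tD e N i j (a + b) := by
  rw [h.tD_split_swap hi hiN hj hjN, ← h.tD_antisymm hi hiN hj hjN]

theorem lie_tD (h : CurrentD e N) {k i j : ℕ} (hk : 1 ≤ k) (hkN : k + 1 ≤ N) (hi : 1 ≤ i)
    (hiN : i ≤ N) (hj : 1 ≤ j) (hjN : j ≤ N) (r s : ℕ) :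
    ⁅e k r, tD e N i j s⁆ = (if i = k + 1 then tD e N k j (r + s) else 0) +
      if j = k + 1 then tD e N i k (r + s) else 0 := by
  rw [tD, leibniz_lie, h.lie_topF hk (by omega) hi hiN, h.lie_gD hk hkN hj hjN]
  congr 1
  · split_ifs
    · rw [h.tD_split hk (by omega) hj hjN, add_zero]
    · rw [zero_lie]
  · split_ifs
    · rw [h.tD_split hi hiN hk (by omega), zero_add]
    · rw [lie_zero]

theorem topF_lie_tD (h : CurrentD e N) {i j k : ℕ} (hi : 1 ≤ i) (hiN : i ≤ N) (hj : 1 ≤ j)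
    (hjN : j ≤ N) (hk : 1 ≤ k) (hkN : k ≤ N) (r s : ℕ) :
    ⁅topF e N i r, tD e N j k s⁆ = 0 := by
  have sw : ∀ {i j k} (_ : 1 ≤ i) (_ : i ≤ N) (_ : 1 ≤ j) (_ : j ≤ N) (_ : 1 ≤ k) (_ : k ≤ N)
      (r s : ℕ), ⁅topF e N i r, tD e N j k s⁆ = ⁅topF e N j 0, tD e N i k (r + s)⁆ := by
    intro i j k hi hiN hj hjN hk hkN r s
    rw [tD, lie_left_comm (h.topF_comm hi hiN hj hjN r 0), h.tD_split hi hiN hk hkN]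
  have ns : ∀ {i j k} (_ : 1 ≤ j) (_ : j ≤ N) (_ : 1 ≤ k) (_ : k ≤ N)
      (s : ℕ), ⁅topF e N i 0, tD e N j k s⁆ = -⁅topF e N i 0, tD e N k j s⁆ := by
    intro i j k hj hjN hk hkN s
    rw [h.tD_antisymm hj hjN hk hkN, lie_neg]
  have sw0 : ∀ {i j k} (_ : 1 ≤ i) (_ : i ≤ N) (_ : 1 ≤ j) (_ : j ≤ N) (_ : 1 ≤ k) (_ : k ≤ N)
      (s : ℕ), ⁅topF e N i 0, tD e N j k s⁆ = ⁅topF e N j 0, tD e N i k s⁆ := by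
    intro i j k hi hiN hj hjN hk hkN s
    rw [sw hi hiN hj hjN hk hkN, zero_add]
  rw [sw hi hiN hj hjN hk hkN]
  apply h.two
  nth_rw 1 [ns hi hiN hk hkN, sw0 hj hjN hk hkN hi hiN, ns hj hjN hi hiN, neg_neg,
    sw0 hk hkN hi hiN hj hjN, ns hk hkN hj hjN, sw0 hi hiN hj hjN hk hkN]
  exact neg_add_cancel _

theorem lie_last_tD (h : CurrentD e N) {i j : ℕ} (hi : 1 ≤ i) (hiN : i ≤ N) (hj : 1 ≤ j)
    (hjN : j ≤ N) (r s : ℕ) : ⁅e (N + 1) r, tD e N i j s⁆ = 0 := by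
  have sw : ∀ {i j k} (_ : 1 ≤ i) (_ : i ≤ N) (_ : 1 ≤ j) (_ : j ≤ N) (_ : 1 ≤ k) (_ : k ≤ N)
      (r s : ℕ), ⁅gD e N i r, tD e N j k s⁆ = ⁅gD e N k 0, tD e N j i (r + s)⁆ := by
    intro i j k hi hiN hj hjN hk hkN r s
    have hs := h.tD_split hj hjN hk hkN s 0
    rw [add_zero] at hs
    rw [← hs, leibniz_lie, h.gD_comm hi hiN hk hkN, lie_zero, add_zero, lie_swap (gD e N i r),
      h.tD_split hj hjN hi hiN, neg_lie, lie_swap, neg_neg, add_comm s r]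
  have ns : ∀ {i j k} (_ : 1 ≤ j) (_ : j ≤ N) (_ : 1 ≤ k) (_ : k ≤ N)
      (s : ℕ), ⁅gD e N i 0, tD e N j k s⁆ = -⁅gD e N i 0, tD e N k j s⁆ := by
    intro i j k hj hjN hk hkN s
    rw [h.tD_antisymm hj hjN hk hkN, lie_neg]
  have sw0 : ∀ {i j k} (_ : 1 ≤ i) (_ : i ≤ N) (_ : 1 ≤ j) (_ : j ≤ N) (_ : 1 ≤ k) (_ : k ≤ N)
      (s : ℕ), ⁅gD e N i 0, tD e N j k s⁆ = ⁅gD e N k 0, tD e N j i s⁆ := by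
    intro i j k hi hiN hj hjN hk hkN s
    rw [sw hi hiN hj hjN hk hkN, zero_add]
  rw [← gD_self e N r, sw h.pos le_rfl hi hiN hj hjN]
  have hN := h.pos
  apply h.two
  nth_rw 1 [ns hi hiN hN le_rfl, sw0 hj hjN hN le_rfl hi hiN, ns hN le_rfl hj hjN, neg_neg,
    sw0 hi hiN hj hjN hN le_rfl, ns hj hjN hi hiN, sw0 hN le_rfl hi hiN hj hjN]
  exact neg_add_cancel _

end CurrentD
end TypeD

/-! ### Spans closed under brackets -/

section Closure
variable {L : Type*} [LieRing L]

/-- If `S` consists of iterated brackets of elements of `G`, the group generated by `S` contains `G`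
and is stable under bracketing with `G`, then it is closed under brackets. -/
theorem lie_mem_closure {S G : Set L} (hG : ∀ y ∈ G, y ∈ AddSubgroup.closure S)
    (hS : ∀ M : AddSubgroup L, (∀ y ∈ G, y ∈ M) → (∀ x ∈ M, ∀ y ∈ M, ⁅x, y⁆ ∈ M) → ∀ x ∈ S, x ∈ M)
    (hact : ∀ x ∈ S, ∀ y ∈ G, ⁅x, y⁆ ∈ AddSubgroup.closure S) :
    ∀ x ∈ AddSubgroup.closure S, ∀ y ∈ AddSubgroup.closure S,
      ⁅x, y⁆ ∈ AddSubgroup.closure S := by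
  let M : AddSubgroup L :=
    { carrier := {y | y ∈ AddSubgroup.closure S ∧
        ∀ x ∈ AddSubgroup.closure S, ⁅x, y⁆ ∈ AddSubgroup.closure S}
      zero_mem' := ⟨zero_mem _, fun x _ => by rw [lie_zero]; exact zero_mem _⟩
      add_mem' := fun {a b} ha hb => ⟨add_mem ha.1 hb.1, fun x hx => by
        rw [lie_add]; exact add_mem (ha.2 x hx) (hb.2 x hx)⟩
      neg_mem' := fun {a} ha => ⟨neg_mem ha.1, fun x hx => by
        rw [lie_neg]; exact neg_mem (ha.2 x hx)⟩ }
  have hGM : ∀ y ∈ G, y ∈ M := fun y hy => ⟨hG y hy, fun x hx => by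
    induction hx using AddSubgroup.closure_induction with
    | mem x hx => exact hact x hx y hy
    | zero => rw [zero_lie]; exact zero_mem _
    | add a b _ _ ha hb => rw [add_lie]; exact add_mem ha hb
    | neg a _ ha => rw [neg_lie]; exact neg_mem ha⟩
  have hSM := hS M hGM (fun x hx y hy => ⟨hy.2 x hx.1, fun z hz => by
    rw [leibniz_lie, lie_swap x]
    exact add_mem (hy.2 _ (hx.2 z hz)) (neg_mem (hx.2 _ (hy.2 z hz)))⟩)
  intro x hx y hy
  have : AddSubgroup.closure S ≤ M := (AddSubgroup.closure_le _).2 hSM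
  exact (this hy).2 x hx

/-- The generators with colors in `[1, n]`. -/
def genSet (e : ℕ → ℕ → L) (n : ℕ) : Set L := {x | ∃ k r, 1 ≤ k ∧ k ≤ n ∧ x = e k r}

/-- The root vectors in type `C_{N+1}`. -/
inductive BasC (e : ℕ → ℕ → L) (N : ℕ) : L → Prop
  | str (i l s : ℕ) : 1 ≤ i → i + l ≤ N → BasC e N (strF e i l s)
  | top (i s : ℕ) : 1 ≤ i → i ≤ N + 1 → BasC e N (topF e (N + 1) i s)
  | pair (i j s : ℕ) : 1 ≤ i → i ≤ j → j ≤ N → BasC e N (tC e N i j s)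

/-- The root vectors in type `D_{N+1}`. -/
inductive BasD (e : ℕ → ℕ → L) (N : ℕ) : L → Prop
  | str (i l s : ℕ) : 1 ≤ i → i + l ≤ N → BasD e N (strF e i l s)
  | top (i s : ℕ) : 1 ≤ i → i ≤ N → BasD e N (gD e N i s)
  | pair (i j s : ℕ) : 1 ≤ i → i < j → j ≤ N → BasD e N (tD e N i j s)

theorem strF_mem {e : ℕ → ℕ → L} {n : ℕ} {M : AddSubgroup L} (hG : ∀ y ∈ genSet e n, y ∈ M)
    (hM : ∀ x ∈ M, ∀ y ∈ M, ⁅x, y⁆ ∈ M) {i l : ℕ} (hi : 1 ≤ i) (hl : i + l ≤ n) (s : ℕ) :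
    strF e i l s ∈ M := by
  induction l with
  | zero => exact hG _ ⟨i, s, hi, hl, rfl⟩
  | succ l ih => exact hM _ (ih (by omega)) _ (hG _ ⟨i + l + 1, 0, by omega, hl, rfl⟩)

/-- The span of the root vectors of type `C` is closed under brackets. -/
theorem CurrentC.lie_mem {e : ℕ → ℕ → L} {N : ℕ} (h : CurrentC e N) :
    ∀ x ∈ AddSubgroup.closure {x | BasC e N x}, ∀ y ∈ AddSubgroup.closure {x | BasC e N x},
      ⁅x, y⁆ ∈ AddSubgroup.closure {x | BasC e N x} := by
  have B : ∀ {x}, BasC e N x → x ∈ AddSubgroup.closure {x | BasC e N x} := fun hx =>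
    AddSubgroup.subset_closure hx
  have Bt : ∀ i j s, 1 ≤ i → i ≤ N → 1 ≤ j → j ≤ N →
      tC e N i j s ∈ AddSubgroup.closure {x | BasC e N x} := by
    intro i j s hi hiN hj hjN
    rcases le_total i j with hij | hij
    · exact B (.pair i j s hi hij hjN)
    · rw [h.tC_symm hi hiN hj hjN]; exact B (.pair j i s hj hij hiN)
  refine lie_mem_closure (G := genSet e (N + 1)) ?_ ?_ ?_
  · rintro _ ⟨k, r, hk, hkN, rfl⟩
    rcases hkN.eq_or_lt with rfl | hk'
    · rw [← topF_self e (N + 1)]; exact B (.top _ _ hk hkN)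
    · exact B (.str k 0 r hk (by omega))
  · intro M hG hM x hx
    rcases hx with ⟨i, l, s, hi, hl⟩ | ⟨i, s, hi, hiN⟩ | ⟨i, j, s, hi, hij, hj⟩
    · exact strF_mem hG hM hi (by omega) s
    · exact strF_mem hG hM hi (by omega) s
    · exact hM _ (strF_mem hG hM hi (by omega) 0) _ (strF_mem hG hM (by omega) (by omega) s)
  · rintro x hx _ ⟨k, r, hk, hkN, rfl⟩
    rcases hx with ⟨i, l, s, hi, hl⟩ | ⟨i, s, hi, hiN⟩ | ⟨i, j, s, hi, hij, hj⟩
    · rcases hkN.eq_or_lt with rfl | hk'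
      · rcases hl.eq_or_lt with hl' | hl'
        · have : strF e i l s = topF e N i s := by rw [topF, ← hl']; congr 1; omega
          rw [this, h.topF_lie_last hi (by omega)]
          exact B (.top _ _ hi (by omega))
        · rw [h.strF_lie_last hi l (by omega)]; exact zero_mem _
      · by_cases h1 : k = i + l + 1
        · subst h1
          rw [h.strF_lie_next hi (by omega)]
          exact B (.str _ _ _ hi (by omega))
        by_cases h2 : k + 1 = i
        · subst h2
          rw [h.strF_lie_prev hk (by omega)]
          exact neg_mem (B (.str _ _ _ hk (by omega)))
        · rw [h.strF_lie_other hi hl hk (by omega) h1 h2]; exact zero_mem _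
    · rw [lie_swap]
      refine neg_mem ?_
      rcases hkN.eq_or_lt with rfl | hk'
      · rw [h.lie_last_topF_succ hi hiN]; exact zero_mem _
      by_cases hc : k + 1 ≤ N ∨ k = N ∧ i = N + 1
      · rw [h.lie_topF_succ hk hi hiN hc]
        split_ifs
        · exact B (.top _ _ hk (by omega))
        · exact zero_mem _
      · obtain rfl : k = N := by omega
        rw [← topF_self e k r, h.tC_split hk le_rfl hi (by omega)]
        exact Bt _ _ _ hk le_rfl hi (by omega)
    · rw [lie_swap]
      refine neg_mem ?_
      rcases hkN.eq_or_lt with rfl | hk'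
      · rw [h.lie_last_tC hi (by omega) (by omega) hj]; exact zero_mem _
      by_cases hc : k + 1 ≤ N
      · rw [h.lie_tC hk hc hi (by omega) (by omega) hj]
        refine add_mem ?_ ?_ <;> split_ifs
        · exact Bt _ _ _ hk (by omega) (by omega) hj
        · exact zero_mem _
        · exact Bt _ _ _ hi (by omega) hk (by omega)
        · exact zero_mem _
      · obtain rfl : k = N := by omega
        rw [← topF_self e k r, h.topF_lie_tC hk le_rfl hi (by omega) (by omega) hj]
        exact zero_mem _

/-- The span of the root vectors of type `D` is closed under brackets. -/
theorem CurrentD.lie_mem {e : ℕ → ℕ → L} {N : ℕ} (h : CurrentD e N) :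
    ∀ x ∈ AddSubgroup.closure {x | BasD e N x}, ∀ y ∈ AddSubgroup.closure {x | BasD e N x},
      ⁅x, y⁆ ∈ AddSubgroup.closure {x | BasD e N x} := by
  have hN := h.pos
  have B : ∀ {x}, BasD e N x → x ∈ AddSubgroup.closure {x | BasD e N x} := fun hx =>
    AddSubgroup.subset_closure hx
  have Bt : ∀ i j s, 1 ≤ i → i ≤ N → 1 ≤ j → j ≤ N →
      tD e N i j s ∈ AddSubgroup.closure {x | BasD e N x} := by
    intro i j s hi hiN hj hjN
    rcases lt_trichotomy i j with hij | rfl | hij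
    · exact B (.pair i j s hi hij hjN)
    · have : tD e N i i s = 0 := h.two _ (by
        nth_rw 1 [h.tD_antisymm hi hiN hi hiN]; exact neg_add_cancel _)
      rw [this]; exact zero_mem _
    · rw [h.tD_antisymm hi hiN hj hjN]; exact neg_mem (B (.pair j i s hj hij hiN))
  refine lie_mem_closure (G := genSet e (N + 1)) ?_ ?_ ?_
  · rintro _ ⟨k, r, hk, hkN, rfl⟩
    rcases hkN.eq_or_lt with rfl | hk'
    · rw [← gD_self e N]; exact B (.top _ _ hN le_rfl)
    · exact B (.str k 0 r hk (by omega))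
  · intro M hG hM x hx
    have hg : ∀ i s, 1 ≤ i → i ≤ N → gD e N i s ∈ M := by
      intro i s hi hiN
      rcases hiN.eq_or_lt with rfl | hi'
      · rw [gD_self]; exact hG _ ⟨i + 1, s, by omega, le_rfl, rfl⟩
      · rw [← zero_add s, ← h.gD_last hi hi']
        exact hM _ (strF_mem hG hM hi (by omega) 0) _ (hG _ ⟨N + 1, s, by omega, le_rfl, rfl⟩)
    rcases hx with ⟨i, l, s, hi, hl⟩ | ⟨i, s, hi, hiN⟩ | ⟨i, j, s, hi, hij, hj⟩
    · exact strF_mem hG hM hi (by omega) s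
    · exact hg i s hi hiN
    · exact hM _ (strF_mem hG hM hi (by omega) 0) _ (hg j s (by omega) hj)
  · rintro x hx _ ⟨k, r, hk, hkN, rfl⟩
    rcases hx with ⟨i, l, s, hi, hl⟩ | ⟨i, s, hi, hiN⟩ | ⟨i, j, s, hi, hij, hj⟩
    · rcases hkN.eq_or_lt with rfl | hk'
      · rcases hl.eq_or_lt with hl' | hl'
        · have : strF e i l s = topF e N i s := by rw [topF, ← hl']; congr 1; omega
          rw [this, ← gD_self e N, h.tD_split hi (by omega) hN le_rfl]
          exact Bt _ _ _ hi (by omega) hN le_rfl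
        by_cases hl2 : i + l + 1 = N
        · have : strF e i l s = strF e i (N - 1 - i) s := by congr 1; omega
          rw [this, h.gD_last hi (by omega)]
          exact B (.top _ _ hi (by omega))
        · rw [h.strF_lie_last hi (by omega)]; exact zero_mem _
      · by_cases h1 : k = i + l + 1
        · subst h1
          rw [h.strF_lie_next hi (by omega)]
          exact B (.str _ _ _ hi (by omega))
        by_cases h2 : k + 1 = i
        · subst h2
          rw [h.strF_lie_prev hk (by omega)]
          exact neg_mem (B (.str _ _ _ hk (by omega)))
        · rw [h.strF_lie_other hi hl hk (by omega) h1 h2]; exact zero_mem _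
    · rw [lie_swap]
      refine neg_mem ?_
      rcases hkN.eq_or_lt with rfl | hk'
      · rw [h.lie_last_gD hi hiN]; exact zero_mem _
      by_cases hc : k + 1 ≤ N
      · rw [h.lie_gD hk hc hi hiN]
        split_ifs
        · exact B (.top _ _ hk (by omega))
        · exact zero_mem _
      · obtain rfl : k = N := by omega
        rw [← topF_self e k r, h.tD_split hk le_rfl hi hiN]
        exact Bt _ _ _ hk le_rfl hi hiN
    · rw [lie_swap]
      refine neg_mem ?_
      rcases hkN.eq_or_lt with rfl | hk'
      · rw [h.lie_last_tD hi (by omega) (by omega) hj]; exact zero_mem _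
      by_cases hc : k + 1 ≤ N
      · rw [h.lie_tD hk hc hi (by omega) (by omega) hj]
        refine add_mem ?_ ?_ <;> split_ifs
        · exact Bt _ _ _ hk (by omega) (by omega) hj
        · exact zero_mem _
        · exact Bt _ _ _ hi (by omega) hk (by omega)
        · exact zero_mem _
      · obtain rfl : k = N := by omega
        rw [← topF_self e k r, h.topF_lie_tD hk le_rfl hi (by omega) (by omega) hj]
        exact zero_mem _

end Closure

/-! ### Root vectors attached to words -/

section Words
attribute [local instance] LieRing.ofAssociativeRing
variable {B : Type} [Ring B] {g : ℕ → ℕ → B}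

/-- Iterated brackets with the letters of a word. -/
def foldBr (g : ℕ → ℕ → B) (x : B) (w ss : List ℕ) : B :=
  (w.zip ss).foldl (fun acc p => ⁅acc, g p.1 p.2⁆) x

theorem foldBr_cons (g : ℕ → ℕ → B) (x : B) (i : ℕ) (w : List ℕ) (s : ℕ) (ss : List ℕ) :
    foldBr g x (i :: w) (s :: ss) = foldBr g ⁅x, g i s⁆ w ss := rfl

theorem foldBr_neg (g : ℕ → ℕ → B) (w ss : List ℕ) (x : B) :
    foldBr g (-x) w ss = -foldBr g x w ss := by
  induction w generalizing x ss with
  | nil => rfl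
  | cons i w ih =>
    cases ss with
    | nil => rfl
    | cons s ss => rw [foldBr_cons, foldBr_cons, neg_lie, ih]

theorem foldBr_append (g : ℕ → ℕ → B) (x : B) (w w' ss ss' : List ℕ)
    (h : w.length = ss.length) :
    foldBr g x (w ++ w') (ss ++ ss') = foldBr g (foldBr g x w ss) w' ss' := by
  simp only [foldBr, List.zip_append h, List.foldl_append]

theorem chainY_cons (g : ℕ → ℕ → B) (i : ℕ) (w : List ℕ) (s : ℕ) (ss : List ℕ) :
    chainY g (i :: w) (s :: ss) = foldBr g (g i s) w ss := rfl

theorem chainY_append (g : ℕ → ℕ → B) (w w' ss ss' : List ℕ)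
    (h : w.length = ss.length) (hw : w ≠ []) :
    chainY g (w ++ w') (ss ++ ss') = foldBr g (chainY g w ss) w' ss' := by
  cases w with
  | nil => exact absurd rfl hw
  | cons i w =>
    cases ss with
    | nil => simp at h
    | cons s ss =>
      rw [List.cons_append, List.cons_append, chainY_cons, chainY_cons, foldBr_append]
      simpa using h

theorem exists_append_of_length {α : Type*} {ss : List α} {a b : ℕ} (h : ss.length = a + b) :
    ∃ s₁ s₂ : List α, ss = s₁ ++ s₂ ∧ s₁.length = a ∧ s₂.length = b :=
  ⟨ss.take a, ss.drop a, (List.take_append_drop a ss).symm, by simp [h], by simp [h]⟩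

theorem CurrentA.foldBr_range' {N : ℕ} (h : CurrentA g N) {i : ℕ} (hi : 1 ≤ i) (m : ℕ) :
    ∀ (l s : ℕ) (ss : List ℕ), i + l + m ≤ N → ss.length = m →
      foldBr g (strF g i l s) (List.range' (i + l + 1) m) ss = strF g i (l + m) (s + ss.sum) := by
  induction m with
  | zero => intro l s ss _ hs; simp [List.length_eq_zero_iff.1 hs, foldBr]
  | succ m ih =>
    intro l s ss hN hs
    obtain ⟨r, ss, rfl⟩ := List.exists_cons_of_length_eq_add_one hs
    rw [List.range'_succ, foldBr_cons, h.strF_lie_next hi (by omega), List.sum_cons, ← add_assoc,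
      ← add_assoc, add_right_comm l m 1]
    exact ih (l + 1) (s + r) ss (by omega) (by simpa using hs)

theorem CurrentA.chainY_range' {N : ℕ} (h : CurrentA g N) {i l : ℕ} (hi : 1 ≤ i) (hN : i + l ≤ N)
    {ss : List ℕ} (hs : ss.length = l + 1) :
    chainY g (List.range' i (l + 1)) ss = strF g i l ss.sum := by
  obtain ⟨r, ss, rfl⟩ := List.exists_cons_of_length_eq_add_one hs
  have := h.foldBr_range' hi l 0 r ss (by omega) (by simpa using hs)
  rw [List.range'_succ, chainY_cons, List.sum_cons]
  simpa [strF] using this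

/-- The root vector of type `C_n` with index `(i, t)`. -/
def canonC (g : ℕ → ℕ → B) (n i t s : ℕ) : B :=
  if i + t < n ∨ i = n then strF g i t s
  else if i + t = n then tC g (n - 1) i i s
  else if i + t = n + 1 then topF g n i s
  else tC g (n - 1) i (2 * n + 1 - i - t) s

/-- The root vector of type `D_n` with index `(i, t)`. -/
def canonD (g : ℕ → ℕ → B) (n i t s : ℕ) : B :=
  if i + t < n ∨ i = n then strF g i t s
  else if i + t = n then gD g (n - 1) i s
  else if i + t = n + 1 then tD g (n - 1) i (n - 1) s
  else tD g (n - 1) i (2 * n - i - t) s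

theorem CurrentC.chainY_top {N : ℕ} (h : CurrentC g N) {i : ℕ} (hi : 1 ≤ i) (hN : i ≤ N)
    {ss : List ℕ} (hs : ss.length = N + 1 - i + 1) :
    chainY g (List.range' i (N + 1 - i + 1)) ss = topF g (N + 1) i ss.sum := by
  obtain ⟨s₁, s₂, rfl, h₁, h₂⟩ := exists_append_of_length hs
  obtain ⟨r, s₂, rfl⟩ := List.exists_cons_of_length_eq_add_one h₂
  obtain rfl : s₂ = [] := by simpa using h₂
  rw [List.range'_concat, chainY_append _ _ _ _ _ (by simp [h₁])
    (by simp only [ne_eq, List.range'_eq_nil_iff]; omega), show N + 1 - i = N - i + 1 by omega,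
    h.chainY_range' hi (by omega) (by omega), foldBr_cons,
    show i + 1 * (N - i + 1) = N + 1 by omega, List.sum_append, List.sum_singleton,
    ← h.topF_lie_last hi hN]
  rfl

theorem CurrentC.foldBr_reverse {N : ℕ} (h : CurrentC g N) {i j : ℕ} (hi : 1 ≤ i) (hij : i < j)
    (m : ℕ) : ∀ (s : ℕ) (ss : List ℕ), j + m ≤ N → ss.length = m →
      foldBr g (tC g N i (j + m) s) (List.range' j m).reverse ss = tC g N i j (s + ss.sum) ∨
      foldBr g (tC g N i (j + m) s) (List.range' j m).reverse ss = -tC g N i j (s + ss.sum) := by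
  induction m with
  | zero => intro s ss _ hs; left; simp [List.length_eq_zero_iff.1 hs, foldBr]
  | succ m ih =>
    intro s ss hN hs
    obtain ⟨r, ss, rfl⟩ := List.exists_cons_of_length_eq_add_one hs
    have key : ⁅tC g N i (j + (m + 1)) s, g (j + m) r⁆ = -tC g N i (j + m) (s + r) := by
      rw [lie_swap, h.lie_tC (by omega) (by omega) hi (by omega) (by omega) (by omega),
        if_neg (by omega), if_pos (by omega), zero_add, add_comm r s]
    rw [List.range'_concat, List.reverse_append, List.reverse_singleton, List.singleton_append,
      one_mul, foldBr_cons, key, foldBr_neg, List.sum_cons, ← add_assoc, neg_inj, neg_eq_iff_eq_neg]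
    exact (ih (s + r) ss (by omega) (by simpa using hs)).symm

theorem CurrentC.foldBr_top {N : ℕ} (h : CurrentC g N) {i j : ℕ} (hi : 1 ≤ i) (hij : i < j)
    (hj : j ≤ N) (s : ℕ) (ss : List ℕ) (hs : ss.length = N + 1 - j) :
      foldBr g (topF g (N + 1) i s) (List.range' j (N + 1 - j)).reverse ss =
        tC g N i j (s + ss.sum) ∨
      foldBr g (topF g (N + 1) i s) (List.range' j (N + 1 - j)).reverse ss =
        -tC g N i j (s + ss.sum) := by
  obtain ⟨m, rfl⟩ := Nat.exists_eq_add_of_le hj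
  rw [show j + m + 1 - j = m + 1 by omega] at hs ⊢
  obtain ⟨r, ss, rfl⟩ := List.exists_cons_of_length_eq_add_one hs
  have key : ⁅topF g (j + m + 1) i s, g (j + m) r⁆ = -tC g (j + m) i (j + m) (s + r) := by
    rw [lie_swap, ← topF_self g (j + m) r, h.tC_split h.pos le_rfl hi (by omega),
      h.tC_symm h.pos le_rfl hi (by omega), add_comm r s]
  rw [List.range'_concat, List.reverse_append, List.reverse_singleton, List.singleton_append,
    one_mul, foldBr_cons, key, foldBr_neg, List.sum_cons, ← add_assoc, neg_inj, neg_eq_iff_eq_neg]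
  exact (h.foldBr_reverse hi hij m (s + r) ss le_rfl (by simpa using hs)).symm

theorem CurrentD.foldBr_reverse {N : ℕ} (h : CurrentD g N) {i j : ℕ} (hi : 1 ≤ i) (hij : i < j)
    (m : ℕ) : ∀ (s : ℕ) (ss : List ℕ), j + m ≤ N → ss.length = m →
      foldBr g (tD g N i (j + m) s) (List.range' j m).reverse ss = tD g N i j (s + ss.sum) ∨
      foldBr g (tD g N i (j + m) s) (List.range' j m).reverse ss = -tD g N i j (s + ss.sum) := by
  induction m with
  | zero => intro s ss _ hs; left; simp [List.length_eq_zero_iff.1 hs, foldBr]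
  | succ m ih =>
    intro s ss hN hs
    obtain ⟨r, ss, rfl⟩ := List.exists_cons_of_length_eq_add_one hs
    have key : ⁅tD g N i (j + (m + 1)) s, g (j + m) r⁆ = -tD g N i (j + m) (s + r) := by
      rw [lie_swap, h.lie_tD (by omega) (by omega) hi (by omega) (by omega) (by omega),
        if_neg (by omega), if_pos (by omega), zero_add, add_comm r s]
    rw [List.range'_concat, List.reverse_append, List.reverse_singleton, List.singleton_append,
      one_mul, foldBr_cons, key, foldBr_neg, List.sum_cons, ← add_assoc, neg_inj, neg_eq_iff_eq_neg]
    exact (ih (s + r) ss (by omega) (by simpa using hs)).symm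

theorem CurrentD.gD_lie {N : ℕ} (h : CurrentD g N) {i : ℕ} (hi : 1 ≤ i) (hN : i ≤ N) (s r : ℕ) :
    ⁅gD g N i s, g N r⁆ = tD g N i N (s + r) := by
  rw [lie_swap, ← topF_self g N r, h.tD_split h.pos le_rfl hi hN, ← h.tD_antisymm hi hN h.pos le_rfl,
    add_comm r s]

theorem CurrentD.foldBr_top {N : ℕ} (h : CurrentD g N) {i j : ℕ} (hi : 1 ≤ i) (hij : i < j)
    (hj : j ≤ N) (s : ℕ) (ss : List ℕ) (hs : ss.length = N + 1 - j) :
      foldBr g (gD g N i s) (List.range' j (N + 1 - j)).reverse ss =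
        tD g N i j (s + ss.sum) ∨
      foldBr g (gD g N i s) (List.range' j (N + 1 - j)).reverse ss =
        -tD g N i j (s + ss.sum) := by
  obtain ⟨m, rfl⟩ := Nat.exists_eq_add_of_le hj
  rw [show j + m + 1 - j = m + 1 by omega] at hs ⊢
  obtain ⟨r, ss, rfl⟩ := List.exists_cons_of_length_eq_add_one hs
  rw [List.range'_concat, List.reverse_append, List.reverse_singleton, List.singleton_append,
    one_mul, foldBr_cons, h.gD_lie hi (by omega), List.sum_cons, ← add_assoc]
  exact h.foldBr_reverse hi hij m (s + r) ss le_rfl (by simpa using hs)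

theorem CurrentD.chainY_top {N : ℕ} (h : CurrentD g N) {i : ℕ} (hi : 1 ≤ i) (hN : i + 1 ≤ N)
    {ss : List ℕ} (hs : ss.length = N - i + 1) :
    chainY g (List.range' i (N - i) ++ [N + 1]) ss = gD g N i ss.sum := by
  obtain ⟨s₁, s₂, rfl, h₁, h₂⟩ := exists_append_of_length hs
  obtain ⟨r, s₂, rfl⟩ := List.exists_cons_of_length_eq_add_one h₂
  obtain rfl : s₂ = [] := by simpa using h₂
  rw [chainY_append _ _ _ _ _ (by simp [h₁])
    (by simp only [ne_eq, List.range'_eq_nil_iff]; omega), show N - i = N - 1 - i + 1 by omega,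
    h.chainY_range' hi (by omega) (by omega), foldBr_cons, List.sum_append, List.sum_singleton,
    ← h.gD_last hi hN]
  rfl

/-- Root vectors of type `C` attached to words, for any distribution of the exponents. -/
theorem CurrentC.chainY_wordC {N : ℕ} (h : CurrentC g N) (β : PosRootC (N + 1))
    (hβ : ¬ isINI β) {ss : List ℕ} (hs : ss.length = (wordC β).length) :
    chainY g (wordC β) ss = canonC g (N + 1) (ri β) (rt β) ss.sum ∨
    chainY g (wordC β) ss = -canonC g (N + 1) (ri β) (rt β) ss.sum := by
  obtain ⟨hb1, hb2, hb3⟩ := β.2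
  change 1 ≤ ri β at hb1
  change ri β = N + 1 → rt β = 0 at hb2
  change rt β + 2 * ri β ≤ 2 * (N + 1) at hb3
  have hβ' : ¬ (ri β + rt β = N + 1 ∧ ri β < N + 1) := hβ
  simp only [wordC] at hs ⊢
  unfold canonC
  generalize ri β = i at *
  generalize rt β = t at *
  by_cases c1 : i + t < N + 1 ∨ i = N + 1
  · rw [if_pos c1] at hs ⊢
    rw [if_pos c1]
    left
    rw [List.length_range'] at hs
    by_cases hi : i = N + 1
    · have ht := hb2 hi
      subst ht
      obtain ⟨r, ss, rfl⟩ := List.exists_cons_of_length_eq_add_one hs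
      obtain rfl : ss = [] := by simpa using hs
      simp [chainY, strF]
    · exact h.chainY_range' hb1 (by omega) hs
  rw [if_neg c1] at hs ⊢
  have c2 : ¬ (i + t = N + 1) := by omega
  rw [if_neg c2] at hs ⊢
  rw [if_neg c1, if_neg c2]
  by_cases c3 : i + t = N + 1 + 1
  · rw [if_pos c3] at hs ⊢
    rw [if_pos c3]
    left
    exact h.chainY_top hb1 (by omega) (by simpa using hs)
  · rw [if_neg c3] at hs ⊢
    rw [if_neg c3]
    rw [List.length_append, List.length_range', List.length_reverse, List.length_range'] at hs
    obtain ⟨s₁, s₂, rfl, h₁, h₂⟩ := exists_append_of_length hs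
    rw [chainY_append _ _ _ _ _ (by simp [h₁])
      (by simp only [ne_eq, List.range'_eq_nil_iff]; omega), h.chainY_top hb1 (by omega) h₁,
      List.sum_append]
    exact h.foldBr_top hb1 (by omega) (by omega) _ _ h₂

/-- Root vectors of type `C` attached to the roots `[i,n,i]`. -/
theorem CurrentC.lie_chainY {N : ℕ} (h : CurrentC g N) (β : PosRootC (N + 1))
    (hβ : isINI β) {β₁ β₂ : PosRootC (N + 1)} (h₁ : ri β₁ = ri β ∧ ri β₁ + rt β₁ + 1 = N + 1)
    (h₂ : ri β₂ = ri β ∧ ri β₂ + rt β₂ = N + 1 + 1) {s₁ s₂ : List ℕ}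
    (hs₁ : s₁.length = (wordC β₁).length) (hs₂ : s₂.length = (wordC β₂).length) :
    ⁅chainY g (wordC β₁) s₁, chainY g (wordC β₂) s₂⁆ =
      canonC g (N + 1) (ri β) (rt β) (s₁.sum + s₂.sum) := by
  obtain ⟨hb1, hb2, hb3⟩ := β.2
  change 1 ≤ ri β at hb1
  have hβ' : ri β + rt β = N + 1 ∧ ri β < N + 1 := hβ
  simp only [wordC] at *
  unfold canonC
  generalize ri β = i at *
  generalize rt β = t at *
  generalize ri β₁ = i₁ at *
  generalize rt β₁ = t₁ at *
  generalize ri β₂ = i₂ at *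
  generalize rt β₂ = t₂ at *
  obtain ⟨rfl, h₁⟩ := h₁
  obtain ⟨rfl, h₂⟩ := h₂
  rw [if_pos (by omega)] at hs₁
  rw [if_neg (by omega), if_neg (by omega), if_pos (by omega)] at hs₂
  rw [if_pos (by omega), if_neg (by omega), if_neg (by omega), if_pos (by omega),
    if_neg (by omega), if_pos (by omega), h.chainY_range' hb1 (by omega) (by simpa using hs₁),
    h.chainY_top hb1 (by omega) (by simpa using hs₂), show t₁ = N - i₂ by omega]
  exact h.tC_split hb1 (by omega) hb1 (by omega) _ _

/-- Root vectors of type `D` attached to words, for any distribution of the exponents. -/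
theorem CurrentD.chainY_wordD {N : ℕ} (h : CurrentD g N) (β : PosRootD (N + 1))
    {ss : List ℕ} (hs : ss.length = (wordD β).length) :
    chainY g (wordD β) ss = canonD g (N + 1) (riD β) (rtD β) ss.sum ∨
    chainY g (wordD β) ss = -canonD g (N + 1) (riD β) (rtD β) ss.sum := by
  have hN := h.pos
  obtain ⟨hb1, hb2, hb3⟩ := β.2
  change 1 ≤ riD β at hb1
  change N + 1 - 1 ≤ riD β → rtD β = 0 at hb2
  change rtD β = 0 ∨ rtD β + 2 * riD β + 1 ≤ 2 * (N + 1) at hb3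
  have hle : riD β ≤ N + 1 := Nat.lt_succ_iff.1 (ofLex β.1).1.2
  simp only [wordD] at hs ⊢
  unfold canonD
  generalize riD β = i at *
  generalize rtD β = t at *
  by_cases c1 : i + t < N + 1 ∨ i = N + 1
  · rw [if_pos c1] at hs ⊢
    rw [if_pos c1]
    left
    rw [List.length_range'] at hs
    by_cases hi : i = N + 1
    · have ht := hb2 (by omega)
      subst ht
      obtain ⟨r, ss, rfl⟩ := List.exists_cons_of_length_eq_add_one hs
      obtain rfl : ss = [] := by simpa using hs
      simp [chainY, strF]
    · exact h.chainY_range' hb1 (by omega) hs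
  rw [if_neg c1] at hs ⊢
  rw [if_neg c1]
  by_cases c2 : i + t = N + 1
  · rw [if_pos c2] at hs ⊢
    rw [if_pos c2]
    left
    exact h.chainY_top hb1 (by omega) (by simpa using hs)
  rw [if_neg c2] at hs ⊢
  rw [if_neg c2]
  by_cases c3 : i + t = N + 1 + 1
  · rw [if_pos c3] at hs ⊢
    rw [if_pos c3]
    left
    have e1 : List.range' i (N + 1 - 1 - i) ++ [N + 1, N + 1 - 1] =
      (List.range' i (N - i) ++ [N + 1]) ++ [N] := by simp
    rw [e1] at hs ⊢
    rw [List.length_append] at hs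
    obtain ⟨s₁, s₂, rfl, h₁, h₂⟩ := exists_append_of_length hs
    obtain ⟨r, s₂, rfl⟩ := List.exists_cons_of_length_eq_add_one h₂
    obtain rfl : s₂ = [] := by simpa using h₂
    rw [chainY_append _ _ _ _ _ h₁.symm (by simp), h.chainY_top hb1 (by omega) (by simpa using h₁),
      List.sum_append, List.sum_singleton, foldBr_cons, h.gD_lie hb1 (by omega)]
    rfl
  · rw [if_neg c3] at hs ⊢
    rw [if_neg c3]
    rw [List.length_append, List.length_reverse, List.length_range'] at hs
    obtain ⟨s₁, s₂, rfl, h₁, h₂⟩ := exists_append_of_length hs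
    rw [chainY_append _ _ _ _ _ h₁.symm (by simp)]
    simp only [Nat.add_sub_cancel] at h₁ ⊢
    rw [h.chainY_top hb1 (by omega) (by simpa using h₁), List.sum_append]
    exact h.foldBr_top hb1 (by omega) (by omega) _ _ h₂

end Words

/-! ### Relations at `ħ = 0` -/

section CurrentRel
attribute [local instance] LieRing.ofAssociativeRing
variable {B : Type} [Ring B] {g : ℕ → ℕ → B}

/-- The defining relations of the positive subalgebra of the Yangian at `ħ = 0`. -/
structure CurrentRel (n : ℕ) (A : ℕ → ℕ → ℤ) (g : ℕ → ℕ → B) : Prop where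
  loop : ∀ i j r s, 1 ≤ i → i ≤ n → 1 ≤ j → j ≤ n → ⁅g i (r + 1), g j s⁆ = ⁅g i r, g j (s + 1)⁆
  serre : ∀ i j, 1 ≤ i → i ≤ n → 1 ≤ j → j ≤ n → i ≠ j →
    ∀ (ss : Fin (1 - A i j).toNat → ℕ) (r : ℕ),
      ∑ σ : Equiv.Perm (Fin (1 - A i j).toNat),
        (List.ofFn fun l => g i (ss (σ l))).foldr (fun a b => a * b - b * a) (g j r) = 0
  torsionFree : ∀ m : ℕ, m ≠ 0 → ∀ x : B, m • x = 0 → x = 0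

namespace CurrentRel
variable {n : ℕ} {A : ℕ → ℕ → ℤ}

theorem two (h : CurrentRel n A g) (x : B) (hx : x + x = 0) : x = 0 :=
  h.torsionFree 2 two_ne_zero x (by rw [two_nsmul, hx])

theorem loop_right (h : CurrentRel n A g) {i j : ℕ} (hi : 1 ≤ i) (hin : i ≤ n) (hj : 1 ≤ j)
    (hjn : j ≤ n) (a b : ℕ) : ⁅g i a, g j b⁆ = ⁅g i 0, g j (a + b)⁆ := by
  have H := fun a b => shift_total (f := fun a b => ⁅g i a, g j b⁆)
    (fun r s => h.loop i j r s hi hin hj hjn) a b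
  exact (H a b).trans (by simpa using (H 0 (a + b)).symm)

theorem comm_self (h : CurrentRel n A g) {i : ℕ} (hi : 1 ≤ i) (hin : i ≤ n) (a b : ℕ) :
    ⁅g i a, g i b⁆ = 0 := by
  apply h.two
  nth_rw 1 [h.loop_right hi hin hi hin a b, lie_swap (g i a), h.loop_right hi hin hi hin b a,
    add_comm b a]
  exact add_neg_cancel _

theorem serre_zero (h : CurrentRel n A g) {i j m : ℕ} (hi : 1 ≤ i) (hin : i ≤ n) (hj : 1 ≤ j)
    (hjn : j ≤ n) (hij : i ≠ j) (hm : (1 - A i j).toNat = m) (t : ℕ) :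
    (List.replicate m (g i 0)).foldr (fun a b => ⁅a, b⁆) (g j t) = 0 := by
  subst hm
  have := h.serre i j hi hin hj hjn hij (fun _ => 0) t
  rw [List.ofFn_const, Finset.sum_const] at this
  exact h.torsionFree _ (Finset.card_ne_zero_of_mem (Finset.mem_univ 1)) _ this

theorem comm (h : CurrentRel n A g) {i j : ℕ} (hi : 1 ≤ i) (hin : i ≤ n) (hj : 1 ≤ j)
    (hjn : j ≤ n) (hij : i ≠ j) (hm : (1 - A i j).toNat = 1) (a b : ℕ) : ⁅g i a, g j b⁆ = 0 := by
  rw [h.loop_right hi hin hj hjn]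
  exact h.serre_zero hi hin hj hjn hij hm _

theorem serre_two (h : CurrentRel n A g) {i j : ℕ} (hi : 1 ≤ i) (hin : i ≤ n) (hj : 1 ≤ j)
    (hjn : j ≤ n) (hij : i ≠ j) (hm : (1 - A i j).toNat = 2) (r s t : ℕ) :
    ⁅g i r, ⁅g i s, g j t⁆⁆ = 0 := by
  rw [h.loop_right hi hin hj hjn s t, lie_left_comm (h.comm_self hi hin r 0),
    h.loop_right hi hin hj hjn r]
  exact h.serre_zero hi hin hj hjn hij hm _

theorem toCurrentC {N : ℕ} (hN : 1 ≤ N) (h : CurrentRel (N + 1) (aC (N + 1)) g) :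
    CurrentC g N where
  two := h.two
  shift i r s hi hiN := h.loop i (i + 1) r s hi (by omega) (by omega) (by omega)
  comm i j r s hi hiN hj hjN h₁ h₂ := by
    by_cases hij : i = j
    · subst hij; exact h.comm_self hi (by omega) r s
    · refine h.comm hi (by omega) hj (by omega) hij ?_ r s
      unfold aC; split_ifs <;> first | rfl | omega
  serre_up i r s t hi hiN := by
    refine h.serre_two hi (by omega) (by omega) (by omega) (by omega) ?_ r s t
    unfold aC; split_ifs <;> first | rfl | omega
  serre_down i r s t hi hiN := by
    refine h.serre_two (by omega) (by omega) hi (by omega) (by omega) ?_ r s t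
    unfold aC; split_ifs <;> first | rfl | omega
  pos := hN
  three x hx := h.torsionFree 3 three_ne_zero x (by rw [← hx]; abel)
  shift_last r s := h.loop N (N + 1) r s hN (by omega) (by omega) le_rfl
  comm_last k r s hk hkN := by
    refine h.comm hk (by omega) (by omega) le_rfl (by omega) ?_ r s
    unfold aC; split_ifs <;> first | rfl | omega
  comm_self r s := h.comm_self (by omega) le_rfl r s
  serre_last r s t := by
    refine h.serre_two (by omega) le_rfl hN (by omega) (by omega) ?_ r s t
    unfold aC; split_ifs <;> first | rfl | omega
  serre_cubic t := by
    refine h.serre_zero (m := 3) hN (by omega) (by omega) le_rfl (by omega) ?_ t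
    unfold aC; split_ifs <;> first | rfl | omega

theorem toCurrentD {N : ℕ} (hN : 2 ≤ N) (h : CurrentRel (N + 1) (aD (N + 1)) g) :
    CurrentD g N where
  two := h.two
  shift i r s hi hiN := h.loop i (i + 1) r s hi (by omega) (by omega) (by omega)
  comm i j r s hi hiN hj hjN h₁ h₂ := by
    by_cases hij : i = j
    · subst hij; exact h.comm_self hi (by omega) r s
    · refine h.comm hi (by omega) hj (by omega) hij ?_ r s
      unfold aD; split_ifs <;> first | rfl | omega
  serre_up i r s t hi hiN := by
    refine h.serre_two hi (by omega) (by omega) (by omega) (by omega) ?_ r s t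
    unfold aD; split_ifs <;> first | rfl | omega
  serre_down i r s t hi hiN := by
    refine h.serre_two (by omega) (by omega) hi (by omega) (by omega) ?_ r s t
    unfold aD; split_ifs <;> first | rfl | omega
  pos := by omega
  comm_last r s := by
    refine h.comm (by omega) (by omega) (by omega) le_rfl (by omega) ?_ r s
    unfold aD; split_ifs <;> first | rfl | omega
  alt :=
    { two := h.two
      shift := fun i r s hi hiN => by
        simp only [altE, if_neg (show i ≠ N by omega)]
        split_ifs
        · exact h.loop i (N + 1) r s hi (by omega) (by omega) le_rfl
        · exact h.loop i (i + 1) r s hi (by omega) (by omega) (by omega)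
      comm := fun i j r s hi hiN hj hjN h₁ h₂ => by
        simp only [altE]
        split_ifs with hi' hj' hj'
        · exact h.comm_self (by omega) le_rfl r s
        · refine h.comm (by omega) le_rfl hj (by omega) (by omega) ?_ r s
          unfold aD; split_ifs <;> first | rfl | omega
        · refine h.comm hi (by omega) (by omega) le_rfl (by omega) ?_ r s
          unfold aD; split_ifs <;> first | rfl | omega
        · by_cases hij : i = j
          · subst hij; exact h.comm_self hi (by omega) r s
          · refine h.comm hi (by omega) hj (by omega) hij ?_ r s
            unfold aD; split_ifs <;> first | rfl | omega
      serre_up := fun i r s t hi hiN => by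
        simp only [altE, if_neg (show i ≠ N by omega)]
        split_ifs
        all_goals
          refine h.serre_two hi (by omega) (by omega) (by omega) (by omega) ?_ r s t
          unfold aD; split_ifs <;> first | rfl | omega
      serre_down := fun i r s t hi hiN => by
        simp only [altE, if_neg (show i ≠ N by omega)]
        split_ifs
        all_goals
          refine h.serre_two (by omega) (by omega) hi (by omega) (by omega) ?_ r s t
          unfold aD; split_ifs <;> first | rfl | omega }

end CurrentRel

theorem exists_posRootC {n i t : ℕ} (h₁ : 1 ≤ i) (h₂ : i = n → t = 0) (h₃ : t + 2 * i ≤ 2 * n) :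
    ∃ β : PosRootC n, ri β = i ∧ rt β = t :=
  ⟨⟨toLex (⟨i, by omega⟩, ⟨t, by omega⟩), h₁, h₂, h₃⟩, rfl, rfl⟩

theorem exists_posRootD {n i t : ℕ} (h₁ : 1 ≤ i) (hi : i ≤ n) (h₂ : n - 1 ≤ i → t = 0)
    (h₃ : t = 0 ∨ t + 2 * i + 1 ≤ 2 * n) : ∃ β : PosRootD n, riD β = i ∧ rtD β = t :=
  ⟨⟨toLex (⟨i, by omega⟩, ⟨t, by omega⟩), h₁, h₂, h₃⟩, rfl, rfl⟩

theorem BasC.exists_root {N : ℕ} {x : B} (h : BasC g N x) :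
    ∃ (β : PosRootC (N + 1)) (s : ℕ), x = canonC g (N + 1) (ri β) (rt β) s := by
  rcases h with ⟨i, l, s, hi, hl⟩ | ⟨i, s, hi, hiN⟩ | ⟨i, j, s, hi, hij, hj⟩
  · obtain ⟨β, hβ, hβ'⟩ := exists_posRootC (n := N + 1) (i := i) (t := l) hi (by omega) (by omega)
    exact ⟨β, s, by rw [hβ, hβ', canonC, if_pos (by omega)]⟩
  · rcases hiN.eq_or_lt with rfl | hlt
    · obtain ⟨β, hβ, hβ'⟩ := exists_posRootC (n := N + 1) (i := N + 1) (t := 0) hi (by omega)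
        (by omega)
      exact ⟨β, s, by rw [hβ, hβ', canonC, if_pos (by omega), topF, Nat.sub_self]⟩
    · obtain ⟨β, hβ, hβ'⟩ := exists_posRootC (n := N + 1) (i := i) (t := N + 2 - i) hi (by omega)
        (by omega)
      exact ⟨β, s, by rw [hβ, hβ', canonC, if_neg (by omega), if_neg (by omega),
        if_pos (by omega)]⟩
  · rcases hij.eq_or_lt with rfl | hlt
    · obtain ⟨β, hβ, hβ'⟩ := exists_posRootC (n := N + 1) (i := i) (t := N + 1 - i) hi (by omega)
        (by omega)
      exact ⟨β, s, by rw [hβ, hβ', canonC, if_neg (by omega), if_pos (by omega)]; rfl⟩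
    · obtain ⟨β, hβ, hβ'⟩ := exists_posRootC (n := N + 1) (i := i) (t := 2 * N + 3 - i - j) hi
        (by omega) (by omega)
      exact ⟨β, s, by rw [hβ, hβ', canonC, if_neg (by omega), if_neg (by omega),
        if_neg (by omega)]; congr 1; omega⟩

theorem BasD.exists_root {N : ℕ} {x : B} (h : BasD g N x) :
    ∃ (β : PosRootD (N + 1)) (s : ℕ), x = canonD g (N + 1) (riD β) (rtD β) s := by
  rcases h with ⟨i, l, s, hi, hl⟩ | ⟨i, s, hi, hiN⟩ | ⟨i, j, s, hi, hij, hj⟩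
  · obtain ⟨β, hβ, hβ'⟩ := exists_posRootD (n := N + 1) (i := i) (t := l) hi (by omega) (by omega)
      (by omega)
    exact ⟨β, s, by rw [hβ, hβ', canonD, if_pos (by omega)]⟩
  · rcases hiN.eq_or_lt with rfl | hlt
    · obtain ⟨β, hβ, hβ'⟩ := exists_posRootD (n := i + 1) (i := i + 1) (t := 0) (by omega) le_rfl
        (by omega) (by omega)
      exact ⟨β, s, by rw [hβ, hβ', canonD, if_pos (by omega), gD_self]; rfl⟩
    · obtain ⟨β, hβ, hβ'⟩ := exists_posRootD (n := N + 1) (i := i) (t := N + 1 - i) hi (by omega)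
        (by omega) (by omega)
      exact ⟨β, s, by rw [hβ, hβ', canonD, if_neg (by omega), if_pos (by omega)]; rfl⟩
  · rcases hj.eq_or_lt with rfl | hlt
    · obtain ⟨β, hβ, hβ'⟩ := exists_posRootD (n := j + 1) (i := i) (t := j + 2 - i) hi (by omega)
        (by omega) (by omega)
      exact ⟨β, s, by rw [hβ, hβ', canonD, if_neg (by omega), if_neg (by omega),
        if_pos (by omega)]; rfl⟩
    · obtain ⟨β, hβ, hβ'⟩ := exists_posRootD (n := N + 1) (i := i) (t := 2 * N + 2 - i - j) hi
        (by omega) (by omega) (by omega)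
      exact ⟨β, s, by rw [hβ, hβ', canonD, if_neg (by omega), if_neg (by omega),
        if_neg (by omega)]; congr 1; omega⟩

theorem basC_canonC {N : ℕ} (β : PosRootC (N + 1)) (s : ℕ) :
    BasC g N (canonC g (N + 1) (ri β) (rt β) s) ∨
      ri β = N + 1 ∧ canonC g (N + 1) (ri β) (rt β) s = topF g (N + 1) (N + 1) s := by
  obtain ⟨hb1, hb2, hb3⟩ := β.2
  change 1 ≤ ri β at hb1
  change ri β = N + 1 → rt β = 0 at hb2
  change rt β + 2 * ri β ≤ 2 * (N + 1) at hb3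
  unfold canonC
  generalize ri β = i at *
  generalize rt β = t at *
  by_cases hi : i = N + 1
  · rw [if_pos (by omega), hb2 hi, hi, topF_self]
    exact Or.inr ⟨rfl, rfl⟩
  left
  split_ifs
  · exact .str i t s hb1 (by omega)
  · exact .pair i i s hb1 le_rfl (by omega)
  · exact .top i s hb1 (by omega)
  · exact .pair i _ s hb1 (by omega) (by omega)

theorem canonC_mem {N : ℕ} (β : PosRootC (N + 1)) (s : ℕ) :
    BasC g N (canonC g (N + 1) (ri β) (rt β) s) := by
  rcases basC_canonC (g := g) β s with h | ⟨_, h⟩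
  · exact h
  · rw [h]; exact .top _ _ (by omega) le_rfl

theorem canonD_mem {N : ℕ} (hN : 1 ≤ N) (β : PosRootD (N + 1)) (s : ℕ) :
    BasD g N (canonD g (N + 1) (riD β) (rtD β) s) := by
  obtain ⟨hb1, hb2, hb3⟩ := β.2
  change 1 ≤ riD β at hb1
  change N + 1 - 1 ≤ riD β → rtD β = 0 at hb2
  change rtD β = 0 ∨ rtD β + 2 * riD β + 1 ≤ 2 * (N + 1) at hb3
  have hle : riD β ≤ N + 1 := Nat.lt_succ_iff.1 (ofLex β.1).1.2
  unfold canonD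
  generalize riD β = i at *
  generalize rtD β = t at *
  by_cases hi : i = N + 1
  · rw [if_pos (by omega), hb2 (by omega), hi]
    have : strF g (N + 1) 0 s = gD g N N s := (gD_self g N s).symm
    rw [this]
    exact .top N s hN le_rfl
  split_ifs
  · exact .str i t s hb1 (by omega)
  · exact .top i s hb1 (by omega)
  · exact .pair i _ s hb1 (by omega) (by omega)
  · exact .pair i _ s hb1 (by omega) (by omega)

end CurrentRel

/-! ### Formal brackets -/

/-- Formal iterated brackets of generators. -/
inductive BrTree : Type
  | leaf (i r : ℕ) : BrTree
  | node (a b : BrTree) : BrTree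

/-- The value of a formal bracket. -/
def BrTree.eval {B : Type} [Ring B] (g : ℕ → ℕ → B) : BrTree → B
  | leaf i r => g i r
  | node a b => a.eval g * b.eval g - b.eval g * a.eval g

/-- The total exponent of a formal bracket. -/
def BrTree.deg : BrTree → ℕ
  | leaf _ r => r
  | node a b => a.deg + b.deg

theorem BrTree.map_eval {B B' : Type} [Ring B] [Ring B'] (f : B →+* B') (g : ℕ → ℕ → B)
    (τ : BrTree) : f (τ.eval g) = τ.eval fun i r => f (g i r) := by
  induction τ with
  | leaf i r => rfl
  | node a b iha ihb => simp only [eval, map_sub, map_mul, iha, ihb]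

theorem exists_foldBr_tree (w : List ℕ) : ∀ (τ : BrTree) (ss : List ℕ), ss.length = w.length →
    ∃ τ' : BrTree, τ'.deg = τ.deg + ss.sum ∧
      ∀ (B : Type) [Ring B] (g : ℕ → ℕ → B), τ'.eval g = foldBr g (τ.eval g) w ss := by
  induction w with
  | nil => intro τ ss hs; exact ⟨τ, by simp [List.length_eq_zero_iff.1 hs], fun _ _ _ => rfl⟩
  | cons i w ih =>
    intro τ ss hs
    obtain ⟨r, ss, rfl⟩ := List.exists_cons_of_length_eq_add_one hs
    obtain ⟨τ', h, h'⟩ := ih (.node τ (.leaf i r)) ss (by simpa using hs)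
    exact ⟨τ', by rw [h, List.sum_cons, ← add_assoc]; rfl, fun B _ g => h' B g⟩

theorem exists_chainY_tree (w ss : List ℕ) (h : ss.length = w.length) :
    ∃ τ : BrTree, τ.deg = ss.sum ∧
      ∀ (B : Type) [Ring B] (g : ℕ → ℕ → B), τ.eval g = chainY g w ss := by
  cases w with
  | nil =>
    rw [List.length_eq_zero_iff.1 h]
    exact ⟨.node (.leaf 0 0) (.leaf 0 0), rfl, fun B _ g => sub_self _⟩
  | cons i w =>
    obtain ⟨r, ss, rfl⟩ := List.exists_cons_of_length_eq_add_one h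
    obtain ⟨τ, h₁, h₂⟩ := exists_foldBr_tree w (.leaf i r) ss (by simpa using h)
    exact ⟨τ, h₁, fun B _ g => h₂ B g⟩

/-- The formal bracket `τ` is, up to sign, the root vector `x` as soon as the relations at `ħ = 0`
hold. -/
def BrTree.Represents (n : ℕ) (A : ℕ → ℕ → ℤ) (c : ∀ (B : Type) [Ring B], (ℕ → ℕ → B) → B)
    (τ : BrTree) : Prop :=
  ∀ (B : Type) [Ring B] (g : ℕ → ℕ → B), CurrentRel n A g →
    τ.eval g = c B g ∨ τ.eval g = -c B g

theorem IsRVYC.exists_tree {N : ℕ} (hN : 1 ≤ N) {β : PosRootC (N + 1)} {s : ℕ} {E : YC (N + 1)}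
    (hE : IsRVYC β s E) :
    ∃ τ : BrTree, τ.deg = s ∧ τ.eval (genYC (N + 1)) = E ∧ τ.Represents (N + 1) (aC (N + 1))
      fun _ _ g => canonC g (N + 1) (ri β) (rt β) s := by
  unfold IsRVYC at hE
  split_ifs at hE with hβ
  · obtain ⟨β₁, β₂, _, _, _, _, h₁, h₂, ⟨ss₁, l₁, rfl, rfl⟩, ⟨ss₂, l₂, rfl, rfl⟩, rfl, rfl⟩ := hE
    obtain ⟨τ₁, d₁, e₁⟩ := exists_chainY_tree _ _ l₁
    obtain ⟨τ₂, d₂, e₂⟩ := exists_chainY_tree _ _ l₂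
    refine ⟨.node τ₁ τ₂, by rw [BrTree.deg, d₁, d₂], by rw [BrTree.eval, e₁, e₂], fun B _ g h => ?_⟩
    left
    rw [BrTree.eval, e₁, e₂]
    exact (h.toCurrentC hN).lie_chainY β hβ h₁ h₂ l₁ l₂
  · obtain ⟨ss, l, rfl, rfl⟩ := hE
    obtain ⟨τ, d, e⟩ := exists_chainY_tree _ _ l
    refine ⟨τ, d, e _ _, fun B _ g h => ?_⟩
    rw [e]
    exact (h.toCurrentC hN).chainY_wordC β hβ l

theorem IsRVYD.exists_tree {N : ℕ} (hN : 2 ≤ N) {β : PosRootD (N + 1)} {s : ℕ} {E : YD (N + 1)}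
    (hE : IsRVYD β s E) :
    ∃ τ : BrTree, τ.deg = s ∧ τ.eval (genYD (N + 1)) = E ∧ τ.Represents (N + 1) (aD (N + 1))
      fun _ _ g => canonD g (N + 1) (riD β) (rtD β) s := by
  obtain ⟨ss, l, rfl, rfl⟩ := hE
  obtain ⟨τ, d, e⟩ := exists_chainY_tree _ _ l
  refine ⟨τ, d, e _ _, fun B _ g h => ?_⟩
  rw [e]
  exact (h.toCurrentD hN).chainY_wordD β l

/-! ### Ordered monomials span -/

section OrderedMonomials
variable {G : Type} [Ring G] {ι : Type}

/-- The group generated by the products of at most `k` elements of the family `E`. -/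
def wordSpan (E : ι → G) (k : ℕ) : AddSubgroup G :=
  AddSubgroup.closure {x | ∃ l : List ι, l.length ≤ k ∧ x = (l.map E).prod}

theorem mul_mem_wordSpan (E : ι → G) {k : ℕ} {y : G} (hy : y ∈ wordSpan E k) (p : ι) :
    E p * y ∈ wordSpan E (k + 1) := by
  induction hy using AddSubgroup.closure_induction with
  | mem x hx =>
    obtain ⟨l, hl, rfl⟩ := hx
    exact AddSubgroup.subset_closure ⟨p :: l, by simpa using hl, by simp⟩
  | zero => rw [mul_zero]; exact zero_mem _
  | add a b _ _ ha hb => rw [mul_add]; exact add_mem ha hb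
  | neg a _ ha => rw [mul_neg]; exact neg_mem ha

theorem perm_sub_mem {E : ι → G}
    (hE : ∀ p q, E p * E q - E q * E p ∈ AddSubgroup.closure (Set.range E)) {l l' : List ι}
    (h : l.Perm l') : ∀ k, l.length ≤ k + 1 →
      (l.map E).prod - (l'.map E).prod ∈ wordSpan E k := by
  induction h with
  | nil => intro k _; rw [sub_self]; exact zero_mem _
  | @cons p l l' hl ih =>
    intro k hk
    rw [List.map_cons, List.map_cons, List.prod_cons, List.prod_cons, ← mul_sub]
    rw [List.length_cons] at hk
    rcases k with _ | k
    · obtain rfl : l = [] := List.length_eq_zero_iff.1 (by omega)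
      rw [List.nil_perm.1 hl, sub_self, mul_zero]
      exact zero_mem _
    · exact mul_mem_wordSpan E (ih k (by omega)) p
  | swap p q l =>
    intro k hk
    simp only [List.map_cons, List.prod_cons, ← mul_assoc, ← sub_mul]
    have := hE q p
    generalize E q * E p - E p * E q = c at this ⊢
    induction this using AddSubgroup.closure_induction with
    | mem x hx =>
      obtain ⟨r, rfl⟩ := hx
      exact AddSubgroup.subset_closure ⟨r :: l, by simpa using hk, by simp⟩
    | zero => rw [zero_mul]; exact zero_mem _
    | add a b _ _ ha hb => rw [add_mul]; exact add_mem ha hb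
    | neg a _ ha => rw [neg_mul]; exact neg_mem ha
  | trans h₁ _ ih₁ ih₂ =>
    intro k hk
    rw [← sub_add_sub_cancel]
    exact add_mem (ih₁ k hk) (ih₂ k (h₁.length_eq ▸ hk))

variable [LinearOrder ι]

/-- The increasing list of the factors of an ordered monomial. -/
def sortList (h : ι →₀ ℕ) : List ι :=
  (h.support.sort (· ≤ ·)).flatMap fun p => List.replicate (h p) p

theorem ordMon_eq_prod (E : ι → G) (h : ι →₀ ℕ) : ordMon E h = ((sortList h).map E).prod := by
  unfold ordMon sortList
  generalize h.support.sort (· ≤ ·) = l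
  induction l with
  | nil => rfl
  | cons p l ih =>
    rw [List.map_cons, List.prod_cons, List.flatMap_cons, List.map_append, List.prod_append, ih,
      List.map_replicate, List.prod_replicate]

theorem coe_sortList (h : ι →₀ ℕ) : (sortList h : Multiset ι) = Finsupp.toMultiset h := by
  classical
  have : ∀ l : List ι, ((l.flatMap fun p => List.replicate (h p) p : List ι) : Multiset ι) =
      (l.map fun p => h p • ({p} : Multiset ι)).sum := by
    intro l
    induction l with
    | nil => rfl
    | cons p l ih =>
      rw [List.flatMap_cons, List.map_cons, List.sum_cons, ← Multiset.coe_add, ih,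
        Multiset.nsmul_singleton, Multiset.coe_replicate]
  rw [sortList, this, Finsupp.toMultiset_apply, Finsupp.sum, ← Finset.sum_map_toList]
  exact ((Finset.sort_perm_toList _ _).map _).sum_eq

theorem exists_sortList_perm (l : List ι) : ∃ h : ι →₀ ℕ, (sortList h).Perm l := by
  classical
  refine ⟨Multiset.toFinsupp (l : Multiset ι), Multiset.coe_eq_coe.1 ?_⟩
  rw [coe_sortList, Multiset.toFinsupp_toMultiset]

/-- If the span of a family is closed under commutators, ordered monomials span all products. -/
theorem prod_mem_ordMon {E : ι → G}
    (hE : ∀ p q, E p * E q - E q * E p ∈ AddSubgroup.closure (Set.range E)) (l : List ι) :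
    (l.map E).prod ∈ AddSubgroup.closure (Set.range (ordMon E)) := by
  have key : ∀ k, ∀ l : List ι, l.length ≤ k →
      (l.map E).prod ∈ AddSubgroup.closure (Set.range (ordMon E)) := by
    intro k
    induction k with
    | zero =>
      intro l hl
      rw [List.length_eq_zero_iff.1 (Nat.le_zero.1 hl)]
      exact AddSubgroup.subset_closure ⟨0, by simp [ordMon]⟩
    | succ k ih =>
      intro l hl
      obtain ⟨h, hh⟩ := exists_sortList_perm l
      have h₁ := perm_sub_mem hE hh.symm k hl
      have h₂ : wordSpan E k ≤ AddSubgroup.closure (Set.range (ordMon E)) :=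
        (AddSubgroup.closure_le _).2 fun x ⟨l, hl, hx⟩ => hx ▸ ih l hl
      have h₃ : ((sortList h).map E).prod ∈ AddSubgroup.closure (Set.range (ordMon E)) :=
        AddSubgroup.subset_closure ⟨h, ordMon_eq_prod E h⟩
      rw [← sub_add_cancel (l.map E).prod ((sortList h).map E).prod]
      exact add_mem (h₂ h₁) h₃
  exact key _ l le_rfl

end OrderedMonomials

/-! ### The loop filtration and its Rees ring -/

section Rees
variable {Y : Type} [Ring Y] [Algebra RH Y] (n : ℕ) (y : ℕ → ℕ → Y)

/-- The span of the words in the generators of total exponent smaller than `d`. -/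
def loopFil (d : ℕ) : Submodule RH Y :=
  Submodule.span RH {x | ∃ l : List (ℕ × ℕ), (∀ p ∈ l, 1 ≤ p.1 ∧ p.1 ≤ n) ∧
    (l.map Prod.snd).sum < d ∧ x = (l.map fun p => y p.1 p.2).prod}

variable {n y}

theorem loopFil_zero : loopFil n y 0 = ⊥ := by
  rw [loopFil, Submodule.span_eq_bot]
  rintro x ⟨l, -, hl, -⟩
  exact absurd hl (Nat.not_lt_zero _)

theorem prod_mem_loopFil {l : List (ℕ × ℕ)} (hl : ∀ p ∈ l, 1 ≤ p.1 ∧ p.1 ≤ n) {d : ℕ}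
    (h : (l.map Prod.snd).sum < d) : (l.map fun p => y p.1 p.2).prod ∈ loopFil n y d :=
  Submodule.subset_span ⟨l, hl, h, rfl⟩

theorem mul_mem_loopFil {a b c : ℕ} (h : a + b ≤ c + 1) {x x' : Y}
    (hx : x ∈ loopFil n y a) (hx' : x' ∈ loopFil n y b) : x * x' ∈ loopFil n y c := by
  induction hx using Submodule.span_induction with
  | mem x hx =>
    obtain ⟨l, hl, hd, rfl⟩ := hx
    induction hx' using Submodule.span_induction with
    | mem x' hx' =>
      obtain ⟨l', hl', hd', rfl⟩ := hx'
      rw [← List.prod_append, ← List.map_append]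
      refine prod_mem_loopFil (fun p hp => ?_) (by rw [List.map_append, List.sum_append]; omega)
      exact (List.mem_append.1 hp).elim (hl p) (hl' p)
    | zero => rw [mul_zero]; exact zero_mem _
    | add x x' _ _ h₁ h₂ => rw [mul_add]; exact add_mem h₁ h₂
    | smul r x _ h₁ => rw [mul_smul_comm]; exact Submodule.smul_mem _ _ h₁
  | zero => rw [zero_mul]; exact zero_mem _
  | add x x' _ _ h₁ h₂ => rw [add_mul]; exact add_mem h₁ h₂
  | smul r x _ h₁ => rw [smul_mul_assoc]; exact Submodule.smul_mem _ _ h₁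

theorem gen_mem_loopFil {i : ℕ} (hi : 1 ≤ i ∧ i ≤ n) (r : ℕ) : y i r ∈ loopFil n y (r + 1) := by
  have := prod_mem_loopFil (n := n) (y := y) (l := [(i, r)]) (d := r + 1) (by simpa using hi)
    (by simp)
  simpa using this

theorem one_mem_loopFil : (1 : Y) ∈ loopFil n y 1 := by
  have := prod_mem_loopFil (n := n) (y := y) (l := []) (d := 1) (by simp) (by simp)
  simpa using this

variable (n y)

/-- The Rees ring of the loop filtration. -/
def reesRing : Subring (Polynomial Y) where
  carrier := {f | ∀ d, f.coeff d ∈ loopFil n y (d + 1)}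
  mul_mem' {f f'} hf hf' d := by
    rw [Polynomial.coeff_mul]
    refine sum_mem fun p hp => mul_mem_loopFil ?_ (hf p.1) (hf' p.2)
    have := Finset.HasAntidiagonal.mem_antidiagonal.1 hp
    omega
  one_mem' d := by
    rw [Polynomial.coeff_one]
    split_ifs with h
    · subst h; exact one_mem_loopFil
    · exact zero_mem _
  add_mem' {f f'} hf hf' d := by
    rw [Polynomial.coeff_add]; exact add_mem (hf d) (hf' d)
  zero_mem' d := by rw [Polynomial.coeff_zero]; exact zero_mem _
  neg_mem' {f} hf d := by rw [Polynomial.coeff_neg]; exact neg_mem (hf d)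

/-- Equality up to lower terms of the loop filtration, in each degree. -/
def reesCon : RingCon (reesRing n y) where
  r f f' := ∀ d, (f - f' : Polynomial Y).coeff d ∈ loopFil n y d
  iseqv :=
    { refl := fun f d => by rw [sub_self, Polynomial.coeff_zero]; exact zero_mem _
      symm := fun {f f'} h d => by
        rw [← neg_sub, Polynomial.coeff_neg]; exact neg_mem (h d)
      trans := fun {f f' f''} h h' d => by
        rw [← sub_add_sub_cancel (f : Polynomial Y) f' f'', Polynomial.coeff_add]
        exact add_mem (h d) (h' d) }
  add' := fun {f f' k k'} h h' d => by
    rw [Subring.coe_add, Subring.coe_add, add_sub_add_comm, Polynomial.coeff_add]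
    exact add_mem (h d) (h' d)
  mul' := fun {f f' k k'} h h' d => by
    have : (f * k : Polynomial Y) - f' * k' = f * (k - k') + (f - f') * k' := by
      rw [mul_sub, sub_mul]; abel
    rw [Subring.coe_mul, Subring.coe_mul, this, Polynomial.coeff_add, Polynomial.coeff_mul,
      Polynomial.coeff_mul]
    refine add_mem (sum_mem fun p hp => ?_) (sum_mem fun p hp => ?_)
    · have := Finset.HasAntidiagonal.mem_antidiagonal.1 hp
      exact mul_mem_loopFil (by omega) (f.2 p.1) (h' p.2)
    · have := Finset.HasAntidiagonal.mem_antidiagonal.1 hp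
      exact mul_mem_loopFil (by omega) (h p.1) (k'.2 p.2)

/-- The homogeneous generators of the Rees ring. -/
def reesGen (i r : ℕ) : reesRing n y :=
  if h : 1 ≤ i ∧ i ≤ n then ⟨Polynomial.monomial r (y i r), fun d => by
    rw [Polynomial.coeff_monomial]
    split_ifs with hd
    · subst hd; exact gen_mem_loopFil h _
    · exact zero_mem _⟩ else 0

variable {n y}

theorem reesGen_of {i : ℕ} (hi : 1 ≤ i ∧ i ≤ n) (r : ℕ) :
    (reesGen n y i r : Polynomial Y) = Polynomial.monomial r (y i r) := by
  rw [reesGen, dif_pos hi]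

theorem reesCon_eq_zero {f : reesRing n y} :
    (reesCon n y).mk' f = 0 ↔ ∀ d, (f : Polynomial Y).coeff d ∈ loopFil n y d := by
  have := RingCon.eq (reesCon n y) (a := f) (b := 0)
  refine this.trans (forall_congr' fun d => ?_)
  rw [Subring.coe_zero, sub_zero]

theorem map_sub_of_map_add {R S : Type*} [Ring R] [Ring S] {f : R → S}
    (hadd : ∀ a b, f (a + b) = f a + f b) (a b : R) : f (a - b) = f a - f b := by
  rw [eq_sub_iff_add_eq, ← hadd, sub_add_cancel]

theorem map_foldr_comm {R S : Type*} [Ring R] [Ring S] {f : R → S}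
    (hmul : ∀ a b, f (a * b) = f a * f b) (hsub : ∀ a b, f (a - b) = f a - f b)
    (l : List R) (x : R) :
    f (l.foldr (fun a b => a * b - b * a) x) =
      (l.map f).foldr (fun a b => a * b - b * a) (f x) := by
  induction l with
  | nil => rfl
  | cons a l ih => simp only [List.foldr_cons, List.map_cons, hsub, hmul, ih]

theorem foldr_comm_monomial {R : Type*} [Ring R] (m : ℕ) (s : Fin m → ℕ) (x : Fin m → R) (r : ℕ)
    (z : R) :
    (List.ofFn fun l => Polynomial.monomial (s l) (x l)).foldr (fun a b => a * b - b * a)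
        (Polynomial.monomial r z) =
      Polynomial.monomial (∑ l, s l + r)
        ((List.ofFn x).foldr (fun a b => a * b - b * a) z) := by
  induction m with
  | zero => simp
  | succ m ih =>
    rw [List.ofFn_succ, List.ofFn_succ, List.foldr_cons, List.foldr_cons, ih,
      Polynomial.monomial_mul_monomial, Polynomial.monomial_mul_monomial, Fin.sum_univ_succ,
      map_sub, ← add_assoc, add_comm (∑ i : Fin m, s i.succ + r) (s 0), ← add_assoc]

theorem mem_of_nsmul_mem (M : Submodule RH Y) {m : ℕ} (hm : m ≠ 0) {x : Y}
    (h : m • x ∈ M) : x ∈ M := by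
  have h' := M.smul_mem (Polynomial.C ((m : ℚ)⁻¹)) h
  rwa [← Nat.cast_smul_eq_nsmul RH, smul_smul, ← Polynomial.C_eq_natCast, ← Polynomial.C_mul,
    inv_mul_cancel₀ (by exact_mod_cast hm), Polynomial.C_1, one_smul] at h'

/-- The relations of the positive part of the Yangian for a family of elements. -/
structure YangRel (n : ℕ) (A : ℕ → ℕ → ℤ) (y : ℕ → ℕ → Y) : Prop where
  loop : ∀ i j r s, 1 ≤ i → i ≤ n → 1 ≤ j → j ≤ n → ∃ c : ℚ,
    (y i (r + 1) * y j s - y j s * y i (r + 1)) - (y i r * y j (s + 1) - y j (s + 1) * y i r) =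
      (Polynomial.C c * hbar) • (y i r * y j s + y j s * y i r)
  serre : ∀ i j, 1 ≤ i → i ≤ n → 1 ≤ j → j ≤ n → i ≠ j →
    ∀ (ss : Fin (1 - A i j).toNat → ℕ) (r : ℕ), ∑ σ : Equiv.Perm (Fin (1 - A i j).toNat),
      (List.ofFn fun l => y i (ss (σ l))).foldr (fun a b => a * b - b * a) (y j r) = 0

attribute [local instance] LieRing.ofAssociativeRing in
/-- The exact current relations hold up to lower terms. -/
theorem YangRel.currentRel {A : ℕ → ℕ → ℤ} (hy : YangRel n A y) :
    CurrentRel n A fun i r => (reesCon n y).mk' (reesGen n y i r) where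
  loop i j r s hi hin hj hjn := by
    rw [LieRing.of_associative_ring_bracket, LieRing.of_associative_ring_bracket, ← sub_eq_zero]
    simp only [← map_mul, ← map_sub]
    refine reesCon_eq_zero.2 fun d => ?_
    have e₁ : r + 1 + s = r + s + 1 := by omega
    have e₂ : s + (r + 1) = r + s + 1 := by omega
    have e₃ : r + (s + 1) = r + s + 1 := by omega
    have e₄ : s + 1 + r = r + s + 1 := by omega
    simp only [AddSubgroupClass.coe_sub, Subring.coe_mul, reesGen_of ⟨hi, hin⟩, reesGen_of ⟨hj, hjn⟩,
      Polynomial.monomial_mul_monomial, e₁, e₂, e₃, e₄]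
    simp only [← map_sub]
    obtain ⟨c, hc⟩ := hy.loop i j r s hi hin hj hjn
    rw [hc, Polynomial.coeff_monomial]
    split_ifs with hd
    · subst hd
      exact Submodule.smul_mem _ _ (add_mem
        (mul_mem_loopFil (by omega) (gen_mem_loopFil ⟨hi, hin⟩ _) (gen_mem_loopFil ⟨hj, hjn⟩ _))
        (mul_mem_loopFil (by omega) (gen_mem_loopFil ⟨hj, hjn⟩ _) (gen_mem_loopFil ⟨hi, hin⟩ _)))
    · exact zero_mem _
  serre i j hi hin hj hjn hij ss r := by
    have h : ∀ σ : Equiv.Perm (Fin (1 - A i j).toNat),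
        (List.ofFn fun l => (reesCon n y).mk' (reesGen n y i (ss (σ l)))).foldr
          (fun a b => a * b - b * a) ((reesCon n y).mk' (reesGen n y j r)) =
        (reesCon n y).mk' ((List.ofFn fun l => reesGen n y i (ss (σ l))).foldr
          (fun a b => a * b - b * a) (reesGen n y j r)) := by
      intro σ
      rw [map_foldr_comm (map_mul _) (map_sub _), List.map_ofFn]
      rfl
    simp only [h, ← map_sum]
    refine reesCon_eq_zero.2 fun d => ?_
    have h' : ∀ σ : Equiv.Perm (Fin (1 - A i j).toNat),
        (((List.ofFn fun l => reesGen n y i (ss (σ l))).foldr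
          (fun a b => a * b - b * a) (reesGen n y j r) : reesRing n y) : Polynomial Y) =
        Polynomial.monomial (∑ l, ss l + r)
          ((List.ofFn fun l => y i (ss (σ l))).foldr (fun a b => a * b - b * a) (y j r)) := by
      intro σ
      rw [← Equiv.sum_comp σ, ← foldr_comm_monomial _ (fun l => ss (σ l)),
        map_foldr_comm (f := ((↑) : reesRing n y → Polynomial Y)) (fun _ _ => rfl)
          (fun _ _ => rfl), List.map_ofFn, reesGen_of ⟨hj, hjn⟩]
      congr 2
      funext l
      exact reesGen_of ⟨hi, hin⟩ _
    rw [AddSubmonoidClass.coe_finsetSum, Finset.sum_congr rfl fun σ _ => h' σ, ← map_sum,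
      hy.serre i j hi hin hj hjn hij ss r, map_zero, Polynomial.coeff_zero]
    exact zero_mem _
  torsionFree m hm x hx := by
    obtain ⟨f, rfl⟩ := (reesCon n y).mk'_surjective x
    rw [← map_nsmul] at hx
    refine reesCon_eq_zero.2 fun d => ?_
    have := reesCon_eq_zero.1 hx d
    rw [AddSubmonoidClass.coe_nsmul, Polynomial.coeff_smul] at this
    exact mem_of_nsmul_mem _ hm this

theorem coe_list_prod_map {ι : Type} {E : ι → reesRing n y} {k : ι → ℕ} {e : ι → Y}
    (h : ∀ p, (E p : Polynomial Y) = Polynomial.monomial (k p) (e p)) (l : List ι) :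
    ((l.map E).prod : Polynomial Y) =
      Polynomial.monomial (l.map k).sum (l.map e).prod := by
  induction l with
  | nil => rfl
  | cons p l ih =>
    simp only [List.map_cons, List.prod_cons, List.sum_cons, Subring.coe_mul, h, ih,
      Polynomial.monomial_mul_monomial]

theorem coe_eval_reesGen (hy : ∀ i r, ¬(1 ≤ i ∧ i ≤ n) → y i r = 0) (τ : BrTree) :
    ((τ.eval (reesGen n y) : reesRing n y) : Polynomial Y) = Polynomial.monomial τ.deg (τ.eval y) := by
  induction τ with
  | leaf i r =>
    by_cases hi : 1 ≤ i ∧ i ≤ n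
    · exact reesGen_of hi r
    · change ((reesGen n y i r : reesRing n y) : Polynomial Y) = Polynomial.monomial r (y i r)
      rw [hy i r hi, map_zero, reesGen, dif_neg hi]
      rfl
  | node a b iha ihb =>
    change ((a.eval (reesGen n y) * b.eval (reesGen n y) - b.eval (reesGen n y) *
      a.eval (reesGen n y) : reesRing n y) : Polynomial Y) = Polynomial.monomial (a.deg + b.deg)
        (a.eval y * b.eval y - b.eval y * a.eval y)
    rw [AddSubgroupClass.coe_sub, Subring.coe_mul, Subring.coe_mul, iha, ihb,
      Polynomial.monomial_mul_monomial, Polynomial.monomial_mul_monomial, map_sub,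
      add_comm b.deg]

theorem mul_mem_ordMon {G : Type} [Ring G] {ι : Type} [LinearOrder ι] {E : ι → G}
    (hE : ∀ p q, E p * E q - E q * E p ∈ AddSubgroup.closure (Set.range E)) {a b : G}
    (ha : a ∈ AddSubgroup.closure (Set.range E))
    (hb : b ∈ AddSubgroup.closure (Set.range (ordMon E))) :
    a * b ∈ AddSubgroup.closure (Set.range (ordMon E)) := by
  induction ha using AddSubgroup.closure_induction with
  | mem a ha =>
    obtain ⟨p, rfl⟩ := ha
    induction hb using AddSubgroup.closure_induction with
    | mem b hb =>
      obtain ⟨h, rfl⟩ := hb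
      rw [ordMon_eq_prod]
      simpa using prod_mem_ordMon hE (p :: sortList h)
    | zero => rw [mul_zero]; exact zero_mem _
    | add a b _ _ ha hb => rw [mul_add]; exact add_mem ha hb
    | neg a _ ha => rw [mul_neg]; exact neg_mem ha
  | zero => rw [zero_mul]; exact zero_mem _
  | add a b _ _ ha hb => rw [add_mul]; exact add_mem ha hb
  | neg a _ ha => rw [neg_mul]; exact neg_mem ha

/-- Ordered monomials span if they do so for the associated graded relations. -/
theorem span_ordMon_eq_top (hy : ∀ i r, ¬(1 ≤ i ∧ i ≤ n) → y i r = 0)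
    (htop : ∀ x, ∃ d, x ∈ loopFil n y d) {ι : Type} [LinearOrder ι] (τ : ι → BrTree)
    (hbr : ∀ p q, ((τ p).eval fun i r => (reesCon n y).mk' (reesGen n y i r)) *
        ((τ q).eval fun i r => (reesCon n y).mk' (reesGen n y i r)) -
        ((τ q).eval fun i r => (reesCon n y).mk' (reesGen n y i r)) *
        ((τ p).eval fun i r => (reesCon n y).mk' (reesGen n y i r)) ∈ AddSubgroup.closure
          (Set.range fun p => (τ p).eval fun i r => (reesCon n y).mk' (reesGen n y i r)))
    (hgen : ∀ i r, 1 ≤ i → i ≤ n → (reesCon n y).mk' (reesGen n y i r) ∈ AddSubgroup.closure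
      (Set.range fun p => (τ p).eval fun i r => (reesCon n y).mk' (reesGen n y i r))) :
    Submodule.span RH (Set.range (ordMon fun p => (τ p).eval y)) = ⊤ := by
  set M := Submodule.span RH (Set.range (ordMon fun p => (τ p).eval y)) with hM
  have hword : ∀ l : List (ℕ × ℕ), (∀ p ∈ l, 1 ≤ p.1 ∧ p.1 ≤ n) →
      (l.map fun p => (reesCon n y).mk' (reesGen n y p.1 p.2)).prod ∈ AddSubgroup.closure
        (Set.range (ordMon fun p => (τ p).eval fun i r =>
          (reesCon n y).mk' (reesGen n y i r))) := by
    intro l hl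
    induction l with
    | nil => exact prod_mem_ordMon hbr []
    | cons p l ih =>
      rw [List.map_cons, List.prod_cons]
      have hp := hl p List.mem_cons_self
      exact mul_mem_ordMon hbr (hgen _ _ hp.1 hp.2)
        (ih fun q hq => hl q (List.mem_cons_of_mem _ hq))
  have hlift : ∀ x ∈ AddSubgroup.closure (Set.range (ordMon fun p => (τ p).eval fun i r =>
      (reesCon n y).mk' (reesGen n y i r))), ∃ f : reesRing n y, (reesCon n y).mk' f = x ∧
        ∀ d, (f : Polynomial Y).coeff d ∈ M := by
    intro x hx
    induction hx using AddSubgroup.closure_induction with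
    | mem x hx =>
      obtain ⟨h, rfl⟩ := hx
      refine ⟨ordMon (fun p => (τ p).eval (reesGen n y)) h, ?_, fun d => ?_⟩
      · rw [ordMon_eq_prod, ordMon_eq_prod, map_list_prod, List.map_map]
        congr 2
        funext p
        exact BrTree.map_eval _ _ _
      · rw [ordMon_eq_prod, coe_list_prod_map fun p => coe_eval_reesGen hy (τ p),
          ← ordMon_eq_prod, Polynomial.coeff_monomial]
        split_ifs
        · exact Submodule.subset_span ⟨h, rfl⟩
        · exact zero_mem _
    | zero => exact ⟨0, map_zero _, fun d => zero_mem _⟩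
    | add a b _ _ ha hb =>
      obtain ⟨f, rfl, hf⟩ := ha
      obtain ⟨f', rfl, hf'⟩ := hb
      refine ⟨f + f', map_add _ _ _, fun d => ?_⟩
      rw [Subring.coe_add, Polynomial.coeff_add]
      exact add_mem (hf d) (hf' d)
    | neg a _ ha =>
      obtain ⟨f, rfl, hf⟩ := ha
      refine ⟨-f, map_neg _ _, fun d => ?_⟩
      rw [NegMemClass.coe_neg, Polynomial.coeff_neg]
      exact neg_mem (hf d)
  have key : ∀ d, loopFil n y d ≤ M := by
    intro d
    induction d with
    | zero => rw [loopFil_zero]; exact bot_le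
    | succ d ih =>
      refine Submodule.span_le.2 ?_
      rintro x ⟨l, hl, hd, rfl⟩
      rcases Nat.lt_succ_iff_lt_or_eq.1 hd with hd | hd
      · exact ih (prod_mem_loopFil hl hd)
      · obtain ⟨f, hf, hfM⟩ := hlift _ (hword l hl)
        have h₁ : (reesCon n y).mk' (f - (l.map fun p => reesGen n y p.1 p.2).prod) = 0 := by
          rw [map_sub, hf, map_list_prod, List.map_map, sub_eq_zero]
          rfl
        have h₂ := ih (reesCon_eq_zero.1 h₁ d)
        have h₃ : ∀ p : ℕ × ℕ, (reesGen n y p.1 p.2 : Polynomial Y) =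
            Polynomial.monomial p.2 (y p.1 p.2) := fun p =>
          coe_eval_reesGen hy (.leaf p.1 p.2)
        rw [AddSubgroupClass.coe_sub, coe_list_prod_map h₃, Polynomial.coeff_sub,
          Polynomial.coeff_monomial, if_pos hd] at h₂
        have := sub_mem (hfM d) h₂
        rwa [sub_sub_cancel] at this
  refine Submodule.eq_top_iff'.2 fun x => ?_
  obtain ⟨d, hd⟩ := htop x
  exact key d hd

theorem loopFil_mono {a b : ℕ} (h : a ≤ b) : loopFil n y a ≤ loopFil n y b :=
  Submodule.span_mono fun _ ⟨l, hn, hl, hx⟩ => ⟨l, hn, hl.trans_le h, hx⟩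

end Rees

section Relations
variable {n : ℕ} {A : ℕ → ℕ → ℤ} {Dd : ℕ → ℕ}

theorem gy1_eq {i : ℕ} (hi : 1 ≤ i ∧ i ≤ n) (r : ℕ) :
    gy1 n A Dd i r = RingQuot.mkAlgHom RH (YRel n A Dd) (fy n ⟨i - 1, by omega⟩ r) :=
  dif_pos hi

theorem yangRel_gy1 : YangRel n A (gy1 n A Dd) := by
  have hmul : ∀ a b : FAY n, RingQuot.mkAlgHom RH (YRel n A Dd) (a * b) =
      RingQuot.mkAlgHom RH (YRel n A Dd) a * RingQuot.mkAlgHom RH (YRel n A Dd) b :=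
    map_mul _
  have hadd : ∀ a b : FAY n, RingQuot.mkAlgHom RH (YRel n A Dd) (a + b) =
      RingQuot.mkAlgHom RH (YRel n A Dd) a + RingQuot.mkAlgHom RH (YRel n A Dd) b :=
    map_add _
  have hsub : ∀ a b : FAY n, RingQuot.mkAlgHom RH (YRel n A Dd) (a - b) =
      RingQuot.mkAlgHom RH (YRel n A Dd) a - RingQuot.mkAlgHom RH (YRel n A Dd) b := 
    map_sub_of_map_add (f := fun a : FAY n => RingQuot.mkAlgHom RH (YRel n A Dd) a) hadd
  constructor
  · intro i j r s hi hin hj hjn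
    have := RingQuot.mkAlgHom_rel RH (YRel.loop (A := A) (Dd := Dd) (⟨i - 1, by omega⟩ : Fin n)
      ⟨j - 1, by omega⟩ r s)
    rw [map_smul, hadd, hsub, hsub, hsub, hmul, hmul, hmul, hmul, hmul, hmul] at this
    simp only [gy1_eq ⟨hi, hin⟩, gy1_eq ⟨hj, hjn⟩]
    exact ⟨_, this⟩
  · intro i j hi hin hj hjn hij ss r
    obtain ⟨i, rfl⟩ := Nat.exists_eq_add_of_le' hi
    obtain ⟨j, rfl⟩ := Nat.exists_eq_add_of_le' hj
    have := RingQuot.mkAlgHom_rel RH (YRel.serre (A := A) (Dd := Dd) (⟨i, hin⟩ : Fin n)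
      ⟨j, hjn⟩ (by simpa using hij) ss r)
    rw [map_sum, map_zero] at this
    rw [← this]
    refine Finset.sum_congr rfl fun σ _ => ?_
    have e := map_foldr_comm (f := fun a : FAY n => RingQuot.mkAlgHom RH (YRel n A Dd) a) hmul
      hsub (List.ofFn fun l => fy n ⟨i, hin⟩ (ss (σ l))) (fy n ⟨j, hjn⟩ r)
    rw [List.map_ofFn] at e
    simp only [gy1_eq ⟨hi, hin⟩, gy1_eq ⟨hj, hjn⟩]
    exact e.symm

theorem exists_mem_loopFil_gy1 (x : YA n A Dd) : ∃ d, x ∈ loopFil n (gy1 n A Dd) d := by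
  obtain ⟨f, rfl⟩ := RingQuot.mkAlgHom_surjective RH (YRel n A Dd) x
  induction f using FreeAlgebra.induction with
  | grade0 r =>
    refine ⟨1, ?_⟩
    rw [AlgHom.commutes, Algebra.algebraMap_eq_smul_one]
    exact Submodule.smul_mem _ _ one_mem_loopFil
  | grade1 p =>
    have h : 1 ≤ p.1.1 + 1 ∧ p.1.1 + 1 ≤ n := ⟨Nat.le_add_left _ _, p.1.2⟩
    refine ⟨p.2 + 1, ?_⟩
    have := gen_mem_loopFil (y := gy1 n A Dd) h p.2
    rwa [gy1_eq h] at this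
  | mul a b ha hb =>
    obtain ⟨d, hd⟩ := ha
    obtain ⟨d', hd'⟩ := hb
    refine ⟨d + d', ?_⟩
    rw [map_mul]
    exact mul_mem_loopFil (Nat.le_succ _) hd hd'
  | add a b ha hb =>
    obtain ⟨d, hd⟩ := ha
    obtain ⟨d', hd'⟩ := hb
    refine ⟨d + d', ?_⟩
    rw [map_add]
    exact add_mem (loopFil_mono (Nat.le_add_right _ _) hd)
      (loopFil_mono (Nat.le_add_left _ _) hd')

theorem gy1_eq_zero {i : ℕ} (r : ℕ) (hi : ¬(1 ≤ i ∧ i ≤ n)) : gy1 n A Dd i r = 0 :=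
  dif_neg hi

end Relations

/-! ### The ordered monomials span -/

section Span

theorem closure_range_eq {G : Type} [AddCommGroup G] {ι : Type} {S : Set G} {E c : ι → G}
    (hE : ∀ p, E p = c p ∨ E p = -c p) (hS : ∀ x ∈ S, ∃ p, x = c p) (hc : ∀ p, c p ∈ S) :
    AddSubgroup.closure (Set.range E) = AddSubgroup.closure S := by
  refine le_antisymm ((AddSubgroup.closure_le _).2 ?_) ((AddSubgroup.closure_le _).2 fun x hx => ?_)
  · rintro _ ⟨p, rfl⟩
    rcases hE p with h | h <;> rw [h]
    · exact AddSubgroup.subset_closure (hc p)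
    · exact neg_mem (AddSubgroup.subset_closure (hc p))
  · obtain ⟨p, rfl⟩ := hS x hx
    have := AddSubgroup.subset_closure (G := G) (Set.mem_range_self (f := E) p)
    rcases hE p with h | h
    · rwa [h] at this
    · rw [h] at this; exact neg_mem_iff.1 this

attribute [local instance] LieRing.ofAssociativeRing

variable {Y : Type} [Ring Y] [Algebra RH Y] {N : ℕ} {y : ℕ → ℕ → Y}

theorem span_ordMonC (hN : 1 ≤ N) (hyr : YangRel (N + 1) (aC (N + 1)) y)
    (hy : ∀ i r, ¬(1 ≤ i ∧ i ≤ N + 1) → y i r = 0) (htop : ∀ x, ∃ d, x ∈ loopFil (N + 1) y d)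
    (τ : Lex (PosRootC (N + 1) × ℕ) → BrTree)
    (hτ : ∀ p, (τ p).Represents (N + 1) (aC (N + 1)) fun _ _ g =>
      canonC g (N + 1) (ri (ofLex p).1) (rt (ofLex p).1) (ofLex p).2) :
    Submodule.span RH (Set.range (ordMon fun p => (τ p).eval y)) = ⊤ := by
  have hg := hyr.currentRel
  have h := hg.toCurrentC hN
  have hcl := closure_range_eq (fun p => hτ p _ _ hg)
    (fun x (hx : BasC _ N x) => (BasC.exists_root hx).elim fun β ⟨s, hs⟩ => ⟨toLex (β, s), hs⟩)
    fun p => canonC_mem (ofLex p).1 (ofLex p).2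
  refine span_ordMon_eq_top hy htop τ (fun p q => ?_) fun i r hi hin => ?_
  · rw [hcl]
    exact h.lie_mem _ (hcl ▸ AddSubgroup.subset_closure ⟨p, rfl⟩) _
      (hcl ▸ AddSubgroup.subset_closure ⟨q, rfl⟩)
  · rw [hcl]
    refine AddSubgroup.subset_closure ?_
    rcases hin.eq_or_lt with rfl | hlt
    · have := BasC.top (e := fun i r => (reesCon (N + 1) y).mk'
        (reesGen (N + 1) y i r)) (N := N) (N + 1) r hi le_rfl
      rwa [topF_self] at this
    · exact .str i 0 r hi (by omega)

theorem span_ordMonD (hN : 2 ≤ N) (hyr : YangRel (N + 1) (aD (N + 1)) y)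
    (hy : ∀ i r, ¬(1 ≤ i ∧ i ≤ N + 1) → y i r = 0) (htop : ∀ x, ∃ d, x ∈ loopFil (N + 1) y d)
    (τ : Lex (PosRootD (N + 1) × ℕ) → BrTree)
    (hτ : ∀ p, (τ p).Represents (N + 1) (aD (N + 1)) fun _ _ g =>
      canonD g (N + 1) (riD (ofLex p).1) (rtD (ofLex p).1) (ofLex p).2) :
    Submodule.span RH (Set.range (ordMon fun p => (τ p).eval y)) = ⊤ := by
  have hg := hyr.currentRel
  have h := hg.toCurrentD hN
  have hcl := closure_range_eq (fun p => hτ p _ _ hg)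
    (fun x (hx : BasD _ N x) => (BasD.exists_root hx).elim fun β ⟨s, hs⟩ => ⟨toLex (β, s), hs⟩)
    fun p => canonD_mem (by omega) (ofLex p).1 (ofLex p).2
  refine span_ordMon_eq_top hy htop τ (fun p q => ?_) fun i r hi hin => ?_
  · rw [hcl]
    exact h.lie_mem _ (hcl ▸ AddSubgroup.subset_closure ⟨p, rfl⟩) _
      (hcl ▸ AddSubgroup.subset_closure ⟨q, rfl⟩)
  · rw [hcl]
    refine AddSubgroup.subset_closure ?_
    rcases hin.eq_or_lt with rfl | hlt
    · have := BasD.top (e := fun i r => (reesCon (N + 1) y).mk'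
        (reesGen (N + 1) y i r)) (N := N) N r (by omega) le_rfl
      rwa [gD_self] at this
    · exact .str i 0 r hi (by omega)

end Span

/-! ### Twisted convolution algebras on finite subsets -/

section Twisted
variable {σ : Type} {K : Type} [CommRing K]

/-- Functions on finite subsets, with the convolution product twisted by `g`. -/
def Tw (_g : σ → σ → K) : Type := Finset σ → K

namespace Tw
variable {g : σ → σ → K}

instance : AddCommGroup (Tw g) := inferInstanceAs (AddCommGroup (Finset σ → K))

instance {S : Type} [Semiring S] [Module S K] : Module S (Tw g) :=
  inferInstanceAs (Module S (Finset σ → K))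

theorem add_apply (f h : Tw g) (S : Finset σ) : (f + h) S = f S + h S := rfl
theorem sub_apply (f h : Tw g) (S : Finset σ) : (f - h) S = f S - h S := rfl
theorem neg_apply (f : Tw g) (S : Finset σ) : (-f) S = -f S := rfl
theorem zero_apply (S : Finset σ) : (0 : Tw g) S = 0 := rfl
theorem smul_apply {R : Type} [Semiring R] [Module R K] (c : R) (f : Tw g) (S : Finset σ) :
    (c • f) S = c • f S := rfl

/-- The multiplicative extension of `g` to pairs of finite subsets. -/
def bi (g : σ → σ → K) (T U : Finset σ) : K := ∏ a ∈ T, ∏ b ∈ U, g a b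

theorem bi_empty_left (U : Finset σ) : bi g ∅ U = 1 := by simp [bi]
theorem bi_empty_right (T : Finset σ) : bi g T ∅ = 1 := by simp [bi]
theorem bi_singleton (a b : σ) : bi g {a} {b} = g a b := by simp [bi]

theorem bi_eq_one {T U : Finset σ} (h : ∀ a ∈ T, ∀ b ∈ U, g a b = 1) : bi g T U = 1 :=
  Finset.prod_eq_one fun a ha => Finset.prod_eq_one fun b hb => h a ha b hb

theorem bi_eq_zero {T U : Finset σ} {a b : σ} (ha : a ∈ T) (hb : b ∈ U) (h : g a b = 0) :
    bi g T U = 0 :=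
  Finset.prod_eq_zero ha (Finset.prod_eq_zero hb h)

variable [DecidableEq σ]

theorem bi_union_left {T T' : Finset σ} (h : Disjoint T T') (U : Finset σ) :
    bi g (T ∪ T') U = bi g T U * bi g T' U := Finset.prod_union h

theorem bi_union_right (T : Finset σ) {U U' : Finset σ} (h : Disjoint U U') :
    bi g T (U ∪ U') = bi g T U * bi g T U' := by
  simp only [bi, Finset.prod_union h, Finset.prod_mul_distrib]

instance : Mul (Tw g) where
  mul f h S := ∑ T ∈ S.powerset, bi g T (S \ T) * (f T * h (S \ T))

instance : One (Tw g) where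
  one S := if S = ∅ then 1 else 0

theorem mul_apply (f h : Tw g) (S : Finset σ) :
    (f * h) S = ∑ T ∈ S.powerset, bi g T (S \ T) * (f T * h (S \ T)) := rfl

theorem one_apply (S : Finset σ) : (1 : Tw g) S = if S = ∅ then 1 else 0 := rfl

theorem mul_assoc' (f h k : Tw g) : f * h * k = f * (h * k) := by
  funext S
  simp only [mul_apply, Finset.sum_mul, Finset.mul_sum]
  rw [Finset.sum_sigma', Finset.sum_sigma']
  refine Finset.sum_nbij' (fun x => ⟨x.2, x.1 \ x.2⟩) (fun x => ⟨x.1 ∪ x.2, x.1⟩) ?_ ?_ ?_ ?_ ?_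
  · rintro ⟨W, T⟩ hx
    simp only [Finset.mem_sigma, Finset.mem_powerset] at hx ⊢
    exact ⟨hx.2.trans hx.1, Finset.sdiff_subset_sdiff hx.1 subset_rfl⟩
  · rintro ⟨T, U⟩ hx
    simp only [Finset.mem_sigma, Finset.mem_powerset] at hx ⊢
    exact ⟨Finset.union_subset hx.1 (hx.2.trans Finset.sdiff_subset), Finset.subset_union_left⟩
  · rintro ⟨W, T⟩ hx
    simp only [Finset.mem_sigma, Finset.mem_powerset] at hx
    simp only [Finset.union_sdiff_of_subset hx.2]
  · rintro ⟨T, U⟩ hx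
    simp only [Finset.mem_sigma, Finset.mem_powerset] at hx
    have : Disjoint T U := (Finset.subset_sdiff.1 hx.2).2.symm
    simp only [Finset.union_sdiff_cancel_left this]
  · rintro ⟨W, T⟩ hx
    simp only [Finset.mem_sigma, Finset.mem_powerset] at hx
    have h₁ : W = T ∪ W \ T := (Finset.union_sdiff_of_subset hx.2).symm
    have h₂ : S \ T = (W \ T) ∪ (S \ W) := by
      ext a
      have := @hx.1 a
      have := @hx.2 a
      simp only [Finset.mem_sdiff, Finset.mem_union]
      tauto
    have h₃ : (S \ T) \ (W \ T) = S \ W := by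
      ext a
      have := @hx.2 a
      simp only [Finset.mem_sdiff]
      tauto
    have h₄ : Disjoint (W \ T) (S \ W) :=
      Finset.disjoint_left.2 fun a h h' =>
        (Finset.mem_sdiff.1 h').2 (Finset.mem_sdiff.1 h).1
    have e₁ : bi g W (S \ W) = bi g T (S \ W) * bi g (W \ T) (S \ W) := by
      conv_lhs => rw [h₁]
      rw [bi_union_left Finset.disjoint_sdiff, ← h₁]
    have e₂ : bi g T (S \ T) = bi g T (W \ T) * bi g T (S \ W) := by
      rw [h₂, bi_union_right _ h₄]
    simp only [h₃, e₁, e₂]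
    ring

instance : Ring (Tw g) :=
  { (inferInstance : AddCommGroup (Tw g)) with
    mul := (· * ·)
    one := 1
    mul_assoc := mul_assoc'
    one_mul := fun f => by
      funext S
      rw [mul_apply, Finset.sum_eq_single ∅]
      · simp [one_apply, bi_empty_left]
      · intro T _ hT; rw [one_apply, if_neg hT]; ring
      · intro h; exact absurd (Finset.empty_mem_powerset S) h
    mul_one := fun f => by
      funext S
      rw [mul_apply, Finset.sum_eq_single S]
      · simp [one_apply, bi_empty_right]
      · intro T hT hTS
        rw [one_apply, if_neg fun h => hTS (subset_antisymm (Finset.mem_powerset.1 hT)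
          (Finset.sdiff_eq_empty_iff_subset.1 h))]
        ring
      · intro h; exact absurd (Finset.mem_powerset_self S) h
    left_distrib := fun f h k => by
      funext S
      simp only [mul_apply, add_apply, mul_add, Finset.sum_add_distrib]
    right_distrib := fun f h k => by
      funext S
      simp only [mul_apply, add_apply, mul_add, add_mul, Finset.sum_add_distrib]
    zero_mul := fun f => by
      funext S
      simp only [mul_apply, zero_apply, zero_mul, mul_zero, Finset.sum_const_zero]
    mul_zero := fun f => by
      funext S
      simp only [mul_apply, zero_apply, mul_zero, Finset.sum_const_zero] }

instance {S : Type} [CommSemiring S] [Algebra S K] : Algebra S (Tw g) :=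
  Algebra.ofModule
    (fun c f h => by
      funext S
      simp only [mul_apply, smul_apply, Finset.smul_sum, Algebra.smul_mul_assoc,
        Algebra.mul_smul_comm])
    (fun c f h => by
      funext S
      simp only [mul_apply, smul_apply, Finset.smul_sum, Algebra.mul_smul_comm])

/-- The commutator as a sum over the subsets. -/
theorem comm_apply (f h : Tw g) (S : Finset σ) :
    (f * h - h * f) S =
      ∑ T ∈ S.powerset, (bi g T (S \ T) - bi g (S \ T) T) * (f T * h (S \ T)) := by
  have : (h * f) S = ∑ T ∈ S.powerset, bi g (S \ T) T * (f T * h (S \ T)) := by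
    rw [mul_apply]
    refine Finset.sum_nbij' (fun T => S \ T) (fun T => S \ T) ?_ ?_ ?_ ?_ ?_
    · intro T _; exact Finset.mem_powerset.2 Finset.sdiff_subset
    · intro T _; exact Finset.mem_powerset.2 Finset.sdiff_subset
    · intro T hT; exact Finset.sdiff_sdiff_eq_self (Finset.mem_powerset.1 hT)
    · intro T hT; exact Finset.sdiff_sdiff_eq_self (Finset.mem_powerset.1 hT)
    · intro T hT
      rw [Finset.sdiff_sdiff_eq_self (Finset.mem_powerset.1 hT)]
      ring
  rw [sub_apply, this, mul_apply, ← Finset.sum_sub_distrib]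
  exact Finset.sum_congr rfl fun T _ => by ring

/-- Base change of twisted algebras. -/
def map {K' : Type} [CommRing K'] (φ : K →+* K') (g : σ → σ → K) :
    Tw g →+* Tw fun a b => φ (g a b) where
  toFun f S := φ (f S)
  map_one' := by
    funext S
    rw [one_apply, one_apply]
    split_ifs
    · exact map_one φ
    · exact map_zero φ
  map_mul' f h := by
    funext S
    change φ ((f * h) S) = ∑ T ∈ S.powerset, bi _ T (S \ T) * (φ (f T) * φ (h (S \ T)))
    simp only [mul_apply, map_sum, map_mul, bi, map_prod]
  map_zero' := by funext S; exact map_zero φ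
  map_add' f h := by funext S; exact map_add φ _ _

/-- Restriction of twisted algebras along an embedding of index sets. -/
def comap {σ' : Type} [DecidableEq σ'] (ι : σ' ↪ σ) (g : σ → σ → K) :
    Tw g →+* Tw fun a b => g (ι a) (ι b) where
  toFun f S := f (S.map ι)
  map_one' := by
    funext S
    rw [one_apply, one_apply]
    simp only [Finset.map_eq_empty]
  map_mul' f h := by
    funext S
    change (f * h) (S.map ι) =
      ∑ T ∈ S.powerset, bi _ T (S \ T) * (f (T.map ι) * h ((S \ T).map ι))
    rw [mul_apply]
    symm
    refine Finset.sum_bij (fun T _ => T.map ι) ?_ ?_ ?_ ?_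
    · intro T hT
      exact Finset.mem_powerset.2 (Finset.map_subset_map.2 (Finset.mem_powerset.1 hT))
    · intro T _ T' _ h; exact Finset.map_injective ι h
    · intro T hT
      obtain ⟨U, hU, rfl⟩ := Finset.subset_map_iff.1 (Finset.mem_powerset.1 hT)
      exact ⟨U, Finset.mem_powerset.2 hU, rfl⟩
    · intro T _
      have : S.map ι \ T.map ι = (S \ T).map ι := by
        ext a
        simp only [Finset.mem_sdiff, Finset.mem_map]
        constructor
        · rintro ⟨⟨b, hb, rfl⟩, hn⟩
          exact ⟨b, ⟨hb, fun hT => hn ⟨b, hT, rfl⟩⟩, rfl⟩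
        · rintro ⟨b, ⟨hb, hbT⟩, rfl⟩
          refine ⟨⟨b, hb, rfl⟩, ?_⟩
          rintro ⟨c, hc, hcb⟩
          exact hbT (ι.injective hcb ▸ hc)
      rw [this]
      simp only [bi, Finset.prod_map]
  map_zero' := rfl
  map_add' _ _ := rfl

/-- The element supported on singletons with values `φ`. -/
def ell (g : σ → σ → K) (φ : σ → K) : Tw g := fun S => if S.card = 1 then ∑ a ∈ S, φ a else 0

/-- The element supported on one finite subset. -/
def delta (g : σ → σ → K) (S : Finset σ) (c : K) : Tw g := fun T => if T = S then c else 0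

set_option linter.unusedSectionVars false in
theorem ell_singleton (φ : σ → K) (a : σ) : ell g φ {a} = φ a := by
  rw [ell, if_pos (Finset.card_singleton a), Finset.sum_singleton]

theorem comm_delta (a : σ) (S : Finset σ) (c d : K) :
    delta g {a} c * delta g S d - delta g S d * delta g {a} c =
      delta g (insert a S) (if a ∈ S then 0 else (bi g {a} S - bi g S {a}) * (c * d)) := by
  funext W
  rw [comm_apply]
  simp only [delta]
  by_cases ha : a ∈ S
  · rw [if_pos ha, ite_self]
    refine Finset.sum_eq_zero fun T hT => ?_
    split_ifs with h₁ h₂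
    · rw [← h₂, h₁] at ha
      exact absurd (Finset.mem_singleton_self a) (Finset.mem_sdiff.1 ha).2
    all_goals ring
  · rw [if_neg ha]
    split_ifs with hW
    · subst hW
      have h₁ : insert a S \ {a} = S := by
        rw [Finset.insert_sdiff_of_mem _ (Finset.mem_singleton_self a),
          Finset.sdiff_singleton_eq_erase, Finset.erase_eq_of_notMem ha]
      rw [Finset.sum_eq_single {a}, h₁, if_pos rfl, if_pos rfl]
      · intro T _ hT; rw [if_neg hT]; ring
      · intro h
        exact absurd (Finset.mem_powerset.2 (Finset.singleton_subset_iff.2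
          (Finset.mem_insert_self a S))) h
    · refine Finset.sum_eq_zero fun T hT => ?_
      split_ifs with h₁ h₂
      · refine absurd ?_ hW
        rw [← h₂, h₁, Finset.insert_eq, Finset.union_sdiff_of_subset]
        exact h₁ ▸ Finset.mem_powerset.1 hT
      all_goals ring

/-- The commutator with an element supported on singletons. -/
theorem comm_ell_apply (f : Tw g) (φ : σ → K) (S : Finset σ) :
    (f * ell g φ - ell g φ * f) S = ∑ a ∈ S,
      (bi g (S.erase a) {a} - bi g {a} (S.erase a)) * (f (S.erase a) * φ a) := by
  rw [comm_apply]
  symm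
  refine Finset.sum_of_injOn (fun a => S.erase a) ?_ ?_ ?_ ?_
  · intro a ha b hb h
    by_contra hab
    have : a ∈ S.erase b := Finset.mem_erase.2 ⟨hab, ha⟩
    simp only at h
    rw [← h] at this
    exact (Finset.mem_erase.1 this).1 rfl
  · intro a _; exact Finset.mem_coe.2 (Finset.mem_powerset.2 (Finset.erase_subset _ _))
  · intro T hT hT'
    have : (S \ T).card ≠ 1 := by
      intro h
      obtain ⟨a, ha⟩ := Finset.card_eq_one.1 h
      have haS : a ∈ S \ T := ha ▸ Finset.mem_singleton_self a
      refine hT' ⟨a, (Finset.mem_sdiff.1 haS).1, ?_⟩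
      simp only
      rw [← Finset.sdiff_singleton_eq_erase, ← ha,
        Finset.sdiff_sdiff_eq_self (Finset.mem_powerset.1 hT)]
    rw [ell, if_neg this]
    ring
  · intro a ha
    have : S \ S.erase a = {a} := by
      ext b
      simp only [Finset.mem_sdiff, Finset.mem_erase, Finset.mem_singleton]
      constructor
      · rintro ⟨h₁, h₂⟩; by_contra h; exact h₂ ⟨h, h₁⟩
      · rintro rfl; exact ⟨ha, fun h => h.1 rfl⟩
    rw [this, ell_singleton]

end Tw
end Twisted

/-! ### The relations of the Yangian in a twisted algebra -/

section TwistedRelations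
variable {σ : Type} [DecidableEq σ] {D : Type} [CommRing D] {g : σ → σ → D}
attribute [local instance] LieRing.ofAssociativeRing

namespace Tw

theorem sum_apply {ι : Type} (s : Finset ι) (f : ι → Tw g) (S : Finset σ) :
    (∑ i ∈ s, f i) S = ∑ i ∈ s, f i S :=
  Finset.sum_apply S s f

theorem ell_eq_sum [Fintype σ] (φ : σ → D) : ell g φ = ∑ a, delta g {a} (φ a) := by
  funext S
  rw [sum_apply]
  simp only [ell, delta]
  split_ifs with h
  · obtain ⟨b, rfl⟩ := Finset.card_eq_one.1 h
    simp [Finset.singleton_inj]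
  · symm
    refine Finset.sum_eq_zero fun a _ => if_neg ?_
    rintro rfl
    exact h (Finset.card_singleton a)

theorem delta_add (S : Finset σ) (c d : D) : delta g S (c + d) = delta g S c + delta g S d := by
  funext W
  simp only [delta, add_apply]
  split_ifs <;> simp

theorem delta_sub (S : Finset σ) (c d : D) : delta g S (c - d) = delta g S c - delta g S d := by
  funext W
  simp only [delta, sub_apply]
  split_ifs <;> simp

theorem delta_zero (S : Finset σ) : delta g S 0 = 0 := by
  funext W
  simp only [delta, zero_apply, ite_self]

theorem smul_delta (x : D) (S : Finset σ) (c : D) : x • delta g S c = delta g S (x * c) := by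
  funext W
  simp only [delta, smul_apply]
  split_ifs <;> simp

theorem delta_mul_delta (a b : σ) (c d : D) :
    delta g {a} c * delta g {b} d = delta g {a, b} (if a = b then 0 else g a b * (c * d)) := by
  funext W
  rw [mul_apply]
  simp only [delta]
  by_cases hab : a = b
  · subst hab
    rw [if_pos rfl, ite_self]
    refine Finset.sum_eq_zero fun T hT => ?_
    split_ifs with h₁ h₂
    · have := Finset.mem_sdiff.1 (h₂ ▸ Finset.mem_singleton_self a : a ∈ W \ T)
      exact absurd (h₁ ▸ Finset.mem_singleton_self a) this.2
    all_goals ring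
  · rw [if_neg hab]
    split_ifs with hW
    · subst hW
      have h₁ : ({a, b} : Finset σ) \ {a} = {b} := by
        rw [Finset.insert_sdiff_of_mem _ (Finset.mem_singleton_self a),
          Finset.sdiff_singleton_eq_erase, Finset.erase_eq_of_notMem (by simpa using hab)]
      rw [Finset.sum_eq_single {a}, h₁, if_pos rfl, if_pos rfl, bi_singleton]
      · intro T _ hT; rw [if_neg hT]; ring
      · intro h
        exact absurd (Finset.mem_powerset.2 (Finset.singleton_subset_iff.2
          (Finset.mem_insert_self a {b}))) h
    · refine Finset.sum_eq_zero fun T hT => ?_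
      split_ifs with h₁ h₂
      · refine absurd ?_ hW
        rw [Finset.insert_eq, ← h₂, h₁, Finset.union_sdiff_of_subset]
        exact h₁ ▸ Finset.mem_powerset.1 hT
      all_goals ring

theorem lie_delta_one {a b : σ} (c d : D) (h : a ≠ b) :
    ⁅delta g {a} c, delta g {b} d⁆ = delta g {a, b} ((g a b - g b a) * (c * d)) := by
  rw [LieRing.of_associative_ring_bracket, comm_delta, if_neg (by simpa using h), bi_singleton,
    bi_singleton]

theorem lie_delta_two {a₁ a₂ b : σ} (c₁ c₂ d : D) (h₁ : a₁ ≠ b) (h₂ : a₂ ≠ b) :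
    ⁅delta g {a₁} c₁, ⁅delta g {a₂} c₂, delta g {b} d⁆⁆ = delta g {a₁, a₂, b}
      (if a₁ = a₂ then 0 else (g a₁ a₂ * g a₁ b - g a₂ a₁ * g b a₁) * (g a₂ b - g b a₂) *
        (c₁ * c₂ * d)) := by
  rw [lie_delta_one _ _ h₂, LieRing.of_associative_ring_bracket, comm_delta]
  congr 1
  by_cases h : a₁ = a₂
  · rw [if_pos h, if_pos (by simp [h])]
  · rw [if_neg h, if_neg (by simp [h, h₁])]
    simp only [bi, Finset.prod_singleton, Finset.prod_pair h₂]
    ring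

theorem lie_delta_three {a₁ a₂ a₃ b : σ} (c₁ c₂ c₃ d : D) (h₁ : a₁ ≠ b) (h₂ : a₂ ≠ b)
    (h₃ : a₃ ≠ b) :
    ⁅delta g {a₁} c₁, ⁅delta g {a₂} c₂, ⁅delta g {a₃} c₃, delta g {b} d⁆⁆⁆ =
      delta g {a₁, a₂, a₃, b} (if a₁ = a₂ ∨ a₁ = a₃ ∨ a₂ = a₃ then 0 else
        (g a₁ a₂ * g a₁ a₃ * g a₁ b - g a₂ a₁ * g a₃ a₁ * g b a₁) *
          (g a₂ a₃ * g a₂ b - g a₃ a₂ * g b a₂) * (g a₃ b - g b a₃) *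
        (c₁ * c₂ * c₃ * d)) := by
  rw [lie_delta_two _ _ _ h₂ h₃, LieRing.of_associative_ring_bracket, comm_delta]
  congr 1
  by_cases h₁₂ : a₁ = a₂
  · rw [if_pos (by simp [h₁₂]), if_pos (by simp [h₁₂])]
  by_cases h₁₃ : a₁ = a₃
  · rw [if_pos (by simp [h₁₃]), if_pos (by simp [h₁₃])]
  rw [if_neg (by simp [h₁₂, h₁₃, h₁])]
  by_cases h₂₃ : a₂ = a₃
  · rw [if_pos (by simp [h₂₃]), if_pos (by simp [h₂₃])]; ring
  rw [if_neg h₂₃, if_neg (by simp [h₁₂, h₁₃, h₂₃])]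
  simp only [bi, Finset.prod_singleton, Finset.prod_pair h₃,
    Finset.prod_insert (show a₂ ∉ ({a₃, b} : Finset σ) by simp [h₂₃, h₂])]
  ring

/-- The twist `g` is compatible with the relations of the Yangian for the colouring `col` and the
spectral parameters `z`. -/
structure Compatible (A : ℕ → ℕ → ℤ) (κ : ℕ → D) (col : σ → ℕ) (z : σ → D) (g : σ → σ → D) :
    Prop where
  symm : ∀ a b, a ≠ b → A (col a) (col b) = 0 → g a b = g b a
  bond : ∀ a b, a ≠ b → A (col a) (col b) ≠ 0 → ∃ μ : D, μ ≠ 0 ∧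
    μ * g a b = z a - z b + A (col a) (col b) * κ (col a) ∧
    μ * g b a = z a - z b - A (col a) (col b) * κ (col a)

/-- The additive subgroup generated by the elements supported on a site of colour `i`. -/
def colGroup (g : σ → σ → D) (col : σ → ℕ) (i : ℕ) : AddSubgroup (Tw g) :=
  AddSubgroup.closure {x | ∃ a c, col a = i ∧ x = delta g {a} c}

theorem eq_zero_of_mem_closure {G H : Type} [AddCommGroup G] [AddCommGroup H] {s : Set G}
    (F : G → H) (hF : ∀ x y, F (x + y) = F x + F y) (h : ∀ x ∈ s, F x = 0) {x : G}
    (hx : x ∈ AddSubgroup.closure s) : F x = 0 :=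
  (AddSubgroup.closure_le (AddMonoidHom.mk' F hF).ker).2 h hx

namespace Compatible
variable {A : ℕ → ℕ → ℤ} {κ : ℕ → D} {col : σ → ℕ} {z : σ → D}

theorem serre_one (h : Compatible A κ col z g) {i j : ℕ} (hij : i ≠ j) (hA : A i j = 0)
    {x y : Tw g} (hx : x ∈ colGroup g col i) (hy : y ∈ colGroup g col j) : ⁅x, y⁆ = 0 := by
  refine eq_zero_of_mem_closure (fun y => ⁅x, y⁆) (fun _ _ => lie_add _ _ _) ?_ hy
  rintro _ ⟨b, d, rfl, rfl⟩
  refine eq_zero_of_mem_closure (fun x => ⁅x, delta g {b} d⁆) (fun _ _ => add_lie _ _ _) ?_ hx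
  rintro _ ⟨a, c, rfl, rfl⟩
  have hab : a ≠ b := fun e => hij (congrArg col e)
  rw [lie_delta_one _ _ hab, h.symm a b hab hA, sub_self, zero_mul, delta_zero]

/-- The coefficient of the symmetrized triple commutator of singletons. -/
def serreCubic (x₁₂ x₂₁ x₁₃ x₃₁ x₂₃ x₃₂ x₁ y₁ x₂ y₂ x₃ y₃ : D) : D :=
  (x₁₂ * x₁₃ * x₁ - x₂₁ * x₃₁ * y₁) * (x₂₃ * x₂ - x₃₂ * y₂) * (x₃ - y₃) +
  (x₁₃ * x₁₂ * x₁ - x₃₁ * x₂₁ * y₁) * (x₃₂ * x₃ - x₂₃ * y₃) * (x₂ - y₂) +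
  (x₂₁ * x₂₃ * x₂ - x₁₂ * x₃₂ * y₂) * (x₁₃ * x₁ - x₃₁ * y₁) * (x₃ - y₃) +
  (x₂₃ * x₂₁ * x₂ - x₃₂ * x₁₂ * y₂) * (x₃₁ * x₃ - x₁₃ * y₃) * (x₁ - y₁) +
  (x₃₁ * x₃₂ * x₃ - x₁₃ * x₂₃ * y₃) * (x₁₂ * x₁ - x₂₁ * y₁) * (x₂ - y₂) +
  (x₃₂ * x₃₁ * x₃ - x₂₃ * x₁₃ * y₃) * (x₂₁ * x₂ - x₁₂ * y₂) * (x₁ - y₁)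

set_option linter.unusedSectionVars false in
theorem serreCubic_scale (x₁₂ x₂₁ x₁₃ x₃₁ x₂₃ x₃₂ x₁ y₁ x₂ y₂ x₃ y₃ μ ν ρ μ₁ μ₂ μ₃ : D) :
    serreCubic (μ * x₁₂) (μ * x₂₁) (ν * x₁₃) (ν * x₃₁) (ρ * x₂₃) (ρ * x₃₂) (μ₁ * x₁) (μ₁ * y₁)
      (μ₂ * x₂) (μ₂ * y₂) (μ₃ * x₃) (μ₃ * y₃) =
    μ * ν * ρ * (μ₁ * μ₂ * μ₃) * serreCubic x₁₂ x₂₁ x₁₃ x₃₁ x₂₃ x₃₂ x₁ y₁ x₂ y₂ x₃ y₃ := by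
  unfold serreCubic
  ring

variable [IsDomain D]

theorem serre_two (h : Compatible A κ col z g) {i j : ℕ} (hij : i ≠ j) (hA : A i j = -1)
    (hAi : A i i = 2)
    {x₁ x₂ y : Tw g} (hx₁ : x₁ ∈ colGroup g col i) (hx₂ : x₂ ∈ colGroup g col i)
    (hy : y ∈ colGroup g col j) : ⁅x₁, ⁅x₂, y⁆⁆ + ⁅x₂, ⁅x₁, y⁆⁆ = 0 := by
  refine eq_zero_of_mem_closure (fun y => ⁅x₁, ⁅x₂, y⁆⁆ + ⁅x₂, ⁅x₁, y⁆⁆)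
    (fun _ _ => by simp only [lie_add]; abel) ?_ hy
  rintro _ ⟨b, d, rfl, rfl⟩
  refine eq_zero_of_mem_closure (fun x₁ => ⁅x₁, ⁅x₂, delta g {b} d⁆⁆ + ⁅x₂, ⁅x₁, delta g {b} d⁆⁆)
    (fun _ _ => by simp only [lie_add, add_lie]; abel) ?_ hx₁
  rintro _ ⟨a₁, c₁, h₁, rfl⟩
  refine eq_zero_of_mem_closure (fun x₂ => ⁅delta g {a₁} c₁, ⁅x₂, delta g {b} d⁆⁆ +
    ⁅x₂, ⁅delta g {a₁} c₁, delta g {b} d⁆⁆)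
    (fun _ _ => by simp only [lie_add, add_lie]; abel) ?_ hx₂
  rintro _ ⟨a₂, c₂, rfl, rfl⟩
  have hb₁ : a₁ ≠ b := fun e => hij (h₁ ▸ congrArg col e)
  have hb₂ : a₂ ≠ b := fun e => hij (congrArg col e)
  rw [lie_delta_two _ _ _ hb₁ hb₂, lie_delta_two _ _ _ hb₂ hb₁, Finset.insert_comm a₂ a₁,
    ← delta_add]
  by_cases h₁₂ : a₁ = a₂
  · rw [if_pos h₁₂, if_pos h₁₂.symm, add_zero, delta_zero]
  rw [if_neg h₁₂, if_neg (Ne.symm h₁₂)]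
  obtain ⟨μ, hμ, e₁, e₂⟩ := h.bond a₁ a₂ h₁₂ (by rw [h₁, hAi]; decide)
  obtain ⟨μ₁, hμ₁, e₃, e₄⟩ := h.bond a₁ b hb₁ (by rw [h₁, hA]; decide)
  obtain ⟨μ₂, hμ₂, e₅, e₆⟩ := h.bond a₂ b hb₂ (by rw [hA]; decide)
  rw [h₁, hAi] at e₁ e₂
  rw [h₁, hA] at e₃ e₄
  rw [hA] at e₅ e₆
  push_cast at e₁ e₂ e₃ e₄ e₅ e₆
  have key : (g a₁ a₂ * g a₁ b - g a₂ a₁ * g b a₁) * (g a₂ b - g b a₂) +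
      (g a₂ a₁ * g a₂ b - g a₁ a₂ * g b a₂) * (g a₁ b - g b a₁) = 0 := by
    apply mul_left_cancel₀ (mul_ne_zero hμ (mul_ne_zero hμ₁ hμ₂))
    calc _ = ((μ * g a₁ a₂) * (μ₁ * g a₁ b) - (μ * g a₂ a₁) * (μ₁ * g b a₁)) *
          (μ₂ * g a₂ b - μ₂ * g b a₂) + ((μ * g a₂ a₁) * (μ₂ * g a₂ b) -
          (μ * g a₁ a₂) * (μ₂ * g b a₂)) * (μ₁ * g a₁ b - μ₁ * g b a₁) := by ring
      _ = _ := by rw [e₁, e₂, e₃, e₄, e₅, e₆]; ring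
  rw [← delta_zero {a₁, a₂, b}]
  congr 1
  linear_combination (c₁ * c₂ * d) * key

theorem serre_three (h : Compatible A κ col z g) {i j : ℕ} (hij : i ≠ j) (hA : A i j = -2)
    (hAi : A i i = 2) {x₁ x₂ x₃ y : Tw g} (hx₁ : x₁ ∈ colGroup g col i)
    (hx₂ : x₂ ∈ colGroup g col i) (hx₃ : x₃ ∈ colGroup g col i) (hy : y ∈ colGroup g col j) :
    ⁅x₁, ⁅x₂, ⁅x₃, y⁆⁆⁆ + ⁅x₁, ⁅x₃, ⁅x₂, y⁆⁆⁆ + ⁅x₂, ⁅x₁, ⁅x₃, y⁆⁆⁆ + ⁅x₂, ⁅x₃, ⁅x₁, y⁆⁆⁆ +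
      ⁅x₃, ⁅x₁, ⁅x₂, y⁆⁆⁆ + ⁅x₃, ⁅x₂, ⁅x₁, y⁆⁆⁆ = 0 := by
  refine eq_zero_of_mem_closure (fun y => ⁅x₁, ⁅x₂, ⁅x₃, y⁆⁆⁆ + ⁅x₁, ⁅x₃, ⁅x₂, y⁆⁆⁆ +
    ⁅x₂, ⁅x₁, ⁅x₃, y⁆⁆⁆ + ⁅x₂, ⁅x₃, ⁅x₁, y⁆⁆⁆ + ⁅x₃, ⁅x₁, ⁅x₂, y⁆⁆⁆ + ⁅x₃, ⁅x₂, ⁅x₁, y⁆⁆⁆)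
    (fun _ _ => by simp only [lie_add]; abel) ?_ hy
  rintro _ ⟨b, d, rfl, rfl⟩
  set δ := delta g {b} d
  refine eq_zero_of_mem_closure (fun x₁ => ⁅x₁, ⁅x₂, ⁅x₃, δ⁆⁆⁆ + ⁅x₁, ⁅x₃, ⁅x₂, δ⁆⁆⁆ +
    ⁅x₂, ⁅x₁, ⁅x₃, δ⁆⁆⁆ + ⁅x₂, ⁅x₃, ⁅x₁, δ⁆⁆⁆ + ⁅x₃, ⁅x₁, ⁅x₂, δ⁆⁆⁆ + ⁅x₃, ⁅x₂, ⁅x₁, δ⁆⁆⁆)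
    (fun _ _ => by simp only [lie_add, add_lie]; abel) ?_ hx₁
  rintro _ ⟨a₁, c₁, h₁, rfl⟩
  set δ₁ := delta g {a₁} c₁
  refine eq_zero_of_mem_closure (fun x₂ => ⁅δ₁, ⁅x₂, ⁅x₃, δ⁆⁆⁆ + ⁅δ₁, ⁅x₃, ⁅x₂, δ⁆⁆⁆ +
    ⁅x₂, ⁅δ₁, ⁅x₃, δ⁆⁆⁆ + ⁅x₂, ⁅x₃, ⁅δ₁, δ⁆⁆⁆ + ⁅x₃, ⁅δ₁, ⁅x₂, δ⁆⁆⁆ + ⁅x₃, ⁅x₂, ⁅δ₁, δ⁆⁆⁆)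
    (fun _ _ => by simp only [lie_add, add_lie]; abel) ?_ hx₂
  rintro _ ⟨a₂, c₂, h₂, rfl⟩
  set δ₂ := delta g {a₂} c₂
  refine eq_zero_of_mem_closure (fun x₃ => ⁅δ₁, ⁅δ₂, ⁅x₃, δ⁆⁆⁆ + ⁅δ₁, ⁅x₃, ⁅δ₂, δ⁆⁆⁆ +
    ⁅δ₂, ⁅δ₁, ⁅x₃, δ⁆⁆⁆ + ⁅δ₂, ⁅x₃, ⁅δ₁, δ⁆⁆⁆ + ⁅x₃, ⁅δ₁, ⁅δ₂, δ⁆⁆⁆ + ⁅x₃, ⁅δ₂, ⁅δ₁, δ⁆⁆⁆)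
    (fun _ _ => by simp only [lie_add, add_lie]; abel) ?_ hx₃
  rintro _ ⟨a₃, c₃, rfl, rfl⟩
  have hb₁ : a₁ ≠ b := fun e => hij (h₁ ▸ congrArg col e)
  have hb₂ : a₂ ≠ b := fun e => hij (h₂ ▸ congrArg col e)
  have hb₃ : a₃ ≠ b := fun e => hij (congrArg col e)
  have s₁ : ({a₁, a₃, a₂, b} : Finset σ) = {a₁, a₂, a₃, b} := by rw [Finset.insert_comm a₃]
  have s₂ : ({a₂, a₁, a₃, b} : Finset σ) = {a₁, a₂, a₃, b} := by rw [Finset.insert_comm a₂]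
  have s₃ : ({a₂, a₃, a₁, b} : Finset σ) = {a₁, a₂, a₃, b} := by
    rw [Finset.insert_comm a₃, s₂]
  have s₄ : ({a₃, a₁, a₂, b} : Finset σ) = {a₁, a₂, a₃, b} := by
    rw [Finset.insert_comm a₃, s₁]
  have s₅ : ({a₃, a₂, a₁, b} : Finset σ) = {a₁, a₂, a₃, b} := by
    rw [Finset.insert_comm a₂, s₄]
  simp only [δ, δ₁, δ₂]
  rw [lie_delta_three _ _ _ _ hb₁ hb₂ hb₃, lie_delta_three _ _ _ _ hb₁ hb₃ hb₂,
    lie_delta_three _ _ _ _ hb₂ hb₁ hb₃, lie_delta_three _ _ _ _ hb₂ hb₃ hb₁,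
    lie_delta_three _ _ _ _ hb₃ hb₁ hb₂, lie_delta_three _ _ _ _ hb₃ hb₂ hb₁,
    s₁, s₂, s₃, s₄, s₅]
  simp only [← delta_add]
  rw [← delta_zero {a₁, a₂, a₃, b}]
  congr 1
  by_cases h₁₂ : a₁ = a₂
  · simp [h₁₂]
  by_cases h₁₃ : a₁ = a₃
  · simp [h₁₃]
  by_cases h₂₃ : a₂ = a₃
  · simp [h₂₃]
  simp only [h₁₂, h₁₃, h₂₃, Ne.symm h₁₂, Ne.symm h₁₃, Ne.symm h₂₃, or_self, if_false]
  obtain ⟨μ, hμ, e₁, e₂⟩ := h.bond a₁ a₂ h₁₂ (by rw [h₁, h₂, hAi]; decide)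
  obtain ⟨ν, hν, e₃, e₄⟩ := h.bond a₁ a₃ h₁₃ (by rw [h₁, hAi]; decide)
  obtain ⟨ρ, hρ, e₅, e₆⟩ := h.bond a₂ a₃ h₂₃ (by rw [h₂, hAi]; decide)
  obtain ⟨μ₁, hμ₁, f₁, f₂⟩ := h.bond a₁ b hb₁ (by rw [h₁, hA]; decide)
  obtain ⟨μ₂, hμ₂, f₃, f₄⟩ := h.bond a₂ b hb₂ (by rw [h₂, hA]; decide)
  obtain ⟨μ₃, hμ₃, f₅, f₆⟩ := h.bond a₃ b hb₃ (by rw [hA]; decide)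
  rw [h₁, h₂, hAi] at e₁ e₂
  rw [h₁, hAi] at e₃ e₄
  rw [h₂, hAi] at e₅ e₆
  rw [h₁, hA] at f₁ f₂
  rw [h₂, hA] at f₃ f₄
  rw [hA] at f₅ f₆
  push_cast at e₁ e₂ e₃ e₄ e₅ e₆ f₁ f₂ f₃ f₄ f₅ f₆
  have key : serreCubic (g a₁ a₂) (g a₂ a₁) (g a₁ a₃) (g a₃ a₁) (g a₂ a₃) (g a₃ a₂) (g a₁ b)
      (g b a₁) (g a₂ b) (g b a₂) (g a₃ b) (g b a₃) = 0 := by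
    apply mul_left_cancel₀ (mul_ne_zero (mul_ne_zero (mul_ne_zero hμ hν) hρ)
      (mul_ne_zero (mul_ne_zero hμ₁ hμ₂) hμ₃))
    rw [← serreCubic_scale, e₁, e₂, e₃, e₄, e₅, e₆, f₁, f₂, f₃, f₄, f₅, f₆]
    unfold serreCubic
    ring
  unfold serreCubic at key
  linear_combination (c₁ * c₂ * c₃ * d) * key

theorem serre_sum (h : Compatible A κ col z g) {i j : ℕ} (hij : i ≠ j) (hAi : A i i = 2)
    (hA : A i j = 0 ∨ A i j = -1 ∨ A i j = -2) (x : ℕ → Tw g) (hx : ∀ r, x r ∈ colGroup g col i)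
    {y : Tw g} (hy : y ∈ colGroup g col j) (m : ℕ) (hm : (1 - A i j).toNat = m)
    (ss : Fin m → ℕ) : ∑ τ : Equiv.Perm (Fin m),
      (List.ofFn fun l => x (ss (τ l))).foldr (fun a b => a * b - b * a) y = 0 := by
  rcases hA with hA | hA | hA
  · obtain rfl : m = 1 := by rw [← hm, hA]; rfl
    rw [Fintype.sum_unique]
    simpa [List.ofFn_succ, LieRing.of_associative_ring_bracket] using h.serre_one hij hA (hx (ss 0)) hy
  · obtain rfl : m = 2 := by rw [← hm, hA]; rfl
    have : (Finset.univ : Finset (Equiv.Perm (Fin 2))) = {1, Equiv.swap 0 1} := by decide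
    rw [this, Finset.sum_pair (by decide)]
    simpa [List.ofFn_succ, LieRing.of_associative_ring_bracket] using
      h.serre_two hij hA hAi (hx (ss 0)) (hx (ss 1)) hy
  · obtain rfl : m = 3 := by rw [← hm, hA]; rfl
    have : (Finset.univ : Finset (Equiv.Perm (Fin 3))) = {1, Equiv.swap 1 2, Equiv.swap 0 1,
      Equiv.swap 0 1 * Equiv.swap 1 2, Equiv.swap 1 2 * Equiv.swap 0 1, Equiv.swap 0 2} := by decide
    rw [this, Finset.sum_insert (by decide), Finset.sum_insert (by decide),
      Finset.sum_insert (by decide), Finset.sum_insert (by decide), Finset.sum_pair (by decide)]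
    have e := h.serre_three hij hA hAi (hx (ss 0)) (hx (ss 1)) (hx (ss 2)) hy
    simp only [LieRing.of_associative_ring_bracket] at e
    simp only [List.ofFn_succ, List.ofFn_zero, List.foldr_cons, List.foldr_nil]
    rw [← e]
    simp only [← add_assoc]
    rfl

end Compatible

/-- The image of the generator `x_{i,r}`. -/
def gen (g : σ → σ → D) (col : σ → ℕ) (z : σ → D) (i r : ℕ) : Tw g :=
  ell g fun a => if col a = i then z a ^ r else 0

section Gen
variable [Fintype σ] {A : ℕ → ℕ → ℤ} {κ : ℕ → D} {col : σ → ℕ} {z : σ → D}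

theorem gen_mem (i r : ℕ) : gen g col z i r ∈ colGroup g col i := by
  rw [gen, ell_eq_sum]
  refine sum_mem fun a _ => ?_
  split_ifs with h
  · exact AddSubgroup.subset_closure ⟨a, _, h, rfl⟩
  · rw [delta_zero]; exact zero_mem _

variable [IsDomain D]

theorem Compatible.loop (h : Compatible A κ col z g) (i j r s : ℕ) :
    (gen g col z i (r + 1) * gen g col z j s - gen g col z j s * gen g col z i (r + 1)) -
      (gen g col z i r * gen g col z j (s + 1) - gen g col z j (s + 1) * gen g col z i r) =
    ((A i j : D) * κ i) • (gen g col z i r * gen g col z j s + gen g col z j s * gen g col z i r) := by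
  simp only [gen, ell_eq_sum]
  simp only [Finset.sum_mul_sum]
  simp only [Finset.sum_comm (s := Finset.univ) (t := Finset.univ)
    (f := fun x y => delta g {x} (if col x = j then _ else 0) *
      delta g {y} (if col y = i then _ else 0))]
  simp only [← Finset.sum_sub_distrib, ← Finset.sum_add_distrib, Finset.smul_sum]
  refine Finset.sum_congr rfl fun a _ => Finset.sum_congr rfl fun b _ => ?_
  simp only [delta_mul_delta, Finset.pair_comm b a, ← delta_sub, ← delta_add, smul_delta]
  congr 1
  by_cases hab : a = b
  · simp [hab]
  simp only [if_neg hab, if_neg (Ne.symm hab)]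
  split_ifs with hi hj
  · subst hi hj
    have key : (z a - z b) * (g a b - g b a) =
        (A (col a) (col b) : D) * κ (col a) * (g a b + g b a) := by
      by_cases hA : A (col a) (col b) = 0
      · rw [h.symm a b hab hA, hA]; push_cast; ring
      · obtain ⟨μ, hμ, e₁, e₂⟩ := h.bond a b hab hA
        apply mul_left_cancel₀ hμ
        linear_combination (z a - z b - (A (col a) (col b) : D) * κ (col a)) * e₁ -
          (z a - z b + (A (col a) (col b) : D) * κ (col a)) * e₂
    linear_combination (z a ^ r * z b ^ s) * key
  all_goals ring

/-- A twisted algebra whose twist is compatible with the relations of the Yangian is a quotient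
of the Yangian up to the choice of generators. -/
theorem Compatible.exists_algHom [Algebra RH D] {n : ℕ} {Dd : ℕ → ℕ}
    (hAi : ∀ i, A i i = 2)
    (hA : ∀ i j, i ≠ j → A i j = 0 ∨ A i j = -1 ∨ A i j = -2)
    (hκ : ∀ i, κ i = algebraMap RH D (Polynomial.C ((Dd i : ℚ) / 2) * hbar))
    (h : Compatible A κ col z g) :
    ∃ Φ : YA n A Dd →ₐ[RH] Tw g, ∀ i r, 1 ≤ i → i ≤ n → Φ (gy1 n A Dd i r) = gen g col z i r := by
  let φ : FAY n →ₐ[RH] Tw g := FreeAlgebra.lift RH fun p => gen g col z (p.1.1 + 1) p.2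
  have hφ : ∀ i r, φ (fy n i r) = gen g col z (i.1 + 1) r := fun i r => FreeAlgebra.lift_ι_apply _ _
  have hmul : ∀ a b : FAY n, φ (a * b) = φ a * φ b := map_mul _
  have hadd : ∀ a b : FAY n, φ (a + b) = φ a + φ b := map_add _
  have hsub : ∀ a b : FAY n, φ (a - b) = φ a - φ b := map_sub_of_map_add (f := fun a => φ a) hadd
  have hrel : ∀ ⦃x y : FAY n⦄, YRel n A Dd x y → φ x = φ y := by
    intro x y hxy
    cases hxy with
    | loop i j r s =>
      rw [map_smul, hadd, hsub, hsub, hsub, hmul, hmul, hmul, hmul, hmul, hmul]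
      simp only [hφ]
      rw [h.loop, hκ]
      have hs : ∀ (c : RH) (f : Tw g), c • f = algebraMap RH D c • f := fun c f => by
        funext S
        exact Algebra.smul_def _ _
      rw [hs, ← map_intCast (algebraMap RH D), ← map_mul, ← map_intCast (Polynomial.C : ℚ →+* RH),
        ← mul_assoc, ← map_mul, ← mul_div_assoc, mul_comm (A _ _ : ℚ)]
    | serre i j hij ss r =>
      rw [map_sum, map_zero]
      have hij' : i.1 + 1 ≠ j.1 + 1 := by simpa [Fin.ext_iff] using hij
      rw [← h.serre_sum hij' (hAi _) (hA _ _ hij') (gen g col z (i.1 + 1))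
        (gen_mem _) (gen_mem _ r) _ rfl ss]
      refine Finset.sum_congr rfl fun τ _ => ?_
      have e := map_foldr_comm (f := fun a : FAY n => φ a) hmul hsub
        (List.ofFn fun l => fy n i (ss (τ l))) (fy n j r)
      rw [List.map_ofFn, hφ] at e
      refine e.trans ?_
      congr 2
      funext l
      exact hφ _ _
  refine ⟨RingQuot.liftAlgHom RH ⟨φ, hrel⟩, fun i r hi hin => ?_⟩
  rw [gy1_eq ⟨hi, hin⟩, RingQuot.liftAlgHom_mkAlgHom_apply, hφ]
  simp only [Nat.sub_add_cancel hi]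

end Gen
end Tw
end TwistedRelations

/-! ### Linear independence by specialization -/

section Descent
variable {Y H : Type} [AddCommMonoid Y] [Module RH Y]

/-- A family over `ℚ[ħ]` is independent when leading terms are separated after specialization to
`ħ = 0`. -/
theorem linearIndependent_of_specialization (x : H → Y) (deg : H → ℕ)
    (hf : ∀ h₀, ∃ (P : Type) (_ : AddCommGroup P) (_ : Module RH P) (F : Y →ₗ[RH] P) (ψ : P →+ ℚ),
      (∀ p : P, hbar • p = 0 → p = 0) ∧ (∀ (c : RH) (p : P), ψ (c • p) = c.coeff 0 * ψ p) ∧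
      ψ (F (x h₀)) ≠ 0 ∧ ∀ h, h ≠ h₀ → deg h ≤ deg h₀ → ψ (F (x h)) = 0) :
    LinearIndependent RH x := by
  classical
  choose P instA instM F ψ hP hψ h_ne h_zero using hf
  let Z : (H →₀ RH) → Prop := fun l => ∀ h₀, Finsupp.linearCombination RH (F h₀ ∘ x) l = 0
  have h₁ : ∀ l, Z l → ∀ h, (l h).coeff 0 = 0 := by
    intro l hl
    by_contra! hne
    obtain ⟨h, hh⟩ := hne
    obtain ⟨h₀, hm, hmax⟩ := Finset.exists_max_image (l.support.filter fun h => (l h).coeff 0 ≠ 0)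
      deg ⟨h, Finset.mem_filter.2 ⟨Finsupp.mem_support_iff.2 fun h' => hh (by rw [h']; rfl), hh⟩⟩
    have e := congrArg (ψ h₀) (hl h₀)
    rw [map_zero, Finsupp.linearCombination_apply, Finsupp.sum, map_sum,
      Finset.sum_eq_single h₀] at e
    · rw [hψ] at e
      exact mul_ne_zero (Finset.mem_filter.1 hm).2 (h_ne h₀) e
    · intro h hs hne
      rw [hψ]
      by_cases h' : (l h).coeff 0 = 0
      · rw [h', zero_mul]
      · rw [Function.comp_apply, h_zero h₀ h hne (hmax h (Finset.mem_filter.2 ⟨hs, h'⟩)), mul_zero]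
    · intro h'; exact absurd (Finset.mem_filter.1 hm).1 h'
  have h₂ : ∀ l, Z l → ∃ l', l = hbar • l' ∧ Z l' := by
    intro l hl
    have e : l = hbar • l.mapRange Polynomial.divX Polynomial.divX_zero := by
      ext1 h
      rw [Finsupp.smul_apply, Finsupp.mapRange_apply, smul_eq_mul]
      nth_rw 1 [← Polynomial.divX_mul_X_add (l h)]
      rw [h₁ l hl h, map_zero, add_zero, mul_comm]
      rfl
    refine ⟨_, e, fun h₀ => hP h₀ _ ?_⟩
    rw [← map_smul, ← e]
    exact hl h₀
  have h₃ : ∀ k l, Z l → ∀ h, (Polynomial.X : RH) ^ k ∣ l h := by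
    intro k
    induction k with
    | zero => intro l _ h; rw [pow_zero]; exact one_dvd _
    | succ k ih =>
      intro l hl h
      obtain ⟨l', rfl, hl'⟩ := h₂ l hl
      rw [Finsupp.smul_apply, smul_eq_mul, pow_succ']
      exact mul_dvd_mul_left _ (ih l' hl' h)
  intro l l' hl
  rw [← sub_eq_zero]
  ext h k
  refine Polynomial.X_pow_dvd_iff.1 (h₃ (k + 1) (l - l') (fun h₀ => ?_) h) k (Nat.lt_succ_self k)
  rw [map_sub, ← Finsupp.apply_linearCombination, ← Finsupp.apply_linearCombination, hl, sub_self]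

end Descent

/-! ### Products of primitive elements on several chains -/

section Chains
variable {ι U : Type} [DecidableEq ι] [DecidableEq U] {K : Type} [CommRing K]
  {g : ι × U → ι × U → K}

namespace Tw

/-- The support consists of nonempty subsets of a single chain. -/
def Primitive (f : Tw g) : Prop := ∀ S, f S ≠ 0 → ∃ a ∈ S, ∀ b ∈ S, b.1 = a.1

theorem Primitive.comm (hg : ∀ a b : ι × U, a.1 ≠ b.1 → g a b = 1) {f h : Tw g}
    (hf : Primitive f) (hh : Primitive h) : Primitive (f * h - h * f) := by
  intro S hS
  rw [comm_apply] at hS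
  obtain ⟨T, hT, hne⟩ := Finset.exists_ne_zero_of_sum_ne_zero hS
  obtain ⟨a, ha, ha'⟩ := hf T (left_ne_zero_of_mul (right_ne_zero_of_mul hne))
  obtain ⟨b, hb, hb'⟩ := hh _ (right_ne_zero_of_mul (right_ne_zero_of_mul hne))
  rw [Finset.mem_powerset] at hT
  refine ⟨a, hT ha, fun c hc => ?_⟩
  by_cases hcT : c ∈ T
  · exact ha' c hcT
  rw [hb' c (Finset.mem_sdiff.2 ⟨hc, hcT⟩)]
  by_contra hba
  refine left_ne_zero_of_mul hne ?_
  rw [bi_eq_one fun x hx y hy => hg x y ?_, bi_eq_one fun x hx y hy => hg x y ?_, sub_self]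
  · rw [ha' y hy, hb' x hx]; exact hba
  · rw [ha' x hx, hb' y hy]; exact Ne.symm hba

theorem Primitive.eval (hg : ∀ a b : ι × U, a.1 ≠ b.1 → g a b = 1) {y : ℕ → ℕ → Tw g}
    (hy : ∀ i r, Primitive (y i r)) (τ : BrTree) : Primitive (τ.eval y) := by
  induction τ with
  | leaf i r => exact hy i r
  | node a b ha hb => exact ha.comm hg hb

theorem card_image_le_of_prod_ne_zero {l : List (Tw g)} (hl : ∀ f ∈ l, Primitive f)
    {S : Finset (ι × U)} (hS : l.prod S ≠ 0) : (S.image Prod.fst).card ≤ l.length := by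
  induction l generalizing S with
  | nil =>
    rw [List.prod_nil, one_apply] at hS
    by_cases h : S = ∅
    · simp [h]
    · exact absurd (if_neg h) hS
  | cons f l ih =>
    rw [List.prod_cons, mul_apply] at hS
    obtain ⟨T, hT, hne⟩ := Finset.exists_ne_zero_of_sum_ne_zero hS
    obtain ⟨a, ha, ha'⟩ := hl f (by simp) T (left_ne_zero_of_mul (right_ne_zero_of_mul hne))
    have h₁ := ih (fun f hf => hl f (by simp [hf]))
      (right_ne_zero_of_mul (right_ne_zero_of_mul hne))
    have h₂ : S.image Prod.fst ⊆ insert a.1 ((S \ T).image Prod.fst) := by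
      intro q hq
      obtain ⟨b, hb, rfl⟩ := Finset.mem_image.1 hq
      by_cases hbT : b ∈ T
      · rw [ha' b hbT]; exact Finset.mem_insert_self _ _
      · exact Finset.mem_insert_of_mem (Finset.mem_image_of_mem _ (Finset.mem_sdiff.2 ⟨hb, hbT⟩))
    calc _ ≤ _ := Finset.card_le_card h₂
      _ ≤ _ := Finset.card_insert_le _ _
      _ ≤ _ := by rw [List.length_cons]; omega

/-- The embedding of a chain. -/
def chainEmb (q : ι) : U ↪ ι × U := ⟨Prod.mk q, Prod.mk_right_injective q⟩

/-- The union of prescribed subsets of the chains indexed by `Q`. -/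
def block (s : ι → Finset U) (Q : Finset ι) : Finset (ι × U) :=
  Q.biUnion fun q => (s q).map (chainEmb q)

theorem mem_block {s : ι → Finset U} {Q : Finset ι} {a : ι × U} :
    a ∈ block s Q ↔ a.1 ∈ Q ∧ a.2 ∈ s a.1 := by
  simp only [block, Finset.mem_biUnion, Finset.mem_map, chainEmb, Function.Embedding.coeFn_mk]
  constructor
  · rintro ⟨q, hq, u, hu, rfl⟩; exact ⟨hq, hu⟩
  · rintro ⟨h₁, h₂⟩; exact ⟨a.1, h₁, a.2, h₂, rfl⟩

set_option linter.unusedSectionVars false in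
theorem mem_map_chainEmb {s : Finset U} {q : ι} {a : ι × U} :
    a ∈ s.map (chainEmb q) ↔ a.1 = q ∧ a.2 ∈ s := by
  simp only [Finset.mem_map, chainEmb, Function.Embedding.coeFn_mk]
  constructor
  · rintro ⟨u, hu, rfl⟩; exact ⟨rfl, hu⟩
  · rintro ⟨rfl, h₂⟩; exact ⟨a.2, h₂, rfl⟩

theorem block_sdiff (s : ι → Finset U) (Q : Finset ι) (q : ι) :
    block s Q \ (s q).map (chainEmb q) = block s (Q.erase q) := by
  ext a
  simp only [Finset.mem_sdiff, mem_block, mem_map_chainEmb, Finset.mem_erase]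
  constructor
  · rintro ⟨⟨h₁, h₂⟩, h₃⟩
    refine ⟨⟨?_, h₁⟩, h₂⟩
    rintro rfl
    exact h₃ ⟨rfl, h₂⟩
  · rintro ⟨⟨h₁, h₂⟩, h₃⟩
    exact ⟨⟨h₂, h₃⟩, fun h => h₁ h.1⟩

/-- The value of a product of primitive elements on a block touching as many chains as there are
factors. -/
theorem prod_block (hg : ∀ a b : ι × U, a.1 ≠ b.1 → g a b = 1) {s : ι → Finset U}
    (hs : ∀ q, (s q).Nonempty) {f : Tw g} (hf : Primitive f) {l : List (Tw g)}
    (hl : ∀ f ∈ l, Primitive f) {Q : Finset ι} (hQ : Q.card = l.length + 1) :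
    (f * l.prod) (block s Q) =
      ∑ q ∈ Q, f ((s q).map (chainEmb q)) * l.prod (block s (Q.erase q)) := by
  rw [mul_apply]
  symm
  refine Finset.sum_of_injOn (fun q => (s q).map (chainEmb q)) ?_ ?_ ?_ ?_
  · intro q _ q' _ h
    obtain ⟨u, hu⟩ := hs q
    have h' : (s q).map (chainEmb q) = (s q').map (chainEmb q') := h
    have : (q, u) ∈ (s q').map (chainEmb q') := by
      rw [← h']; exact mem_map_chainEmb.2 ⟨rfl, hu⟩
    exact (mem_map_chainEmb.1 this).1
  · intro q hq
    refine Finset.mem_coe.2 (Finset.mem_powerset.2 fun a ha => ?_)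
    obtain ⟨rfl, h⟩ := mem_map_chainEmb.1 ha
    exact mem_block.2 ⟨hq, h⟩
  · intro T hT hT'
    by_contra hne
    obtain ⟨a, ha, ha'⟩ := hf T (left_ne_zero_of_mul (right_ne_zero_of_mul hne))
    have hc := card_image_le_of_prod_ne_zero hl (right_ne_zero_of_mul (right_ne_zero_of_mul hne))
    rw [Finset.mem_powerset] at hT
    have haQ := mem_block.1 (hT ha)
    refine hT' ⟨a.1, haQ.1, ?_⟩
    by_contra hTa
    have : Q ⊆ (block s Q \ T).image Prod.fst := by
      intro q hq
      obtain ⟨u, hu⟩ := hs q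
      by_cases hqa : q = a.1
      · subst hqa
        have : ∃ u ∈ s a.1, (a.1, u) ∉ T := by
          by_contra! hall
          refine hTa (subset_antisymm (fun b hb => ?_) fun b hb => ?_)
          · obtain ⟨h₁, h₂⟩ := mem_map_chainEmb.1 hb
            have := hall b.2 h₂
            rwa [← h₁] at this
          · exact mem_map_chainEmb.2 ⟨ha' b hb, by
              have := (mem_block.1 (hT hb)).2
              rwa [ha' b hb] at this⟩
        obtain ⟨u, hu, huT⟩ := this
        exact Finset.mem_image.2 ⟨(a.1, u),
          Finset.mem_sdiff.2 ⟨mem_block.2 ⟨hq, hu⟩, huT⟩, rfl⟩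
      · exact Finset.mem_image.2 ⟨(q, u), Finset.mem_sdiff.2 ⟨mem_block.2 ⟨hq, hu⟩,
          fun h => hqa (ha' _ h)⟩, rfl⟩
    have := Finset.card_le_card this
    omega
  · intro q hq
    rw [block_sdiff, bi_eq_one, one_mul]
    intro a ha b hb
    refine hg a b ?_
    rw [(mem_map_chainEmb.1 ha).1]
    exact Ne.symm (Finset.mem_erase.1 (mem_block.1 hb).1).1

end Tw
end Chains

/-! ### Values of iterated commutators -/

section Values
variable {σ : Type} [DecidableEq σ] {D : Type} [CommRing D] {g : σ → σ → D} {col : σ → ℕ}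
attribute [local instance] LieRing.ofAssociativeRing

namespace Tw

/-- Every set in the support has `ν c` elements of colour `c`. -/
def Homog (col : σ → ℕ) (f : Tw g) (ν : ℕ → ℕ) : Prop :=
  ∀ S, f S ≠ 0 → ∀ c, (S.filter fun a => col a = c).card = ν c

theorem Homog.lie {f h : Tw g} {ν ν' ν'' : ℕ → ℕ} (hf : Homog col f ν) (hh : Homog col h ν')
    (hν : ∀ c, ν c + ν' c = ν'' c) : Homog col ⁅f, h⁆ ν'' := by
  intro S hS c
  rw [LieRing.of_associative_ring_bracket, comm_apply] at hS
  obtain ⟨T, hT, hne⟩ := Finset.exists_ne_zero_of_sum_ne_zero hS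
  rw [← hν, ← hf T (left_ne_zero_of_mul (right_ne_zero_of_mul hne)) c,
    ← hh _ (right_ne_zero_of_mul (right_ne_zero_of_mul hne)) c,
    ← Finset.card_union_of_disjoint, ← Finset.filter_union,
    Finset.union_sdiff_of_subset (Finset.mem_powerset.1 hT)]
  exact Finset.disjoint_filter_filter Finset.disjoint_sdiff

set_option linter.unusedSectionVars false in
theorem homog_gen (z : σ → D) (i r : ℕ) :
    Homog col (gen g col z i r) fun c => if c = i then 1 else 0 := by
  intro S hS c
  rw [gen, ell] at hS
  split_ifs at hS with h
  · obtain ⟨a, rfl⟩ := Finset.card_eq_one.1 h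
    rw [Finset.sum_singleton] at hS
    have ha : col a = i := by by_contra h; exact hS (if_neg h)
    subst ha
    rw [Finset.filter_singleton]
    show _ = if c = col a then 1 else 0
    by_cases hc : col a = c
    · rw [if_pos hc, if_pos hc.symm, Finset.card_singleton]
    · rw [if_neg hc, if_neg (Ne.symm hc), Finset.card_empty]
  · exact absurd rfl hS

/-- The value of a string of commutators on a path of sites. -/
theorem strF_image {e : ℕ → ℕ → Tw g} {c : ℕ → ℕ} {x : ℕ → σ} {w : ℕ → D} {i l : ℕ}
    (he : ∀ k r, e k r = gen g col (fun _ => 1) (c k) r)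
    (hx : ∀ k, i ≤ k → k ≤ i + l → ∀ k', i ≤ k' → k' ≤ i + l → (col (x k) = c k' ↔ k = k'))
    (h1 : ∀ k k', i ≤ k → k + 1 < k' → k' ≤ i + l → g (x k) (x k') = 1 ∧ g (x k') (x k) = 1)
    (hw : ∀ k, i ≤ k → k < i + l → g (x k) (x (k + 1)) - g (x (k + 1)) (x k) = w k) (s : ℕ) :
    strF e i l s ((Finset.Icc i (i + l)).image x) = ∏ k ∈ Finset.Ico i (i + l), w k := by
  induction l with
  | zero =>
    rw [strF, he, gen, Nat.add_zero, Finset.Icc_self, Finset.image_singleton, ell_singleton,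
      if_pos ((hx i le_rfl (by omega) i le_rfl (by omega)).2 rfl), one_pow, Finset.Ico_self,
      Finset.prod_empty]
  | succ l ih =>
    have hinj : ∀ k, i ≤ k → k ≤ i + l + 1 → ∀ k', i ≤ k' → k' ≤ i + l + 1 → x k = x k' →
        k = k' := fun k h₁ h₂ k' h₃ h₄ h =>
      (hx k h₁ h₂ k' h₃ h₄).1 (by rw [h]; exact (hx k' h₃ h₄ k' h₃ h₄).2 rfl)
    have herase : ((Finset.Icc i (i + (l + 1))).image x).erase (x (i + l + 1)) =
        (Finset.Icc i (i + l)).image x := by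
      ext a
      simp only [Finset.mem_erase, Finset.mem_image, Finset.mem_Icc]
      constructor
      · rintro ⟨h, k, hk, rfl⟩
        refine ⟨k, ⟨hk.1, ?_⟩, rfl⟩
        by_contra hlt
        obtain rfl : k = i + l + 1 := by omega
        exact h rfl
      · rintro ⟨k, hk, rfl⟩
        refine ⟨fun h => ?_, k, ⟨hk.1, by omega⟩, rfl⟩
        have := hinj k hk.1 (by omega) _ (by omega) le_rfl h
        omega
    have hb : ∀ h : σ → σ → D, (∀ k, i ≤ k → k < i + l → h (x k) (x (i + l + 1)) = 1) →
        bi h ((Finset.Icc i (i + l)).image x) {x (i + l + 1)} = h (x (i + l)) (x (i + l + 1)) := by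
      intro h hh
      rw [bi, Finset.prod_image fun k hk k' hk' => by
        simp only [Finset.coe_Icc, Set.mem_Icc] at hk hk'
        exact hinj k hk.1 (by omega) k' hk'.1 (by omega)]
      simp only [Finset.prod_singleton]
      refine Finset.prod_eq_single (i + l) (fun k hk hne => ?_) fun h => ?_
      · rw [Finset.mem_Icc] at hk
        exact hh k hk.1 (by omega)
      · exact absurd (Finset.mem_Icc.2 ⟨by omega, le_rfl⟩) h
    have hb' : bi g {x (i + l + 1)} ((Finset.Icc i (i + l)).image x) =
        g (x (i + l + 1)) (x (i + l)) := by
      rw [bi, Finset.prod_singleton, ← hb fun a b => g b a]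
      · simp only [bi, Finset.prod_singleton]
      · exact fun k h₁ h₂ => (h1 k _ h₁ (by omega) le_rfl).2
    rw [strF, LieRing.of_associative_ring_bracket, he, gen, comm_ell_apply,
      Finset.sum_eq_single (x (i + l + 1)), herase,
      ih (fun k h₁ h₂ k' h₃ h₄ => hx k h₁ (by omega) k' h₃ (by omega))
        (fun k k' h₁ h₂ h₃ => h1 k k' h₁ h₂ (by omega)) (fun k h₁ h₂ => hw k h₁ (by omega)),
      if_pos ((hx _ (by omega) (by omega) _ (by omega) (by omega)).2 rfl), one_pow, mul_one,
      hb g fun k h₁ h₂ => (h1 k _ h₁ (by omega) le_rfl).1, hb', hw _ (by omega) (by omega),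
      ← Nat.add_assoc, Finset.prod_Ico_succ_top (by omega), mul_comm]
    · intro a ha hne
      obtain ⟨k, hk, rfl⟩ := Finset.mem_image.1 ha
      rw [Finset.mem_Icc] at hk
      rw [if_neg, mul_zero, mul_zero]
      intro h
      have := (hx k hk.1 (by omega) (i + l + 1) (by omega) (by omega)).1 h
      exact hne (by rw [this])
    · intro h
      exact absurd (Finset.mem_image_of_mem x (Finset.mem_Icc.2 ⟨by omega, by omega⟩)) h

end Tw
end Values

/-! ### A chain with two sites of each colour -/

section Chain
attribute [local instance] LieRing.ofAssociativeRing
variable {N : ℕ}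

/-- The sites of a chain. -/
abbrev Site (N : ℕ) : Type := Fin (N + 1) × Bool

/-- The colour of a site. -/
def siteCol (u : Site N) : ℕ := u.1.1 + 1

/-- The site of colour `k` and type `b`. -/
def site (N k : ℕ) (b : Bool) : Site N := (Fin.ofNat (N + 1) (k - 1), b)

theorem siteCol_site {k : ℕ} (h₁ : 1 ≤ k) (h₂ : k ≤ N + 1) (b : Bool) :
    siteCol (site N k b) = k := by
  simp only [siteCol, site, Fin.val_ofNat]
  rw [Nat.mod_eq_of_lt (by omega)]
  omega

theorem site_siteCol (u : Site N) : site N (siteCol u) u.2 = u := by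
  refine Prod.ext (Fin.ext ?_) rfl
  simp only [siteCol, site, Fin.val_ofNat]
  rw [Nat.mod_eq_of_lt (by omega)]
  omega

theorem eq_site_iff {u : Site N} {k : ℕ} (h₁ : 1 ≤ k) (h₂ : k ≤ N + 1) {b : Bool} :
    u = site N k b ↔ siteCol u = k ∧ u.2 = b := by
  constructor
  · rintro rfl; exact ⟨siteCol_site h₁ h₂ b, rfl⟩
  · rintro ⟨rfl, rfl⟩; exact (site_siteCol u).symm

theorem siteCol_pos (u : Site N) : 1 ≤ siteCol u := Nat.succ_le_succ (Nat.zero_le _)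
theorem siteCol_le (u : Site N) : siteCol u ≤ N + 1 := u.1.2

/-- The sign of an ordered pair of sites. -/
def siteSgn (k l : ℕ) (b : Bool) : ℤ := if k < l then 1 else if l < k then -1 else if b then 1 else -1

/-- The twist of a chain with integral spectral parameters. -/
def siteTwist (A : ℕ → ℕ → ℤ) (d : ℕ → ℕ) (P : ℕ → Bool → ℤ) (k : ℕ) (b : Bool) (l : ℕ) (b' : Bool) :
    ℤ :=
  if A k l = 0 then 1 else siteSgn k l b * (P k b - P l b' + 2 * d k * A k l)

/-- The twist of a chain with integral spectral parameters, as a function of the sites. -/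
def chainTwist (A : ℕ → ℕ → ℤ) (d : ℕ → ℕ) (P : ℕ → Bool → ℤ) (u v : Site N) : ℤ :=
  siteTwist A d P (siteCol u) u.2 (siteCol v) v.2

theorem chainTwist_site (A : ℕ → ℕ → ℤ) (d : ℕ → ℕ) (P : ℕ → Bool → ℤ) {k l : ℕ} (h₁ : 1 ≤ k)
    (h₂ : k ≤ N + 1) (h₃ : 1 ≤ l) (h₄ : l ≤ N + 1) (b b' : Bool) :
    chainTwist A d P (site N k b) (site N l b') = siteTwist A d P k b l b' := by
  rw [chainTwist, siteCol_site h₁ h₂, siteCol_site h₃ h₄]; rfl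

theorem siteSgn_sq (k l : ℕ) (b : Bool) : siteSgn k l b * siteSgn k l b = 1 := by
  unfold siteSgn; split_ifs <;> rfl

theorem siteSgn_swap {u v : Site N} (h : u ≠ v) :
    siteSgn (siteCol v) (siteCol u) v.2 = -siteSgn (siteCol u) (siteCol v) u.2 := by
  have : siteCol u = siteCol v → v.2 = !u.2 := by
    intro hc
    by_contra hb
    refine h ?_
    rw [← site_siteCol u, ← site_siteCol v, hc]
    congr 1
    revert hb
    cases u.2 <;> cases v.2 <;> simp
  unfold siteSgn
  rcases lt_trichotomy (siteCol u) (siteCol v) with h | h | h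
  · rw [if_neg (by omega), if_pos h, if_pos h]
  · rw [this h, h, if_neg (lt_irrefl _), if_neg (lt_irrefl _), if_neg (lt_irrefl _),
      if_neg (lt_irrefl _)]
    cases u.2 <;> rfl
  · rw [if_pos h, if_neg (by omega), if_pos h]; rfl

/-- A symmetrized Cartan matrix with entries as in types `C` and `D`. -/
structure CartanData (n : ℕ) (A : ℕ → ℕ → ℤ) (d : ℕ → ℕ) : Prop where
  diag : ∀ i, A i i = 2
  entry : ∀ i j, i ≠ j → A i j = 0 ∨ A i j = -1 ∨ A i j = -2
  symm : ∀ i j, i ≤ n → j ≤ n → d i * A i j = d j * A j i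
  pos : ∀ i, d i ≠ 0

theorem CartanData.zero_comm {n : ℕ} {A : ℕ → ℕ → ℤ} {d : ℕ → ℕ} (h : CartanData n A d) {i j : ℕ}
    (hi : i ≤ n) (hj : j ≤ n) : A i j = 0 ↔ A j i = 0 := by
  have := h.symm i j hi hj
  have h₁ : (d i : ℤ) ≠ 0 := by exact_mod_cast h.pos i
  have h₂ : (d j : ℤ) ≠ 0 := by exact_mod_cast h.pos j
  constructor <;> intro h₀ <;> rw [h₀, mul_zero] at this
  · exact (mul_eq_zero.1 this.symm).resolve_left h₂
  · exact (mul_eq_zero.1 this).resolve_left h₁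

/-- The defining property of the twist of a chain. -/
theorem CartanData.chainTwist_bond {A : ℕ → ℕ → ℤ} {d : ℕ → ℕ} (h : CartanData (N + 1) A d)
    (P : ℕ → Bool → ℤ) {u v : Site N} (huv : u ≠ v) (hA : A (siteCol u) (siteCol v) ≠ 0) :
    siteSgn (siteCol u) (siteCol v) u.2 * chainTwist A d P u v =
      P (siteCol u) u.2 - P (siteCol v) v.2 + A (siteCol u) (siteCol v) * (2 * d (siteCol u)) ∧
    siteSgn (siteCol u) (siteCol v) u.2 * chainTwist A d P v u =
      P (siteCol u) u.2 - P (siteCol v) v.2 - A (siteCol u) (siteCol v) * (2 * d (siteCol u)) := by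
  have h₁ := siteSgn_sq (siteCol u) (siteCol v) u.2
  have h₂ := h.symm (siteCol u) (siteCol v) (siteCol_le u) (siteCol_le v)
  rw [chainTwist, chainTwist, siteTwist, siteTwist, if_neg hA, if_neg (mt (h.zero_comm (siteCol_le u) (siteCol_le v)).2 hA),
    siteSgn_swap huv]
  constructor
  · linear_combination (P (siteCol u) u.2 - P (siteCol v) v.2 +
      A (siteCol u) (siteCol v) * (2 * d (siteCol u))) * h₁
  · linear_combination (P (siteCol u) u.2 - P (siteCol v) v.2 -
      A (siteCol v) (siteCol u) * (2 * d (siteCol v))) * h₁ + 2 * h₂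

theorem CartanData.chainTwist_symm {A : ℕ → ℕ → ℤ} {d : ℕ → ℕ} (h : CartanData (N + 1) A d)
    (P : ℕ → Bool → ℤ) {u v : Site N} (hA : A (siteCol u) (siteCol v) = 0) :
    chainTwist A d P u v = 1 ∧ chainTwist A d P v u = 1 :=
  ⟨if_pos hA, if_pos ((h.zero_comm (siteCol_le u) (siteCol_le v)).1 hA)⟩

/-- The generators of the chain. -/
def chainGen (A : ℕ → ℕ → ℤ) (d : ℕ → ℕ) (P : ℕ → Bool → ℤ) (N : ℕ) (i r : ℕ) :
    Tw (chainTwist (N := N) A d P) :=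
  Tw.gen (chainTwist A d P) siteCol (fun _ => 1) i r

theorem chainGen_congr (A : ℕ → ℕ → ℤ) (d : ℕ → ℕ) (P : ℕ → Bool → ℤ) :
    ∀ r r' i, chainGen A d P N i r = chainGen A d P N i r' := by
  intro r r' i
  simp only [chainGen, Tw.gen, one_pow]

theorem CartanData.currentRel {A : ℕ → ℕ → ℤ} {d : ℕ → ℕ} (h : CartanData (N + 1) A d)
    (P : ℕ → Bool → ℤ) : CurrentRel (N + 1) A (chainGen A d P N) where
  loop i j r s _ _ _ _ := by
    rw [chainGen_congr A d P (r + 1) r, chainGen_congr A d P s (s + 1)]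
  serre i j _ _ _ _ hij ss r := by
    have hc : Tw.Compatible A (fun i => 2 * (d i : ℤ)) siteCol
        (fun u : Site N => P (siteCol u) u.2) (chainTwist A d P) := by
      refine ⟨fun u v _ hA => ?_, fun u v huv hA => ⟨siteSgn (siteCol u) (siteCol v) u.2,
        fun h₀ => ?_, h.chainTwist_bond P huv hA⟩⟩
      · rw [(h.chainTwist_symm P hA).1, (h.chainTwist_symm P hA).2]
      · have := siteSgn_sq (siteCol u) (siteCol v) u.2
        rw [h₀] at this
        exact absurd this (by norm_num)
    exact hc.serre_sum hij (h.diag i) (h.entry i j hij) (fun r => chainGen A d P N i r)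
      (fun r => Tw.gen_mem i r) (Tw.gen_mem j r) _ rfl ss
  torsionFree m hm x hx := by
    funext S
    have : (m • x) S = 0 := by rw [hx]; rfl
    have h' : m • (x S) = 0 := this
    exact (smul_eq_zero.1 h').resolve_left hm

end Chain

/-! ### Values of root vectors on the chain -/

section ChainValues
attribute [local instance] LieRing.ofAssociativeRing
variable {N : ℕ} {A : ℕ → ℕ → ℤ} {d : ℕ → ℕ} {P : ℕ → Bool → ℤ}

theorem CartanData.strF_chain (h : CartanData (N + 1) A d) {e : ℕ → ℕ → Tw (chainTwist (N := N) A d P)}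
    {c : ℕ → ℕ} {i l : ℕ} (he : ∀ k r, e k r = chainGen A d P N (c k) r)
    (hc : ∀ k, i ≤ k → k ≤ i + l → 1 ≤ c k ∧ c k ≤ N + 1)
    (hmono : ∀ k k', i ≤ k → k < k' → k' ≤ i + l → c k < c k')
    (far : ∀ k k', i ≤ k → k + 1 < k' → k' ≤ i + l → A (c k) (c k') = 0)
    (near : ∀ k, i ≤ k → k < i + l → A (c k) (c (k + 1)) ≠ 0) (b : ℕ → Bool) (s : ℕ) :
    strF e i l s ((Finset.Icc i (i + l)).image fun k => site N (c k) (b k)) =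
      ∏ k ∈ Finset.Ico i (i + l), 4 * (d (c k) * A (c k) (c (k + 1))) := by
  refine Tw.strF_image he ?_ ?_ ?_ s
  · intro k h₁ h₂ k' h₃ h₄
    rw [siteCol_site (hc k h₁ h₂).1 (hc k h₁ h₂).2]
    constructor
    · intro hk
      rcases lt_trichotomy k k' with hlt | hlt | hlt
      · exact absurd hk (hmono k k' h₁ hlt h₄).ne
      · exact hlt
      · exact absurd hk (hmono k' k h₃ hlt h₂).ne'
    · rintro rfl; rfl
  · intro k k' h₁ h₂ h₃
    obtain ⟨h₄, h₅⟩ := hc k h₁ (by omega)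
    obtain ⟨h₆, h₇⟩ := hc k' (by omega) h₃
    refine h.chainTwist_symm P ?_
    rw [siteCol_site h₄ h₅, siteCol_site h₆ h₇]
    exact far k k' h₁ h₂ h₃
  · intro k h₁ h₂
    obtain ⟨h₄, h₅⟩ := hc k h₁ (by omega)
    obtain ⟨h₆, h₇⟩ := hc (k + 1) (by omega) (by omega)
    have hlt := hmono k (k + 1) h₁ (by omega) (by omega)
    rw [chainTwist_site A d P h₄ h₅ h₆ h₇, chainTwist_site A d P h₆ h₇ h₄ h₅, siteTwist, siteTwist,
      if_neg (near k h₁ h₂), if_neg (mt (h.zero_comm h₅ h₇).2 (near k h₁ h₂)), siteSgn, siteSgn,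
      if_pos hlt, if_neg (by omega), if_pos hlt]
    linear_combination -2 * h.symm (c k) (c (k + 1)) h₅ h₇

theorem CartanData.prod_ne_zero (h : CartanData (N + 1) A d) {c : ℕ → ℕ} {i m : ℕ}
    (near : ∀ k, i ≤ k → k < m → A (c k) (c (k + 1)) ≠ 0) :
    ∏ k ∈ Finset.Ico i m, 4 * ((d (c k) : ℤ) * A (c k) (c (k + 1))) ≠ 0 := by
  refine Finset.prod_ne_zero_iff.2 fun k hk => ?_
  rw [Finset.mem_Ico] at hk
  refine mul_ne_zero (by norm_num) (mul_ne_zero ?_ (near k hk.1 hk.2))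
  exact_mod_cast h.pos _

theorem homog_strF (i l s : ℕ) : Tw.Homog siteCol (strF (chainGen A d P N) i l s)
    fun c => if i ≤ c ∧ c ≤ i + l then 1 else 0 := by
  induction l with
  | zero =>
    have h : (fun c => if i ≤ c ∧ c ≤ i + 0 then 1 else 0) = fun c => if c = i then 1 else 0 := by
      funext c; split_ifs <;> omega
    rw [h]
    exact Tw.homog_gen _ _ _
  | succ l ih =>
    rw [strF]
    refine ih.lie (Tw.homog_gen _ _ _) fun c => ?_
    split_ifs <;> omega

theorem homog_topF {M i : ℕ} (hi : i ≤ M) (s : ℕ) : Tw.Homog siteCol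
    (topF (chainGen A d P N) M i s) fun c => if i ≤ c ∧ c ≤ M then 1 else 0 := by
  have := homog_strF (A := A) (d := d) (P := P) (N := N) i (M - i) s
  rwa [Nat.add_sub_cancel' hi] at this

/-- Of the two sites of a colour of multiplicity one, exactly one belongs to the set. -/
theorem Tw.Homog.site_mem_iff {g : Site N → Site N → ℤ} {f : Tw g} {ν : ℕ → ℕ}
    (hf : Tw.Homog siteCol f ν) {T : Finset (Site N)} (hT : f T ≠ 0) {k : ℕ} (h₁ : 1 ≤ k)
    (h₂ : k ≤ N + 1) (hk : ν k = 1) : site N k true ∈ T ↔ site N k false ∉ T := by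
  obtain ⟨u, hu⟩ := Finset.card_eq_one.1 ((hf T hT k).trans hk)
  have hmem : ∀ b, site N k b ∈ T ↔ site N k b = u := fun b => by
    rw [← Finset.mem_singleton, ← hu, Finset.mem_filter]
    exact (and_iff_left (siteCol_site h₁ h₂ b)).symm
  have hu' : siteCol u = k := by
    have : u ∈ ({u} : Finset (Site N)) := Finset.mem_singleton_self u
    rw [← hu] at this
    exact (Finset.mem_filter.1 this).2
  have hne : ∀ b, site N k b = u ↔ u.2 = b := fun b => by
    rw [eq_comm, eq_site_iff h₁ h₂]
    exact and_iff_right hu'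
  rw [hmem, hmem, hne, hne]
  cases u.2 <;> simp

theorem Tw.Homog.col_of_mem {g : Site N → Site N → ℤ} {f : Tw g} {ν : ℕ → ℕ}
    (hf : Tw.Homog siteCol f ν) {T : Finset (Site N)} (hT : f T ≠ 0) {u : Site N} (hu : u ∈ T) :
    ν (siteCol u) ≠ 0 := by
  rw [← hf T hT]
  exact Finset.card_ne_zero_of_mem (Finset.mem_filter.2 ⟨hu, rfl⟩)

/-- The sites of type `true` with colours in `[i, m]`. -/
def upSet (N i m : ℕ) : Finset (Site N) :=
  Finset.univ.filter fun u => u.2 = true ∧ i ≤ siteCol u ∧ siteCol u ≤ m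

/-- The sites of type `false` with colours in `[j, m]`. -/
def downSet (N j m : ℕ) : Finset (Site N) :=
  Finset.univ.filter fun u => u.2 = false ∧ j ≤ siteCol u ∧ siteCol u ≤ m

theorem mem_upSet {i m : ℕ} {u : Site N} :
    u ∈ upSet N i m ↔ u.2 = true ∧ i ≤ siteCol u ∧ siteCol u ≤ m := by
  simp [upSet]

theorem mem_downSet {j m : ℕ} {u : Site N} :
    u ∈ downSet N j m ↔ u.2 = false ∧ j ≤ siteCol u ∧ siteCol u ≤ m := by
  simp [downSet]

theorem site_mem_upSet {i m k : ℕ} (h₁ : 1 ≤ k) (h₂ : k ≤ N + 1) {b : Bool} :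
    site N k b ∈ upSet N i m ↔ b = true ∧ i ≤ k ∧ k ≤ m := by
  rw [mem_upSet, siteCol_site h₁ h₂]; rfl

theorem site_mem_downSet {j m k : ℕ} (h₁ : 1 ≤ k) (h₂ : k ≤ N + 1) {b : Bool} :
    site N k b ∈ downSet N j m ↔ b = false ∧ j ≤ k ∧ k ≤ m := by
  rw [mem_downSet, siteCol_site h₁ h₂]; rfl

theorem image_site_eq {c : ℕ → ℕ} {b : ℕ → Bool} {i m : ℕ} {S : Finset (Site N)}
    (hc : ∀ k, i ≤ k → k ≤ m → 1 ≤ c k ∧ c k ≤ N + 1 ∧ site N (c k) (b k) ∈ S)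
    (hS : ∀ u ∈ S, ∃ k, i ≤ k ∧ k ≤ m ∧ siteCol u = c k ∧ u.2 = b k) :
    (Finset.Icc i m).image (fun k => site N (c k) (b k)) = S := by
  ext u
  simp only [Finset.mem_image, Finset.mem_Icc]
  constructor
  · rintro ⟨k, hk, rfl⟩; exact (hc k hk.1 hk.2).2.2
  · intro hu
    obtain ⟨k, h₁, h₂, h₃⟩ := hS u hu
    exact ⟨k, ⟨h₁, h₂⟩, ((eq_site_iff (hc k h₁ h₂).1 (hc k h₁ h₂).2.1).2 h₃).symm⟩

end ChainValues

/-! ### Type `C` -/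

section ValuesC
attribute [local instance] LieRing.ofAssociativeRing
variable {N : ℕ}

theorem cartanData_C (n : ℕ) : CartanData n (aC n) (dC n) where
  diag i := by simp [aC]
  entry i j hij := by unfold aC; split_ifs <;> simp_all
  symm i j _ _ := by
    unfold aC dC
    split_ifs <;> omega
  pos i := by unfold dC; split_ifs <;> norm_num

theorem aC_far {n k l : ℕ} (h : k + 1 < l) : aC n k l = 0 := by
  unfold aC
  rw [if_neg (by omega), if_neg (by omega), if_neg (by omega)]

theorem aC_near {n k : ℕ} : aC n k (k + 1) ≠ 0 := by
  unfold aC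
  split_ifs <;> omega

/-- The spectral parameters of the chain of type `C`. -/
def paramC (N k : ℕ) (b : Bool) : ℤ :=
  if k = N + 1 then 4 else if b then 2 * k - 2 * N else if k = N then 8 else 1

/-- The twist of the chain of type `C`. -/
abbrev twistC (N : ℕ) : Site N → Site N → ℤ := chainTwist (aC (N + 1)) (dC (N + 1)) (paramC N)

/-- The generators of the chain of type `C`. -/
abbrev chainC (N : ℕ) : ℕ → ℕ → Tw (twistC N) := chainGen (aC (N + 1)) (dC (N + 1)) (paramC N) N

theorem strF_chainC {i m : ℕ} (hi : 1 ≤ i) (him : i ≤ m) (hm : m ≤ N + 1) (b : ℕ → Bool) (s : ℕ) :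
    strF (chainC N) i (m - i) s ((Finset.Icc i m).image fun k => site N k (b k)) =
      ∏ k ∈ Finset.Ico i m, 4 * (dC (N + 1) k * aC (N + 1) k (k + 1)) := by
  have := (cartanData_C (N + 1)).strF_chain (N := N) (P := paramC N) (e := chainC N) (c := id)
    (i := i) (l := m - i) (fun _ _ => rfl) (fun k _ _ => ⟨by simp only [id]; omega,
      by simp only [id]; omega⟩) (fun k k' _ h _ => h) (fun k k' _ h _ => aC_far h)
    (fun k _ _ => aC_near) b s
  rw [Nat.add_sub_cancel' him] at this
  exact this

theorem prod_aC_ne_zero (N i m : ℕ) :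
    ∏ k ∈ Finset.Ico i m, 4 * ((dC (N + 1) k : ℤ) * aC (N + 1) k (k + 1)) ≠ 0 :=
  (cartanData_C (N + 1)).prod_ne_zero (c := id) fun _ _ _ => aC_near

theorem image_up {i m : ℕ} (hi : 1 ≤ i) (hm : m ≤ N + 1) :
    (Finset.Icc i m).image (fun k => site N k true) = upSet N i m :=
  image_site_eq (c := id) (b := fun _ => true)
    (fun k h₁ h₂ => ⟨by simp only [id]; omega, by simp only [id]; omega,
      (site_mem_upSet (by simp only [id]; omega) (by simp only [id]; omega)).2 ⟨rfl, h₁, h₂⟩⟩)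
    fun u hu => by
      obtain ⟨h₁, h₂, h₃⟩ := mem_upSet.1 hu
      exact ⟨_, h₂, h₃, rfl, h₁⟩

theorem image_down {i m : ℕ} (hi : 1 ≤ i) (hm : m ≤ N + 1) :
    (Finset.Icc i m).image (fun k => site N k false) = downSet N i m :=
  image_site_eq (c := id) (b := fun _ => false)
    (fun k h₁ h₂ => ⟨by simp only [id]; omega, by simp only [id]; omega,
      (site_mem_downSet (by simp only [id]; omega) (by simp only [id]; omega)).2 ⟨rfl, h₁, h₂⟩⟩)
    fun u hu => by
      obtain ⟨h₁, h₂, h₃⟩ := mem_downSet.1 hu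
      exact ⟨_, h₂, h₃, rfl, h₁⟩

theorem strF_chainC_ne_zero {i m : ℕ} (hi : 1 ≤ i) (him : i ≤ m) (hm : m ≤ N + 1) (s : ℕ) :
    strF (chainC N) i (m - i) s (upSet N i m) ≠ 0 := by
  rw [← image_up hi hm, strF_chainC hi him hm (fun _ => true)]
  exact prod_aC_ne_zero _ _ _

theorem twistC_step {k : ℕ} (h₁ : 1 ≤ k) (h₂ : k < N) :
    twistC N (site N (k + 1) true) (site N k true) = 0 := by
  rw [twistC, chainTwist_site _ _ _ (by omega) (by omega) (by omega) (by omega)]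
  simp only [siteTwist, siteSgn, aC, dC, paramC]
  split_ifs <;> first | omega | simp_all

theorem twistC_top (hN : 1 ≤ N) (b : Bool) :
    twistC N (site N N b) (site N (N + 1) true) = if b then -8 else 0 := by
  rw [twistC, chainTwist_site _ _ _ (by omega) (by omega) (by omega) (by omega)]
  cases b <;> simp [siteTwist, siteSgn, aC, dC, paramC]

theorem twistC_top' (hN : 1 ≤ N) (b : Bool) :
    twistC N (site N (N + 1) true) (site N N b) = if b then 0 else 8 := by
  rw [twistC, chainTwist_site _ _ _ (by omega) (by omega) (by omega) (by omega)]
  cases b <;> simp [siteTwist, siteSgn, aC, dC, paramC]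

theorem twistC_ne_zero {k l : ℕ} (h₁ : 1 ≤ k) (h₂ : k ≤ N) (h₃ : 1 ≤ l) (h₄ : l ≤ N) :
    twistC N (site N k true) (site N l false) ≠ 0 := by
  rw [twistC, chainTwist_site _ _ _ (by omega) (by omega) (by omega) (by omega)]
  simp only [siteTwist, siteSgn, aC, dC, paramC]
  split_ifs <;> omega

end ValuesC

section PairC
attribute [local instance] LieRing.ofAssociativeRing
variable {N : ℕ}

theorem homog_tC {i j : ℕ} (hi : i ≤ N) (hj : j ≤ N + 1) (s : ℕ) :
    Tw.Homog siteCol (tC (chainC N) N i j s) fun c =>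
      (if i ≤ c ∧ c ≤ N then 1 else 0) + if j ≤ c ∧ c ≤ N + 1 then 1 else 0 :=
  (homog_topF hi 0).lie (homog_topF hj s) fun _ => rfl

variable {i j : ℕ} {T : Finset (Site N)} {f : Tw (twistC N)}

theorem site_top_notMem (hf : Tw.Homog siteCol f fun c => if i ≤ c ∧ c ≤ N then 1 else 0)
    (hT : f T ≠ 0) (b : Bool) : site N (N + 1) b ∉ T := by
  intro h
  have := hf.col_of_mem hT h
  rw [siteCol_site (by omega) le_rfl] at this
  exact this (if_neg (by omega))

/-- If the left factor of a product is not on the sites of type `true`, then the twist vanishes. -/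
theorem bi_twistC_left (hi : 1 ≤ i) (hiN : i ≤ N)
    (hf : Tw.Homog siteCol f fun c => if i ≤ c ∧ c ≤ N then 1 else 0)
    (hTS : T ⊆ upSet N i (N + 1) ∪ downSet N j N) (hT : f T ≠ 0) (hne : T ≠ upSet N i N) :
    Tw.bi (twistC N) T ((upSet N i (N + 1) ∪ downSet N j N) \ T) = 0 := by
  have hiff : ∀ k, i ≤ k → k ≤ N → (site N k true ∈ T ↔ site N k false ∉ T) := fun k h₁ h₂ =>
    hf.site_mem_iff hT (by omega) (by omega) (if_pos ⟨h₁, h₂⟩)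
  have hmem : ∀ k, i ≤ k → k ≤ N + 1 → site N k true ∈ upSet N i (N + 1) ∪ downSet N j N :=
    fun k h₁ h₂ => Finset.mem_union_left _ ((site_mem_upSet (by omega) h₂).2 ⟨rfl, h₁, h₂⟩)
  by_contra hbi
  have step : ∀ k, i ≤ k → k < N → site N (k + 1) true ∈ T → site N k true ∈ T := by
    intro k h₁ h₂ h
    by_contra hk
    exact hbi (Tw.bi_eq_zero h (Finset.mem_sdiff.2 ⟨hmem k h₁ (by omega), hk⟩)
      (twistC_step (by omega) h₂))
  have top : site N N true ∈ T := by
    by_contra h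
    have h' : site N N false ∈ T := by
      by_contra h'
      exact h ((hiff N hiN le_rfl).2 h')
    exact hbi (Tw.bi_eq_zero h' (Finset.mem_sdiff.2 ⟨hmem (N + 1) (by omega) le_rfl,
      site_top_notMem hf hT true⟩) (twistC_top (by omega) false))
  have all : ∀ m k, i ≤ k → k + m = N → site N k true ∈ T := by
    intro m
    induction m with
    | zero => rintro k _ rfl; exact top
    | succ m ih => exact fun k h₁ h₂ => step k h₁ (by omega) (ih (k + 1) (by omega) (by omega))
  refine hne (Finset.ext fun u => ?_)
  rw [mem_upSet]
  constructor
  · intro hu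
    have hc := hf.col_of_mem hT hu
    have hc' : i ≤ siteCol u ∧ siteCol u ≤ N := by
      by_contra h
      exact hc (if_neg h)
    refine ⟨?_, hc'⟩
    by_contra hb
    refine (hiff _ hc'.1 hc'.2).1 (all (N - siteCol u) _ hc'.1 (by omega)) ?_
    rw [Bool.not_eq_true] at hb
    rw [← hb, site_siteCol]
    exact hu
  · rintro ⟨h₁, h₂, h₃⟩
    rw [← site_siteCol u, h₁]
    exact all (N - siteCol u) _ h₂ (by omega)

/-- If the left factor of a product contains a site of type `true`, then the opposite twist
vanishes. -/
theorem bi_twistC_right (hi : 1 ≤ i)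
    (hf : Tw.Homog siteCol f fun c => if i ≤ c ∧ c ≤ N then 1 else 0)
    (hT : f T ≠ 0) {k : ℕ} (hik : i ≤ k) (hkN : k ≤ N) (hk : site N k true ∈ T) :
    Tw.bi (twistC N) ((upSet N i (N + 1) ∪ downSet N j N) \ T) T = 0 := by
  have hmem : ∀ k, i ≤ k → k ≤ N + 1 → site N k true ∈ upSet N i (N + 1) ∪ downSet N j N :=
    fun k h₁ h₂ => Finset.mem_union_left _ ((site_mem_upSet (by omega) h₂).2 ⟨rfl, h₁, h₂⟩)
  by_contra hbi
  have step : ∀ m, i ≤ m → m < N → site N m true ∈ T → site N (m + 1) true ∈ T := by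
    intro m h₁ h₂ h
    by_contra hk'
    exact hbi (Tw.bi_eq_zero (Finset.mem_sdiff.2 ⟨hmem _ (by omega) (by omega), hk'⟩) h
      (twistC_step (by omega) h₂))
  have all : ∀ m, k + m ≤ N → site N (k + m) true ∈ T := by
    intro m
    induction m with
    | zero => exact fun _ => hk
    | succ m ih => exact fun h => step (k + m) (by omega) (by omega) (ih (by omega))
  have top := all (N - k) (by omega)
  rw [Nat.add_sub_cancel' hkN] at top
  exact hbi (Tw.bi_eq_zero (Finset.mem_sdiff.2 ⟨hmem (N + 1) (by omega) le_rfl,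
      site_top_notMem hf hT true⟩) top (twistC_top' (by omega) true))

theorem sdiff_upSet (hi : i ≤ N + 1) : (upSet N i (N + 1) ∪ downSet N j N) \ upSet N i N =
    downSet N j N ∪ {site N (N + 1) true} := by
  ext u
  rw [Finset.mem_sdiff, Finset.mem_union, Finset.mem_union, Finset.mem_singleton, mem_upSet,
    mem_upSet, mem_downSet, eq_site_iff (by omega) le_rfl]
  have := siteCol_le u
  cases u.2
  · simp
  · simp only [true_and, Bool.true_eq_false, false_and, or_false, false_or, and_true]
    omega

theorem sdiff_downSet : (upSet N i (N + 1) ∪ downSet N i N) \ downSet N i N =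
    upSet N i (N + 1) := by
  rw [Finset.union_sdiff_right, Finset.sdiff_eq_self_iff_disjoint, Finset.disjoint_left]
  intro u h₁ h₂
  rw [mem_upSet] at h₁
  rw [mem_downSet, h₁.1] at h₂
  exact absurd h₂.1 (by simp)

theorem image_down_top (hj : 1 ≤ j) (hjN : j ≤ N + 1) :
    (Finset.Icc j (N + 1)).image (fun k => site N k (decide (k = N + 1))) =
      downSet N j N ∪ {site N (N + 1) true} := by
  refine image_site_eq (c := id) (b := fun k => decide (k = N + 1)) (fun k h₁ h₂ => ?_) fun u hu => ?_
  · simp only [id]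
    refine ⟨by omega, by omega, ?_⟩
    by_cases hk : k = N + 1
    · rw [hk, decide_eq_true rfl]
      exact Finset.mem_union_right _ (Finset.mem_singleton_self _)
    · rw [decide_eq_false hk]
      exact Finset.mem_union_left _ ((site_mem_downSet (by omega) (by omega)).2
        ⟨rfl, by omega, by omega⟩)
  · rcases Finset.mem_union.1 hu with h | h
    · obtain ⟨h₁, h₂, h₃⟩ := mem_downSet.1 h
      exact ⟨_, h₂, by omega, rfl, by rw [h₁, decide_eq_false (by omega)]⟩
    · rw [Finset.mem_singleton, eq_site_iff (by omega) le_rfl] at h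
      exact ⟨N + 1, hjN, le_rfl, h.1, by rw [h.2, decide_eq_true rfl]⟩

theorem topF_chainC_down (hi : 1 ≤ i) (hiN : i ≤ N) :
    topF (chainC N) N i 0 (downSet N i N) = topF (chainC N) N i 0 (upSet N i N) := by
  rw [topF, ← image_up hi (by omega), ← image_down hi (by omega),
    strF_chainC hi hiN (by omega) (fun _ => true), strF_chainC hi hiN (by omega) (fun _ => false)]

theorem topF_chainC_down_top (hi : 1 ≤ i) (hiN : i ≤ N + 1) (s : ℕ) :
    topF (chainC N) (N + 1) i s (downSet N i N ∪ {site N (N + 1) true}) =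
      topF (chainC N) (N + 1) i s (upSet N i (N + 1)) := by
  rw [topF, ← image_up hi le_rfl, ← image_down_top hi hiN,
    strF_chainC hi hiN le_rfl (fun _ => true), strF_chainC hi hiN le_rfl]

theorem twistC_ne_zero' {u v : Site N} (hu : u ∈ upSet N i N) (hv : v ∈ downSet N j N) :
    twistC N u v ≠ 0 := by
  obtain ⟨h₁, h₂, h₃⟩ := mem_upSet.1 hu
  obtain ⟨h₄, h₅, h₆⟩ := mem_downSet.1 hv
  rw [← site_siteCol u, ← site_siteCol v, h₁, h₄]
  exact twistC_ne_zero (siteCol_pos u) h₃ (siteCol_pos v) h₆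

theorem bi_upSet_top (hi : 1 ≤ i) (hiN : i ≤ N) :
    Tw.bi (twistC N) (upSet N i N) {site N (N + 1) true} = -8 := by
  simp only [Tw.bi, Finset.prod_singleton]
  refine (Finset.prod_eq_single (site N N true) (fun u hu hne => ?_) fun h => ?_).trans
    (twistC_top (by omega) true)
  · obtain ⟨h₁, h₂, h₃⟩ := mem_upSet.1 hu
    have hc : siteCol u ≠ N := fun h => hne ((eq_site_iff (by omega) (by omega)).2 ⟨h, h₁⟩)
    refine ((cartanData_C (N + 1)).chainTwist_symm _ ?_).1
    rw [siteCol_site (by omega) le_rfl]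
    exact aC_far (by omega)
  · exact absurd ((site_mem_upSet (by omega) (by omega)).2 ⟨rfl, hiN, le_rfl⟩) h

theorem bi_top_downSet (hi : 1 ≤ i) (hiN : i ≤ N) :
    Tw.bi (twistC N) {site N (N + 1) true} (downSet N i N) = 8 := by
  simp only [Tw.bi, Finset.prod_singleton]
  refine (Finset.prod_eq_single (site N N false) (fun u hu hne => ?_) fun h => ?_).trans
    (twistC_top' (by omega) false)
  · obtain ⟨h₁, h₂, h₃⟩ := mem_downSet.1 hu
    have hc : siteCol u ≠ N := fun h => hne ((eq_site_iff (by omega) (by omega)).2 ⟨h, h₁⟩)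
    refine ((cartanData_C (N + 1)).chainTwist_symm _ ?_).2
    rw [siteCol_site (by omega) le_rfl]
    exact aC_far (by omega)
  · exact absurd ((site_mem_downSet (by omega) (by omega)).2 ⟨rfl, hiN, le_rfl⟩) h

theorem bi_up_down_ne_zero : Tw.bi (twistC N) (upSet N i N) (downSet N j N) ≠ 0 :=
  Finset.prod_ne_zero_iff.2 fun _ hu => Finset.prod_ne_zero_iff.2 fun _ hv => twistC_ne_zero' hu hv

theorem notMem_downSet : Disjoint (downSet N j N) {site N (N + 1) true} := by
  rw [Finset.disjoint_singleton_right, site_mem_downSet (by omega) le_rfl]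
  simp

theorem tC_chainC_ne_zero (hi : 1 ≤ i) (hij : i ≤ j) (hj : j ≤ N) (s : ℕ) :
    tC (chainC N) N i j s (upSet N i (N + 1) ∪ downSet N j N) ≠ 0 := by
  have hF := homog_topF (A := aC (N + 1)) (d := dC (N + 1)) (P := paramC N) (N := N)
    (hij.trans hj) 0
  have hA : topF (chainC N) N i 0 (upSet N i N) ≠ 0 :=
    strF_chainC_ne_zero hi (by omega) (by omega) 0
  have hH : topF (chainC N) (N + 1) j s (upSet N j (N + 1)) ≠ 0 :=
    strF_chainC_ne_zero (by omega) (by omega) le_rfl s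
  have hAS : upSet N i N ∈ (upSet N i (N + 1) ∪ downSet N j N).powerset := by
    refine Finset.mem_powerset.2 fun u hu => Finset.mem_union_left _ ?_
    obtain ⟨h₁, h₂, h₃⟩ := mem_upSet.1 hu
    exact mem_upSet.2 ⟨h₁, h₂, by omega⟩
  have hterm : (Tw.bi (twistC N) (upSet N i N)
        ((upSet N i (N + 1) ∪ downSet N j N) \ upSet N i N) -
      Tw.bi (twistC N) ((upSet N i (N + 1) ∪ downSet N j N) \ upSet N i N) (upSet N i N)) *
      (topF (chainC N) N i 0 (upSet N i N) * topF (chainC N) (N + 1) j s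
        ((upSet N i (N + 1) ∪ downSet N j N) \ upSet N i N)) =
      Tw.bi (twistC N) (upSet N i N) (downSet N j N) * -8 *
        (topF (chainC N) N i 0 (upSet N i N) * topF (chainC N) (N + 1) j s (upSet N j (N + 1))) := by
    rw [bi_twistC_right hi hF hA (hij.trans hj) le_rfl ((site_mem_upSet (by omega) (by omega)).2
      ⟨rfl, hij.trans hj, le_rfl⟩), sdiff_upSet (by omega), topF_chainC_down_top (by omega) (by omega),
      Tw.bi_union_right _ notMem_downSet, bi_upSet_top hi (hij.trans hj), sub_zero]
  rw [tC, LieRing.of_associative_ring_bracket, Tw.comm_apply]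
  have hzero : ∀ T ∈ (upSet N i (N + 1) ∪ downSet N j N).powerset,
      topF (chainC N) N i 0 T ≠ 0 → T ≠ upSet N i N →
      (∃ k, i ≤ k ∧ k ≤ N ∧ site N k true ∈ T) →
      (Tw.bi (twistC N) T ((upSet N i (N + 1) ∪ downSet N j N) \ T) -
        Tw.bi (twistC N) ((upSet N i (N + 1) ∪ downSet N j N) \ T) T) *
        (topF (chainC N) N i 0 T * topF (chainC N) (N + 1) j s
          ((upSet N i (N + 1) ∪ downSet N j N) \ T)) = 0 := by
    rintro T hT hT₀ hne ⟨k, h₁, h₂, h₃⟩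
    rw [bi_twistC_left hi (hij.trans hj) hF (Finset.mem_powerset.1 hT) hT₀ hne,
      bi_twistC_right hi hF hT₀ h₁ h₂ h₃, sub_zero, zero_mul]
  have hdown : ∀ T ∈ (upSet N i (N + 1) ∪ downSet N j N).powerset,
      topF (chainC N) N i 0 T ≠ 0 → (∀ k, i ≤ k → k ≤ N → site N k true ∉ T) →
      T = downSet N i N ∧ j = i := by
    intro T hT hT₀ h
    have hin : ∀ k, i ≤ k → k ≤ N → site N k false ∈ T := fun k h₁ h₂ => by
      by_contra h'
      exact h k h₁ h₂ ((hF.site_mem_iff hT₀ (by omega) (by omega) (if_pos ⟨h₁, h₂⟩)).2 h')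
    refine ⟨Finset.ext fun u => ?_, ?_⟩
    · rw [mem_downSet]
      constructor
      · intro hu
        have hc' : i ≤ siteCol u ∧ siteCol u ≤ N := by
          by_contra h
          exact hF.col_of_mem hT₀ hu (if_neg h)
        refine ⟨?_, hc'⟩
        by_contra hb
        rw [Bool.not_eq_false] at hb
        refine h _ hc'.1 hc'.2 ?_
        rw [← hb, site_siteCol]
        exact hu
      · rintro ⟨h₁, h₂, h₃⟩
        rw [← site_siteCol u, h₁]
        exact hin _ h₂ h₃
    · rcases Finset.mem_union.1 (Finset.mem_powerset.1 hT (hin i le_rfl (by omega))) with h' | h'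
      · rw [site_mem_upSet hi (by omega)] at h'
        exact absurd h'.1 (by simp)
      · rw [site_mem_downSet hi (by omega)] at h'
        omega
  have hne8 : Tw.bi (twistC N) (upSet N i N) (downSet N j N) *
      (topF (chainC N) N i 0 (upSet N i N) * topF (chainC N) (N + 1) j s (upSet N j (N + 1))) ≠ 0 :=
    mul_ne_zero bi_up_down_ne_zero (mul_ne_zero hA hH)
  by_cases hji : j = i
  · subst hji
    have hB : topF (chainC N) N j 0 (downSet N j N) ≠ 0 := by
      rw [topF_chainC_down hi hj]; exact hA
    have hsite : site N N true ∉ downSet N j N := by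
      rw [site_mem_downSet (by omega) (by omega)]; simp
    have hAB : upSet N j N ≠ downSet N j N := by
      intro h
      rw [← h] at hsite
      exact hsite ((site_mem_upSet (by omega) (by omega)).2 ⟨rfl, hj, le_rfl⟩)
    have hBS : downSet N j N ∈ (upSet N j (N + 1) ∪ downSet N j N).powerset :=
      Finset.mem_powerset.2 Finset.subset_union_right
    rw [Finset.sum_eq_add (upSet N j N) (downSet N j N) hAB, hterm,
      bi_twistC_left hi hj hF Finset.subset_union_right hB hAB.symm, sdiff_downSet,
      topF_chainC_down hi hj]
    · have : upSet N j (N + 1) = upSet N j N ∪ {site N (N + 1) true} := by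
        ext u
        have := siteCol_le u
        rw [Finset.mem_union, Finset.mem_singleton, mem_upSet, mem_upSet,
          eq_site_iff (by omega) le_rfl]
        cases u.2
        · simp
        · simp only [true_and, and_true]
          omega
      have hbi : Tw.bi (twistC N) (upSet N j (N + 1)) (downSet N j N) =
          Tw.bi (twistC N) (upSet N j N) (downSet N j N) * 8 := by
        rw [this, Tw.bi_union_left, bi_top_downSet hi hj]
        rw [Finset.disjoint_singleton_right, site_mem_upSet (by omega) le_rfl]
        omega
      rw [hbi]
      intro h
      refine hne8 ?_
      linarith
    · rintro T hT ⟨h₁, h₂⟩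
      by_contra h
      have hT₀ := left_ne_zero_of_mul (right_ne_zero_of_mul h)
      by_cases hk : ∃ k, j ≤ k ∧ k ≤ N ∧ site N k true ∈ T
      · exact h (hzero T hT hT₀ h₁ hk)
      · push Not at hk
        exact h₂ (hdown T hT hT₀ hk).1
    · exact fun h => absurd hAS h
    · exact fun h => absurd hBS h
  · rw [Finset.sum_eq_single_of_mem _ hAS, hterm]
    · intro h
      refine hne8 ?_
      linarith
    · intro T hT hne
      by_contra h
      have hT₀ := left_ne_zero_of_mul (right_ne_zero_of_mul h)
      by_cases hk : ∃ k, i ≤ k ∧ k ≤ N ∧ site N k true ∈ T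
      · exact h (hzero T hT hT₀ hne hk)
      · push Not at hk
        exact hji (hdown T hT hT₀ hk).2

end PairC

section RootsValuesC
attribute [local instance] LieRing.ofAssociativeRing
variable {N : ℕ}

/-- A set of sites in the support of the root vector of type `C`. -/
def rootSetC (N : ℕ) (β : PosRootC (N + 1)) : Finset (Site N) :=
  if ri β + rt β < N + 1 ∨ ri β = N + 1 then upSet N (ri β) (ri β + rt β)
  else if ri β + rt β = N + 1 then upSet N (ri β) (N + 1) ∪ downSet N (ri β) N
  else if ri β + rt β = N + 2 then upSet N (ri β) (N + 1)
  else upSet N (ri β) (N + 1) ∪ downSet N (2 * (N + 1) + 1 - ri β - rt β) N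

theorem posRootC_bounds (β : PosRootC (N + 1)) :
    1 ≤ ri β ∧ (ri β = N + 1 → rt β = 0) ∧ rt β + 2 * ri β ≤ 2 * (N + 1) := β.2

theorem homog_canonC (β : PosRootC (N + 1)) (s : ℕ) :
    Tw.Homog siteCol (canonC (chainC N) (N + 1) (ri β) (rt β) s) (nuC β) := by
  obtain ⟨h₁, h₂, h₃⟩ := posRootC_bounds β
  unfold canonC
  split_ifs with h h' h''
  · have := homog_strF (A := aC (N + 1)) (d := dC (N + 1)) (P := paramC N) (N := N) (ri β) (rt β) s
    convert this using 1
    funext c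
    simp only [nuC]
    rw [if_pos h]
  · have := homog_tC (N := N) (i := ri β) (j := ri β) (by omega) (by omega) s
    have e : nuC β = fun c => (if ri β ≤ c ∧ c ≤ N then 1 else 0) +
        if ri β ≤ c ∧ c ≤ N + 1 then 1 else 0 := by
      funext c
      simp only [nuC]
      rw [if_neg h, if_pos h']
      split_ifs <;> omega
    rw [e]
    exact this
  · have := homog_topF (A := aC (N + 1)) (d := dC (N + 1)) (P := paramC N) (N := N)
      (M := N + 1) (i := ri β) (by omega) s
    convert this using 1
    funext c
    simp only [nuC]
    rw [if_neg h, if_neg h', if_pos h'']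
  · have := homog_tC (N := N) (i := ri β) (j := 2 * (N + 1) + 1 - ri β - rt β) (by omega)
      (by omega) s
    have e : nuC β = fun c => (if ri β ≤ c ∧ c ≤ N then 1 else 0) +
        if 2 * (N + 1) + 1 - ri β - rt β ≤ c ∧ c ≤ N + 1 then 1 else 0 := by
      funext c
      simp only [nuC]
      rw [if_neg h, if_neg h', if_neg h'']
      split_ifs <;> omega
    rw [e]
    exact this

theorem canonC_rootSetC_ne_zero (β : PosRootC (N + 1)) (s : ℕ) :
    canonC (chainC N) (N + 1) (ri β) (rt β) s (rootSetC N β) ≠ 0 := by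
  obtain ⟨h₁, h₂, h₃⟩ := posRootC_bounds β
  unfold canonC rootSetC
  split_ifs with h h' h''
  · have := strF_chainC_ne_zero (N := N) h₁ (Nat.le_add_right (ri β) (rt β)) (by omega) s
    rwa [Nat.add_sub_cancel_left] at this
  · exact tC_chainC_ne_zero h₁ le_rfl (by omega) s
  · exact strF_chainC_ne_zero h₁ (by omega) le_rfl s
  · exact tC_chainC_ne_zero h₁ (by omega) (by omega) s

variable {β γ : PosRootC (N + 1)}

theorem nuC_eq_zero {c : ℕ} (hc : c < ri β) : nuC β c = 0 := by
  have h₁ : ri β ≤ N + 1 := Nat.lt_succ_iff.1 (ofLex β.1).1.2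
  have h₂ : rt β + 2 * ri β ≤ 2 * (N + 1) := β.2.2.2
  simp only [nuC]
  split_ifs <;> omega

theorem nuC_ri_ne_zero (β : PosRootC (N + 1)) : nuC β (ri β) ≠ 0 := by
  obtain ⟨h₁, h₂, h₃⟩ := posRootC_bounds β
  simp only [nuC]
  split_ifs <;> omega

theorem exists_nuC_ne (hi : ri β = ri γ) (ht : rt β < rt γ) : ∃ c, nuC β c ≠ nuC γ c := by
  obtain ⟨-, -, h₂⟩ := posRootC_bounds β
  obtain ⟨k₁, k₂, k₃⟩ := posRootC_bounds γ
  by_cases c₁ : ri γ + rt γ < N + 1 ∨ ri γ = N + 1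
  · refine ⟨ri γ + rt β + 1, ?_⟩
    simp only [nuC, hi]
    rw [if_pos c₁, if_pos (by omega), if_neg (by omega), if_pos (by omega)]
    exact zero_ne_one
  by_cases d₁ : ri γ + rt β < N + 1 ∨ ri γ = N + 1
  · refine ⟨N + 1, ?_⟩
    simp only [nuC, hi]
    rw [if_neg c₁, if_pos d₁, if_neg (by omega)]
    split_ifs <;> omega
  by_cases d₂ : ri γ + rt β = N + 1
  · refine ⟨ri γ, ?_⟩
    simp only [nuC, hi]
    rw [if_neg c₁, if_neg d₁, if_pos d₂, if_pos (by omega), if_neg (by omega)]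
    split_ifs <;> omega
  refine ⟨2 * (N + 1) + 1 - ri γ - rt γ, ?_⟩
  simp only [nuC, hi]
  rw [if_neg c₁, if_neg d₁, if_neg d₂]
  split_ifs <;> omega

theorem nuC_injective (h : ∀ c, nuC β c = nuC γ c) : β = γ := by
  have hi : ri β = ri γ := by
    rcases lt_trichotomy (ri β) (ri γ) with hlt | hlt | hlt
    · exact absurd ((h _).trans (nuC_eq_zero hlt)) (nuC_ri_ne_zero β)
    · exact hlt
    · exact absurd ((h _).symm.trans (nuC_eq_zero hlt)) (nuC_ri_ne_zero γ)
  have ht : rt β = rt γ := by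
    rcases lt_trichotomy (rt β) (rt γ) with hlt | hlt | hlt
    · obtain ⟨c, hc⟩ := exists_nuC_ne hi hlt
      exact absurd (h c) hc
    · exact hlt
    · obtain ⟨c, hc⟩ := exists_nuC_ne hi.symm hlt
      exact absurd (h c).symm hc
  exact Subtype.ext (Prod.ext (Fin.ext hi) (Fin.ext ht))

end RootsValuesC

/-! ### Type `D` -/

section ValuesD
attribute [local instance] LieRing.ofAssociativeRing
variable {N : ℕ}

theorem cartanData_D (n : ℕ) : CartanData n (aD n) (dD n) where
  diag i := by simp [aD]
  entry i j hij := by unfold aD; split_ifs <;> simp_all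
  symm i j _ _ := by
    unfold aD dD
    split_ifs <;> omega
  pos i := by unfold dD; norm_num

theorem aD_far {k l : ℕ} (h : k + 1 < l) (hl : l ≤ N) : aD (N + 1) k l = 0 := by
  unfold aD
  rw [if_neg (by omega), if_neg (by omega), if_neg (by omega)]

theorem aD_near {k : ℕ} (h : k < N) : aD (N + 1) k (k + 1) ≠ 0 := by
  unfold aD
  split_ifs <;> omega

/-- The spectral parameters of the chain of type `D`. -/
def paramD (N k : ℕ) (b : Bool) : ℤ := if k = N + 1 then 0 else if b then 2 * k - 2 * N else 1

/-- The twist of the chain of type `D`. -/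
abbrev twistD (N : ℕ) : Site N → Site N → ℤ := chainTwist (aD (N + 1)) (dD (N + 1)) (paramD N)

/-- The generators of the chain of type `D`. -/
abbrev chainD (N : ℕ) : ℕ → ℕ → Tw (twistD N) := chainGen (aD (N + 1)) (dD (N + 1)) (paramD N) N

theorem strF_chainD_ne_zero {i m : ℕ} (hi : 1 ≤ i) (him : i ≤ m) (hm : m ≤ N + 1)
    (hmN : m ≤ N ∨ i = m) (s : ℕ) : strF (chainD N) i (m - i) s (upSet N i m) ≠ 0 := by
  have := (cartanData_D (N + 1)).strF_chain (N := N) (P := paramD N) (e := chainD N) (c := id)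
    (i := i) (l := m - i) (fun _ _ => rfl) (fun k _ _ => ⟨by simp only [id]; omega,
      by simp only [id]; omega⟩) (fun k k' _ h _ => h)
    (fun k k' _ h _ => aD_far h (by simp only [id]; omega))
    (fun k _ _ => aD_near (by simp only [id]; omega)) (fun _ => true) s
  rw [Nat.add_sub_cancel' him] at this
  simp only [id, image_up hi hm] at this
  rw [this]
  exact (cartanData_D (N + 1)).prod_ne_zero (c := id)
    fun _ _ _ => aD_near (by simp only [id]; omega)

theorem gD_chainD_ne_zero (hN : 2 ≤ N) {i : ℕ} (hi : 1 ≤ i) (hiN : i ≤ N) (b : ℕ → Bool) (s : ℕ) :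
    gD (chainD N) N i s ((Finset.Icc i N).image fun k =>
      site N (if k = N then N + 1 else k) (b k)) ≠ 0 := by
  have hne : ∀ k, i ≤ k → k < N →
      aD (N + 1) (if k = N then N + 1 else k) (if k + 1 = N then N + 1 else k + 1) ≠ 0 := by
    intro k h₁ h₂
    unfold aD
    split_ifs <;> omega
  have := (cartanData_D (N + 1)).strF_chain (N := N) (P := paramD N)
    (e := altE (chainD N) N) (c := fun k => if k = N then N + 1 else k)
    (i := i) (l := N - i) (fun k r => by rw [altE]; split_ifs <;> rfl)
    (fun k _ _ => by split_ifs <;> omega) (fun k k' _ h _ => by split_ifs <;> omega)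
    (fun k k' _ h _ => by unfold aD; split_ifs <;> omega)
    (fun k h₁ h₂ => hne k h₁ (by omega)) b s
  rw [Nat.add_sub_cancel' hiN] at this
  rw [gD, topF, this]
  exact (cartanData_D (N + 1)).prod_ne_zero
    (c := fun k => if k = N then N + 1 else k) hne

theorem homog_gD {i : ℕ} (hi : 1 ≤ i) (hiN : i ≤ N) (s : ℕ) : Tw.Homog siteCol (gD (chainD N) N i s)
    fun c => (if i ≤ c ∧ c ≤ N - 1 then 1 else 0) + if c = N + 1 then 1 else 0 := by
  rcases Nat.lt_or_ge i N with h | h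
  · obtain ⟨l, rfl⟩ : ∃ l, N = i + l + 1 := ⟨N - i - 1, by omega⟩
    rw [gD, topF, show i + l + 1 - i = l + 1 by omega, strF, strF_altE _ _ le_rfl, altE, if_pos rfl]
    exact (homog_strF i l s).lie (Tw.homog_gen _ _ _) fun c => rfl
  · obtain rfl : i = N := le_antisymm hiN h
    rw [gD_self]
    have e : (fun c => (if i ≤ c ∧ c ≤ i - 1 then 1 else 0) + if c = i + 1 then 1 else 0) =
        fun c => if c = i + 1 then 1 else 0 := by
      funext c
      rw [if_neg (by omega), zero_add]
    rw [e]
    exact Tw.homog_gen _ _ _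

theorem image_down_topD {i : ℕ} (hi : 1 ≤ i) (hiN : i ≤ N) :
    (Finset.Icc i N).image (fun k => site N (if k = N then N + 1 else k) (decide (k = N))) =
      downSet N i (N - 1) ∪ {site N (N + 1) true} := by
  refine image_site_eq (c := fun k => if k = N then N + 1 else k) (b := fun k => decide (k = N))
    (fun k h₁ h₂ => ?_) fun u hu => ?_
  · refine ⟨by split_ifs <;> omega, by split_ifs <;> omega, ?_⟩
    by_cases hk : k = N
    · rw [if_pos hk, decide_eq_true hk]
      exact Finset.mem_union_right _ (Finset.mem_singleton_self _)
    · rw [if_neg hk, decide_eq_false hk]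
      exact Finset.mem_union_left _ ((site_mem_downSet (by omega) (by omega)).2
        ⟨rfl, by omega, by omega⟩)
  · rcases Finset.mem_union.1 hu with h | h
    · obtain ⟨h₁, h₂, h₃⟩ := mem_downSet.1 h
      exact ⟨_, h₂, by omega, by rw [if_neg (by omega)], by rw [h₁, decide_eq_false (by omega)]⟩
    · rw [Finset.mem_singleton, eq_site_iff (by omega) le_rfl] at h
      exact ⟨N, hiN, le_rfl, by rw [if_pos rfl, h.1], by rw [h.2, decide_eq_true rfl]⟩

theorem twistD_step {k : ℕ} (h₁ : 1 ≤ k) (h₂ : k < N) :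
    twistD N (site N (k + 1) true) (site N k true) = 0 := by
  rw [twistD, chainTwist_site _ _ _ (by omega) (by omega) (by omega) (by omega)]
  simp only [siteTwist, siteSgn, aD, dD, paramD]
  split_ifs <;> first | omega | simp_all

theorem twistD_top (hN : 2 ≤ N) :
    twistD N (site N (N + 1) true) (site N (N - 1) true) = 0 := by
  obtain ⟨M, rfl⟩ : ∃ M, N = M + 1 := ⟨N - 1, by omega⟩
  rw [twistD, chainTwist_site _ _ _ (by omega) (by omega) (by omega) (by omega)]
  simp only [siteTwist, siteSgn, aD, dD, paramD]
  split_ifs <;> first | omega | (push_cast; omega) | simp_all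

theorem twistD_ne_zero {k l : ℕ} (h₁ : 1 ≤ k) (h₂ : k ≤ N) (h₃ : 1 ≤ l) (h₄ : l ≤ N) :
    twistD N (site N k true) (site N l false) ≠ 0 := by
  rw [twistD, chainTwist_site _ _ _ (by omega) (by omega) (by omega) (by omega)]
  simp only [siteTwist, siteSgn, aD, dD, paramD]
  split_ifs <;> omega

theorem twistD_ne_zero_top {k : ℕ} (h₁ : 1 ≤ k) (h₂ : k ≤ N) :
    twistD N (site N k true) (site N (N + 1) true) ≠ 0 := by
  rw [twistD, chainTwist_site _ _ _ (by omega) (by omega) (by omega) (by omega)]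
  simp only [siteTwist, siteSgn, aD, dD, paramD]
  split_ifs <;> omega

variable {i j : ℕ}

theorem homog_tD (hi : i ≤ N) (hj : 1 ≤ j) (hjN : j ≤ N) (s : ℕ) :
    Tw.Homog siteCol (tD (chainD N) N i j s) fun c => (if i ≤ c ∧ c ≤ N then 1 else 0) +
      ((if j ≤ c ∧ c ≤ N - 1 then 1 else 0) + if c = N + 1 then 1 else 0) :=
  (homog_topF hi 0).lie (homog_gD hj hjN s) fun _ => rfl

theorem sdiff_upSetD (hi : i ≤ N + 1) : (upSet N i (N + 1) ∪ downSet N j (N - 1)) \ upSet N i N =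
    downSet N j (N - 1) ∪ {site N (N + 1) true} := by
  ext u
  rw [Finset.mem_sdiff, Finset.mem_union, Finset.mem_union, Finset.mem_singleton, mem_upSet,
    mem_upSet, mem_downSet, eq_site_iff (by omega) le_rfl]
  have := siteCol_le u
  cases u.2
  · simp
  · simp only [true_and, Bool.true_eq_false, false_and, or_false, false_or, and_true]
    omega

theorem tD_chainD_ne_zero (hN : 2 ≤ N) (hi : 1 ≤ i) (hij : i < j) (hj : j ≤ N) (s : ℕ) :
    tD (chainD N) N i j s (upSet N i (N + 1) ∪ downSet N j (N - 1)) ≠ 0 := by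
  have hF := homog_topF (A := aD (N + 1)) (d := dD (N + 1)) (P := paramD N) (N := N)
    (hij.le.trans hj) 0
  have hA : topF (chainD N) N i 0 (upSet N i N) ≠ 0 :=
    strF_chainD_ne_zero hi (by omega) (by omega) (Or.inl le_rfl) 0
  have hH := gD_chainD_ne_zero hN (by omega : 1 ≤ j) hj (fun k => decide (k = N)) s
  rw [image_down_topD (by omega) hj] at hH
  have hmem : ∀ k, i ≤ k → k ≤ N + 1 →
      site N k true ∈ upSet N i (N + 1) ∪ downSet N j (N - 1) := fun k h₁ h₂ =>
    Finset.mem_union_left _ ((site_mem_upSet (by omega) h₂).2 ⟨rfl, h₁, h₂⟩)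
  have hAS : upSet N i N ∈ (upSet N i (N + 1) ∪ downSet N j (N - 1)).powerset := by
    refine Finset.mem_powerset.2 fun u hu => Finset.mem_union_left _ ?_
    obtain ⟨h₁, h₂, h₃⟩ := mem_upSet.1 hu
    exact mem_upSet.2 ⟨h₁, h₂, by omega⟩
  rw [tD, LieRing.of_associative_ring_bracket, Tw.comm_apply]
  have hiff : ∀ T, topF (chainD N) N i 0 T ≠ 0 → ∀ k, i ≤ k → k ≤ N →
      (site N k true ∈ T ↔ site N k false ∉ T) := fun T hT k h₁ h₂ =>
    hF.site_mem_iff hT (by omega) (by omega) (if_pos ⟨h₁, h₂⟩)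
  have htop : ∀ T, topF (chainD N) N i 0 T ≠ 0 → site N (N + 1) true ∉ T := by
    intro T hT h
    have := hF.col_of_mem hT h
    rw [siteCol_site (by omega) le_rfl] at this
    exact this (if_neg (by omega))
  have hright : ∀ T ∈ (upSet N i (N + 1) ∪ downSet N j (N - 1)).powerset,
      topF (chainD N) N i 0 T ≠ 0 →
      Tw.bi (twistD N) ((upSet N i (N + 1) ∪ downSet N j (N - 1)) \ T) T = 0 := by
    intro T hT hT₀
    by_contra hbi
    have step : ∀ m, i + m ≤ N → site N (i + m) true ∈ T := by
      intro m
      induction m with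
      | zero =>
        intro _
        refine (hiff T hT₀ i le_rfl (by omega)).2 fun h => ?_
        rcases Finset.mem_union.1 (Finset.mem_powerset.1 hT h) with h' | h'
        · rw [site_mem_upSet (by omega) (by omega)] at h'
          exact absurd h'.1 (by simp)
        · rw [site_mem_downSet (by omega) (by omega)] at h'
          omega
      | succ m ih =>
        intro h
        by_contra hk
        exact hbi (Tw.bi_eq_zero (Finset.mem_sdiff.2 ⟨hmem _ (by omega) (by omega), hk⟩)
          (ih (by omega)) (twistD_step (k := i + m) (by omega) (by omega)))
    have := step (N - 1 - i) (by omega)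
    rw [Nat.add_sub_cancel' (by omega)] at this
    exact hbi (Tw.bi_eq_zero (Finset.mem_sdiff.2 ⟨hmem (N + 1) (by omega) le_rfl,
      htop T hT₀⟩) this (twistD_top hN))
  have hleft : ∀ T ∈ (upSet N i (N + 1) ∪ downSet N j (N - 1)).powerset,
      topF (chainD N) N i 0 T ≠ 0 → T ≠ upSet N i N →
      Tw.bi (twistD N) T ((upSet N i (N + 1) ∪ downSet N j (N - 1)) \ T) = 0 := by
    intro T hT hT₀ hne
    by_contra hbi
    have all : ∀ m k, i ≤ k → k + m = N → site N k true ∈ T := by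
      intro m
      induction m with
      | zero =>
        rintro k h₁ rfl
        refine (hiff T hT₀ _ h₁ le_rfl).2 fun h => ?_
        rcases Finset.mem_union.1 (Finset.mem_powerset.1 hT h) with h' | h'
        · rw [site_mem_upSet (by omega) (by omega)] at h'
          exact absurd h'.1 (by simp)
        · rw [site_mem_downSet (by omega) (by omega)] at h'
          omega
      | succ m ih =>
        intro k h₁ h₂
        by_contra hk
        exact hbi (Tw.bi_eq_zero (ih (k + 1) (by omega) (by omega))
          (Finset.mem_sdiff.2 ⟨hmem k h₁ (by omega), hk⟩) (twistD_step (by omega) (by omega)))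
    refine hne (Finset.ext fun u => ?_)
    rw [mem_upSet]
    constructor
    · intro hu
      have hc' : i ≤ siteCol u ∧ siteCol u ≤ N := by
        by_contra h
        exact hF.col_of_mem hT₀ hu (if_neg h)
      refine ⟨?_, hc'⟩
      by_contra hb
      refine (hiff T hT₀ _ hc'.1 hc'.2).1 (all (N - siteCol u) _ hc'.1 (by omega)) ?_
      rw [Bool.not_eq_true] at hb
      rw [← hb, site_siteCol]
      exact hu
    · rintro ⟨h₁, h₂, h₃⟩
      rw [← site_siteCol u, h₁]
      exact all (N - siteCol u) _ h₂ (by omega)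
  rw [Finset.sum_eq_single_of_mem _ hAS]
  · rw [hright _ hAS hA, sdiff_upSetD (by omega), sub_zero]
    refine mul_ne_zero (Finset.prod_ne_zero_iff.2 fun u hu => Finset.prod_ne_zero_iff.2
      fun v hv => ?_) (mul_ne_zero hA hH)
    obtain ⟨h₁, h₂, h₃⟩ := mem_upSet.1 hu
    rw [← site_siteCol u, h₁]
    rcases Finset.mem_union.1 hv with h | h
    · obtain ⟨h₄, h₅, h₆⟩ := mem_downSet.1 h
      rw [← site_siteCol v, h₄]
      exact twistD_ne_zero (siteCol_pos u) h₃ (siteCol_pos v) (by omega)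
    · rw [Finset.mem_singleton.1 h]
      exact twistD_ne_zero_top (siteCol_pos u) h₃
  · intro T hT hne
    by_contra h
    have hT₀ := left_ne_zero_of_mul (right_ne_zero_of_mul h)
    rw [hleft T hT hT₀ hne, hright T hT hT₀, sub_zero, zero_mul] at h
    exact h rfl

end ValuesD

section RootsValuesD
attribute [local instance] LieRing.ofAssociativeRing
variable {N : ℕ}

/-- A set of sites in the support of the root vector of type `D`. -/
def rootSetD (N : ℕ) (β : PosRootD (N + 1)) : Finset (Site N) :=
  if riD β + rtD β < N + 1 ∨ riD β = N + 1 then upSet N (riD β) (riD β + rtD β)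
  else if riD β + rtD β = N + 1 then downSet N (riD β) (N - 1) ∪ {site N (N + 1) true}
  else if riD β + rtD β = N + 2 then upSet N (riD β) (N + 1) ∪ downSet N N (N - 1)
  else upSet N (riD β) (N + 1) ∪ downSet N (2 * (N + 1) - riD β - rtD β) (N - 1)

theorem posRootD_bounds (β : PosRootD (N + 1)) : 1 ≤ riD β ∧ riD β ≤ N + 1 ∧
    (N ≤ riD β → rtD β = 0) ∧ (rtD β = 0 ∨ rtD β + 2 * riD β + 1 ≤ 2 * (N + 1)) := by
  obtain ⟨h₁, h₂, h₃⟩ := β.2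
  exact ⟨h₁, Nat.lt_succ_iff.1 (ofLex β.1).1.2, fun h => h₂ h, h₃⟩

theorem homog_canonD (hN : 2 ≤ N) (β : PosRootD (N + 1)) (s : ℕ) :
    Tw.Homog siteCol (canonD (chainD N) (N + 1) (riD β) (rtD β) s) (nuD β) := by
  obtain ⟨h₁, h₀, h₂, h₃⟩ := posRootD_bounds β
  unfold canonD
  split_ifs with h h' h''
  · have := homog_strF (A := aD (N + 1)) (d := dD (N + 1)) (P := paramD N) (N := N) (riD β) (rtD β) s
    have e : nuD β = fun c => if riD β ≤ c ∧ c ≤ riD β + rtD β then 1 else 0 := by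
      funext c
      simp only [nuD]
      rw [if_pos h]
    rw [e]
    exact this
  · have := homog_gD (N := N) (i := riD β) h₁ (by omega) s
    have e : nuD β = fun c => (if riD β ≤ c ∧ c ≤ N - 1 then 1 else 0) +
        if c = N + 1 then 1 else 0 := by
      funext c
      simp only [nuD]
      rw [if_neg h, if_pos h']
      split_ifs <;> omega
    rw [e]
    exact this
  · have := homog_tD (N := N) (i := riD β) (j := N) (by omega) (by omega) le_rfl s
    have e : nuD β = fun c => (if riD β ≤ c ∧ c ≤ N then 1 else 0) +
        ((if N ≤ c ∧ c ≤ N - 1 then 1 else 0) + if c = N + 1 then 1 else 0) := by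
      funext c
      simp only [nuD]
      rw [if_neg h, if_neg h', if_pos h'']
      split_ifs <;> omega
    rw [e]
    exact this
  · have := homog_tD (N := N) (i := riD β) (j := 2 * (N + 1) - riD β - rtD β) (by omega)
      (by omega) (by omega) s
    have e : nuD β = fun c => (if riD β ≤ c ∧ c ≤ N then 1 else 0) +
        ((if 2 * (N + 1) - riD β - rtD β ≤ c ∧ c ≤ N - 1 then 1 else 0) +
          if c = N + 1 then 1 else 0) := by
      funext c
      simp only [nuD]
      rw [if_neg h, if_neg h', if_neg h'']
      split_ifs <;> omega
    rw [e]
    exact this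

theorem canonD_rootSetD_ne_zero (hN : 2 ≤ N) (β : PosRootD (N + 1)) (s : ℕ) :
    canonD (chainD N) (N + 1) (riD β) (rtD β) s (rootSetD N β) ≠ 0 := by
  obtain ⟨h₁, h₀, h₂, h₃⟩ := posRootD_bounds β
  unfold canonD rootSetD
  split_ifs with h h' h''
  · have := strF_chainD_ne_zero (N := N) h₁ (Nat.le_add_right (riD β) (rtD β)) (by omega)
      (by omega) s
    rwa [Nat.add_sub_cancel_left] at this
  · rw [← image_down_topD h₁ (by omega)]
    exact gD_chainD_ne_zero hN h₁ (by omega) _ s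
  · exact tD_chainD_ne_zero hN h₁ (by omega) le_rfl s
  · exact tD_chainD_ne_zero hN h₁ (by omega) (by omega) s

variable {β γ : PosRootD (N + 1)}

theorem nuD_eq_zero {c : ℕ} (hc : c < riD β) : nuD β c = 0 := by
  obtain ⟨h₁, h₀, h₂, h₃⟩ := posRootD_bounds β
  simp only [nuD]
  split_ifs <;> omega

theorem nuD_ri_ne_zero (β : PosRootD (N + 1)) : nuD β (riD β) ≠ 0 := by
  obtain ⟨h₁, h₀, h₂, h₃⟩ := posRootD_bounds β
  simp only [nuD]
  split_ifs <;> omega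

theorem exists_nuD_ne (hi : riD β = riD γ) (ht : rtD β < rtD γ) : ∃ c, nuD β c ≠ nuD γ c := by
  obtain ⟨-, -, h₂, h₃⟩ := posRootD_bounds β
  obtain ⟨k₁, k₀, k₂, k₃⟩ := posRootD_bounds γ
  by_cases c₁ : riD γ + rtD γ < N + 1 ∨ riD γ = N + 1
  · refine ⟨riD γ + rtD β + 1, ?_⟩
    simp only [nuD, hi]
    rw [if_pos c₁, if_pos (by omega), if_neg (by omega), if_pos (by omega)]
    exact zero_ne_one
  by_cases d₁ : riD γ + rtD β < N + 1 ∨ riD γ = N + 1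
  · refine ⟨N + 1, ?_⟩
    simp only [nuD, hi]
    rw [if_neg c₁, if_pos d₁, if_neg (by omega)]
    split_ifs <;> first | omega | simp_all
  by_cases d₂ : riD γ + rtD β = N + 1
  · refine ⟨N, ?_⟩
    simp only [nuD, hi]
    rw [if_neg c₁, if_neg d₁, if_pos d₂, if_neg (by omega), if_neg (by omega)]
    split_ifs <;> omega
  refine ⟨2 * (N + 1) - riD γ - rtD γ, ?_⟩
  simp only [nuD, hi]
  rw [if_neg c₁, if_neg d₁, if_neg d₂]
  split_ifs <;> omega

theorem nuD_injective (h : ∀ c, nuD β c = nuD γ c) : β = γ := by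
  have hi : riD β = riD γ := by
    rcases lt_trichotomy (riD β) (riD γ) with hlt | hlt | hlt
    · exact absurd ((h _).trans (nuD_eq_zero hlt)) (nuD_ri_ne_zero β)
    · exact hlt
    · exact absurd ((h _).symm.trans (nuD_eq_zero hlt)) (nuD_ri_ne_zero γ)
  have ht : rtD β = rtD γ := by
    rcases lt_trichotomy (rtD β) (rtD γ) with hlt | hlt | hlt
    · obtain ⟨c, hc⟩ := exists_nuD_ne hi hlt
      exact absurd (h c) hc
    · exact hlt
    · obtain ⟨c, hc⟩ := exists_nuD_ne hi.symm hlt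
      exact absurd (h c).symm hc
  exact Subtype.ext (Prod.ext (Fin.ext hi) (Fin.ext ht))

end RootsValuesD

/-! ### Leading coefficients of shuffled products -/

section BlockPoly
variable {ι J : Type} [DecidableEq ι] (w : J → ℕ) (k : J → ι → ℚ)

/-- The value of a product of root vectors on a block, as a polynomial in the spectral parameters of
the chains. -/
def blockPoly : List J → Finset ι → MvPolynomial ι ℚ
  | [], _ => 1
  | p :: l, Q => ∑ q ∈ Q, MvPolynomial.monomial (Finsupp.single q (w p)) (k p q) *
      blockPoly l (Q.erase q)

theorem support_subset_of_coeff_blockPoly_ne_zero : ∀ (l : List J) (Q : Finset ι) (e : ι →₀ ℕ),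
    (blockPoly w k l Q).coeff e ≠ 0 → e.support ⊆ Q
  | [], Q, e, h => by
    rw [blockPoly, MvPolynomial.coeff_one] at h
    have : (0 : ι →₀ ℕ) = e := by by_contra h'; exact h (if_neg h')
    simp [← this]
  | p :: l, Q, e, h => by
    rw [blockPoly, MvPolynomial.coeff_sum] at h
    obtain ⟨q, hq, hne⟩ := Finset.exists_ne_zero_of_sum_ne_zero h
    rw [MvPolynomial.coeff_monomial_mul'] at hne
    split_ifs at hne with hle
    · have := support_subset_of_coeff_blockPoly_ne_zero l _ _ (right_ne_zero_of_mul hne)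
      intro x hx
      by_cases hxq : x = q
      · rwa [hxq]
      · refine Finset.mem_of_mem_erase (this (x := x) ?_)
        rw [Finsupp.mem_support_iff] at hx ⊢
        rw [Finsupp.tsub_apply, Finsupp.single_apply, if_neg (Ne.symm hxq), Nat.sub_zero]
        exact hx
    · exact absurd rfl hne

/-- The leading coefficient counts the ways to match the factors with the chains. -/
theorem exists_coeff_blockPoly {L : ι → J} (hL : ∀ p q, k p q ≠ 0 → w p = w (L q) → p = L q) :
    ∀ (l : List J) (Q : Finset ι), Q.card = l.length → ∃ c : ℕ,
      (blockPoly w k l Q).coeff (∑ q ∈ Q, Finsupp.single q (w (L q))) =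
        (∏ q ∈ Q, k (L q) q) * c ∧ (c ≠ 0 ↔ (l : Multiset J) = Q.val.map L) := by
  classical
  intro l
  induction l with
  | nil =>
    intro Q hQ
    obtain rfl := Finset.card_eq_zero.1 hQ
    exact ⟨1, by simp [blockPoly], by simp⟩
  | cons p l ih =>
    intro Q hQ
    have hc : ∀ q ∈ Q, ∃ c : ℕ, (blockPoly w k l (Q.erase q)).coeff
        (∑ q ∈ Q.erase q, Finsupp.single q (w (L q))) = (∏ q ∈ Q.erase q, k (L q) q) * c ∧
        (c ≠ 0 ↔ (l : Multiset J) = (Q.erase q).val.map L) := by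
      intro q hq
      refine ih _ ?_
      rw [Finset.card_erase_of_mem hq, hQ, List.length_cons, Nat.add_sub_cancel]
    choose! c hc₁ hc₂ using hc
    have hval : ∀ q ∈ Q, Q.val.map L = L q ::ₘ (Q.erase q).val.map L := by
      intro q hq
      rw [← Multiset.map_cons, Finset.erase_val, Multiset.cons_erase hq]
    refine ⟨∑ q ∈ Q with L q = p, c q, ?_, ?_⟩
    · rw [blockPoly, MvPolynomial.coeff_sum, Nat.cast_sum, Finset.mul_sum, Finset.sum_filter]
      refine Finset.sum_congr rfl fun q hq => ?_
      rw [← Finset.add_sum_erase Q _ hq, ← Finset.mul_prod_erase Q _ hq]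
      split_ifs with h
      · rw [h, MvPolynomial.coeff_monomial_mul, hc₁ q hq, _root_.mul_assoc]
      · by_contra hne
        rw [MvPolynomial.coeff_monomial_mul'] at hne
        split_ifs at hne with hle
        · have hsub := support_subset_of_coeff_blockPoly_ne_zero w k _ _ _
            (right_ne_zero_of_mul hne)
          refine h (hL p q (left_ne_zero_of_mul hne) ?_).symm
          have h₀ : (∑ x ∈ Q.erase q, Finsupp.single x (w (L x))) q = 0 := by
            rw [Finsupp.finsetSum_apply]
            exact Finset.sum_eq_zero fun x hx =>
              Finsupp.single_eq_of_ne (Finset.ne_of_mem_erase hx).symm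
          have h₁ := hle q
          rw [Finsupp.add_apply, h₀, Finsupp.single_eq_same, Finsupp.single_eq_same] at h₁
          by_contra hne'
          refine absurd (hsub (x := q) ?_) (Finset.notMem_erase q Q)
          rw [Finsupp.mem_support_iff, Finsupp.tsub_apply, Finsupp.add_apply, h₀,
            Finsupp.single_eq_same, Finsupp.single_eq_same, Nat.add_zero]
          exact fun h' => hne' (le_antisymm h₁ (Nat.sub_eq_zero_iff_le.1 h'))
        · exact absurd rfl hne
    · rw [Ne, Finset.sum_eq_zero_iff]
      push Not
      constructor
      · rintro ⟨q, hq, hne⟩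
        rw [Finset.mem_filter] at hq
        rw [hval q hq.1, hq.2, ← (hc₂ q hq.1).1 hne]
        rfl
      · intro h
        obtain ⟨q, hq, hqp⟩ := Multiset.mem_map.1 (show p ∈ Q.val.map L by rw [← h]; simp)
        refine ⟨q, Finset.mem_filter.2 ⟨hq, hqp⟩, (hc₂ q hq).2 ?_⟩
        rw [hval q hq, hqp] at h
        exact (Multiset.cons_inj_right p).1 h

end BlockPoly

/-! ### Several chains with generic spectral parameters -/

section Multi
variable {N : ℕ} {ι K : Type} [DecidableEq ι] [Field K]

/-- The spectral parameters of several chains. -/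
def multiParam (P : ℕ → Bool → ℤ) (ζ : ι → K) (a : ι × Site N) : PowerSeries K :=
  PowerSeries.C (ζ a.1) + PowerSeries.X * PowerSeries.C ((P (siteCol a.2) a.2.2 : K) / 4)

/-- The parameter `d_i ħ / 2`. -/
def multiScale (K : Type) [Field K] (d : ℕ → ℕ) (i : ℕ) : PowerSeries K :=
  PowerSeries.X * PowerSeries.C ((d i : K) / 2)

/-- The twist of several chains. -/
def multiTwist (A : ℕ → ℕ → ℤ) (d : ℕ → ℕ) (P : ℕ → Bool → ℤ) (ζ : ι → K) (a b : ι × Site N) :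
    PowerSeries K :=
  if a.1 = b.1 then PowerSeries.C (chainTwist A d P a.2 b.2 : K)
  else if A (siteCol a.2) (siteCol b.2) = 0 then 1
  else (multiParam P ζ a - multiParam P ζ b +
      A (siteCol a.2) (siteCol b.2) * multiScale K d (siteCol a.2)) *
    (multiParam P ζ a - multiParam P ζ b)⁻¹

set_option linter.unusedSectionVars false in
theorem constantCoeff_multiParam (P : ℕ → Bool → ℤ) (ζ : ι → K) (a : ι × Site N) :
    PowerSeries.constantCoeff (multiParam P ζ a) = ζ a.1 := by
  simp [multiParam]

theorem constantCoeff_multiTwist (A : ℕ → ℕ → ℤ) (d : ℕ → ℕ) (P : ℕ → Bool → ℤ) {ζ : ι → K}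
    (hζ : Function.Injective ζ) (a b : ι × Site N) :
    PowerSeries.constantCoeff (multiTwist A d P ζ a b) =
      if a.1 = b.1 then (chainTwist A d P a.2 b.2 : K) else 1 := by
  unfold multiTwist
  split_ifs with h₁ h₂
  · simp
  · simp
  · have : ζ a.1 - ζ b.1 ≠ 0 := sub_ne_zero.2 (hζ.ne h₁)
    simp [constantCoeff_multiParam, multiScale, this]

variable [Algebra ℚ K]

theorem CartanData.compatible_multiTwist {A : ℕ → ℕ → ℤ} {d : ℕ → ℕ}
    (h : CartanData (N + 1) A d) (P : ℕ → Bool → ℤ) {ζ : ι → K} (hζ : Function.Injective ζ) :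
    Tw.Compatible A (multiScale K d) (fun a : ι × Site N => siteCol a.2) (multiParam P ζ)
      (multiTwist A d P ζ) := by
  have : CharZero K := algebraRat.charZero K
  constructor
  · intro a b hab hA
    have hA' := (h.zero_comm (siteCol_le a.2) (siteCol_le b.2)).1 hA
    obtain ⟨h₁, h₂⟩ := h.chainTwist_symm P hA
    simp only [multiTwist, if_pos hA, if_pos hA', h₁, h₂, eq_comm (a := a.1)]
  · intro a b hab hA
    have hA' := mt (h.zero_comm (siteCol_le a.2) (siteCol_le b.2)).2 hA
    by_cases hc : a.1 = b.1
    · have huv : a.2 ≠ b.2 := fun h' => hab (Prod.ext hc h')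
      obtain ⟨h₁, h₂⟩ := h.chainTwist_bond P huv hA
      set σ := siteSgn (siteCol a.2) (siteCol b.2) a.2.2 with hσ
      have h₁' := congrArg (Int.cast : ℤ → K) h₁
      have h₂' := congrArg (Int.cast : ℤ → K) h₂
      push_cast at h₁' h₂'
      refine ⟨PowerSeries.X * PowerSeries.C ((σ : K) / 4), ?_, ?_, ?_⟩
      · refine mul_ne_zero PowerSeries.X_ne_zero ?_
        rw [Ne, map_eq_zero_iff _ PowerSeries.C_injective]
        refine div_ne_zero ?_ (by norm_num)
        rw [Int.cast_ne_zero]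
        intro h₀
        have := siteSgn_sq (siteCol a.2) (siteCol b.2) a.2.2
        rw [← hσ, h₀] at this
        exact absurd this (by norm_num)
      · have e : (σ : K) / 4 * chainTwist A d P a.2 b.2 = (P (siteCol a.2) a.2.2 : K) / 4 -
            (P (siteCol b.2) b.2.2 : K) / 4 +
            A (siteCol a.2) (siteCol b.2) * ((d (siteCol a.2) : K) / 2) := by
          linear_combination h₁' / 4
        have e' := congrArg (PowerSeries.C (R := K)) e
        simp only [map_mul, map_add, map_sub, map_intCast] at e'
        simp only [multiTwist, if_true, multiParam, multiScale, hc, map_intCast]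
        linear_combination PowerSeries.X * e'
      · have e : (σ : K) / 4 * chainTwist A d P b.2 a.2 = (P (siteCol a.2) a.2.2 : K) / 4 -
            (P (siteCol b.2) b.2.2 : K) / 4 -
            A (siteCol a.2) (siteCol b.2) * ((d (siteCol a.2) : K) / 2) := by
          linear_combination h₂' / 4
        have e' := congrArg (PowerSeries.C (R := K)) e
        simp only [map_mul, map_sub, map_intCast] at e'
        simp only [multiTwist, if_true, multiParam, multiScale, hc, map_intCast]
        linear_combination PowerSeries.X * e'
    · have h₀ : PowerSeries.constantCoeff (multiParam P ζ a - multiParam P ζ b) ≠ 0 := by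
        rw [map_sub, constantCoeff_multiParam, constantCoeff_multiParam]
        exact sub_ne_zero.2 (hζ.ne hc)
      have h₀' : PowerSeries.constantCoeff (multiParam P ζ b - multiParam P ζ a) ≠ 0 := by
        rw [map_sub, constantCoeff_multiParam, constantCoeff_multiParam]
        exact sub_ne_zero.2 (hζ.ne (Ne.symm hc))
      have e₁ := PowerSeries.mul_inv_cancel _ h₀
      have e₂ := PowerSeries.mul_inv_cancel _ h₀'
      have e₃ : (A (siteCol b.2) (siteCol a.2) : PowerSeries K) * multiScale K d (siteCol b.2) =
          A (siteCol a.2) (siteCol b.2) * multiScale K d (siteCol a.2) := by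
        have := congrArg (Int.cast : ℤ → K) (h.symm _ _ (siteCol_le a.2) (siteCol_le b.2))
        push_cast at this
        have e : (A (siteCol b.2) (siteCol a.2) : K) * ((d (siteCol b.2) : K) / 2) =
            A (siteCol a.2) (siteCol b.2) * ((d (siteCol a.2) : K) / 2) := by
          linear_combination -this / 2
        have e' := congrArg (PowerSeries.C (R := K)) e
        simp only [map_mul, map_intCast] at e'
        simp only [multiScale]
        linear_combination PowerSeries.X * e'
      refine ⟨multiParam P ζ a - multiParam P ζ b, fun h' => h₀ (by rw [h', map_zero]), ?_, ?_⟩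
      · simp only [multiTwist, if_neg hc, if_neg hA]
        linear_combination (multiParam P ζ a - multiParam P ζ b +
          A (siteCol a.2) (siteCol b.2) * multiScale K d (siteCol a.2)) * e₁
      · simp only [multiTwist, if_neg (Ne.symm hc), if_neg hA', e₃]
        linear_combination -(multiParam P ζ b - multiParam P ζ a +
          A (siteCol a.2) (siteCol b.2) * multiScale K d (siteCol a.2)) * e₂

theorem CartanData.exists_multi [Fintype ι] {A : ℕ → ℕ → ℤ} {d : ℕ → ℕ}
    (h : CartanData (N + 1) A d) (P : ℕ → Bool → ℤ) {ζ : ι → K} (hζ : Function.Injective ζ) :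
    ∃ Φ : YA (N + 1) A d →ₐ[RH] Tw (multiTwist (N := N) A d P ζ), ∀ i r,
      Φ (gy1 (N + 1) A d i r) =
        Tw.gen (multiTwist A d P ζ) (fun a => siteCol a.2) (multiParam P ζ) i r := by
  obtain ⟨Φ, hΦ⟩ := (h.compatible_multiTwist P hζ).exists_algHom (n := N + 1) (Dd := d) h.diag
    h.entry fun i => by
      rw [PowerSeries.algebraMap_apply', Polynomial.coe_mul, Polynomial.coe_C, hbar,
        Polynomial.coe_X, map_mul, PowerSeries.map_C, PowerSeries.map_X, multiScale, mul_comm]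
      simp
  refine ⟨Φ, fun i r => ?_⟩
  by_cases hi : 1 ≤ i ∧ i ≤ N + 1
  · exact hΦ i r hi.1 hi.2
  · rw [gy1_eq_zero (n := N + 1) (A := A) (Dd := d) r hi, map_zero]
    funext S
    rw [Tw.gen, Tw.ell]
    split_ifs
    · refine (Finset.sum_eq_zero fun a _ => if_neg ?_).symm
      rintro rfl
      exact hi ⟨siteCol_pos _, siteCol_le _⟩
    · rfl

end Multi

/-! ### Linear independence of ordered monomials -/

section Independence
variable {N : ℕ}

/-- Values of iterated commutators after a rescaling of the generators and a change of rings. -/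
theorem BrTree.eval_apply_of_rescale {U K : Type} [DecidableEq U] [CommRing K] {c : U → U → ℤ}
    {g : U → U → K} (hg : ∀ u v, g u v = c u v) (x : K) {y : ℕ → ℕ → Tw g} {e : ℕ → ℕ → Tw c}
    (hy : ∀ i r S, y i r S = x ^ r * (e i r S : ℤ)) (τ : BrTree) (S : Finset U) :
    τ.eval y S = x ^ τ.deg * (τ.eval e S : ℤ) := by
  induction τ generalizing S with
  | leaf i r => exact hy i r S
  | node a b ha hb =>
    simp only [BrTree.eval, BrTree.deg]
    rw [Tw.comm_apply, Tw.comm_apply, Int.cast_sum, Finset.mul_sum]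
    refine Finset.sum_congr rfl fun T _ => ?_
    rw [ha, hb]
    simp only [Tw.bi, hg]
    push_cast
    ring

section Field
variable {ι K : Type} [DecidableEq ι] [Field K] {A : ℕ → ℕ → ℤ} {d : ℕ → ℕ} {P : ℕ → Bool → ℤ}
  {ζ : ι → K}

/-- The generators of several chains at `ħ = 0`. -/
def multiGen (A : ℕ → ℕ → ℤ) (d : ℕ → ℕ) (P : ℕ → Bool → ℤ) (ζ : ι → K) (i r : ℕ) :
    Tw fun a b : ι × Site N => PowerSeries.constantCoeff (multiTwist A d P ζ a b) :=
  Tw.map PowerSeries.constantCoeff _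
    (Tw.gen (multiTwist A d P ζ) (fun a => siteCol a.2) (multiParam P ζ) i r)

theorem multiGen_apply (i r : ℕ) (S : Finset (ι × Site N)) :
    multiGen A d P ζ i r S =
      if S.card = 1 then ∑ a ∈ S, if siteCol a.2 = i then ζ a.1 ^ r else 0 else 0 := by
  change PowerSeries.constantCoeff (if S.card = 1 then _ else _) = _
  split_ifs
  · rw [map_sum]
    refine Finset.sum_congr rfl fun a _ => ?_
    split_ifs
    · rw [map_pow, constantCoeff_multiParam]
    · exact map_zero _
  · exact map_zero _

theorem primitive_multiGen (i r : ℕ) : Tw.Primitive (multiGen (N := N) A d P ζ i r) := by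
  intro S hS
  rw [multiGen_apply] at hS
  split_ifs at hS with h
  · obtain ⟨a, rfl⟩ := Finset.card_eq_one.1 h
    exact ⟨a, Finset.mem_singleton_self a, fun b hb => by rw [Finset.mem_singleton.1 hb]⟩
  · exact absurd rfl hS

/-- Values of root vectors on a single chain. -/
theorem eval_multiGen_map (hζ : Function.Injective ζ) (τ : BrTree) (q : ι) (S : Finset (Site N)) :
    τ.eval (multiGen A d P ζ) (S.map (Tw.chainEmb q)) =
      ζ q ^ τ.deg * (τ.eval (chainGen A d P N) S : ℤ) := by
  have h := congrFun (BrTree.map_eval (Tw.comap (Tw.chainEmb q) _) (multiGen A d P ζ) τ) S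
  refine Eq.trans h (BrTree.eval_apply_of_rescale (fun u v => ?_) (ζ q) (fun i r S => ?_) τ S)
  · rw [constantCoeff_multiTwist A d P hζ]
    exact if_pos rfl
  · refine (multiGen_apply (A := A) (d := d) (P := P) i r (S.map (Tw.chainEmb q))).trans ?_
    rw [Finset.card_map, Finset.sum_map, chainGen, Tw.gen, Tw.ell]
    split_ifs
    · rw [Int.cast_sum, Finset.mul_sum]
      refine Finset.sum_congr rfl fun u _ => ?_
      change (if siteCol u = i then ζ q ^ r else 0) = _
      split_ifs <;> simp
    · simp

end Field

/-- Values of products of root vectors on blocks. -/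
theorem prod_eval_multiGen_block {ι J : Type} [DecidableEq ι] {A : ℕ → ℕ → ℤ} {d : ℕ → ℕ}
    {P : ℕ → Bool → ℤ} {K : Type} [Field K] [Algebra (MvPolynomial ι ℚ) K]
    [FaithfulSMul (MvPolynomial ι ℚ) K] (τ : J → BrTree) {S : ι → Finset (Site N)}
    (hS : ∀ q, (S q).Nonempty) : ∀ (l : List J) (Q : Finset ι), Q.card = l.length →
    (l.map fun p => (τ p).eval (multiGen A d P fun q =>
        algebraMap (MvPolynomial ι ℚ) K (MvPolynomial.X q))).prod (Tw.block S Q) =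
      algebraMap (MvPolynomial ι ℚ) K (blockPoly (fun p => (τ p).deg)
        (fun p q => ((τ p).eval (chainGen A d P N) (S q) : ℤ)) l Q) := by
  have hζ : Function.Injective fun q => algebraMap (MvPolynomial ι ℚ) K (MvPolynomial.X q) :=
    (FaithfulSMul.algebraMap_injective _ _).comp (MvPolynomial.X_injective)
  have hg : ∀ a b : ι × Site N, a.1 ≠ b.1 → PowerSeries.constantCoeff (multiTwist A d P
      (fun q => algebraMap (MvPolynomial ι ℚ) K (MvPolynomial.X q)) a b) = 1 := fun a b hab => by
    rw [constantCoeff_multiTwist A d P hζ, if_neg hab]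
  intro l
  induction l with
  | nil =>
    intro Q hQ
    obtain rfl := Finset.card_eq_zero.1 hQ
    rw [blockPoly, map_one, List.map_nil, List.prod_nil, Tw.one_apply]
    exact if_pos rfl
  | cons p l ih =>
    intro Q hQ
    rw [List.map_cons, List.prod_cons, Tw.prod_block hg hS
      (Tw.Primitive.eval hg primitive_multiGen _) _ (by rw [List.length_map]; exact hQ), blockPoly,
      map_sum]
    · refine Finset.sum_congr rfl fun q hq => ?_
      rw [ih _ (by rw [Finset.card_erase_of_mem hq, hQ, List.length_cons, Nat.add_sub_cancel]),
        eval_multiGen_map hζ, map_mul, ← MvPolynomial.C_mul_X_pow_eq_monomial, map_mul, map_pow,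
        map_intCast, map_intCast]
      ring
    · intro f hf
      obtain ⟨p, _, rfl⟩ := List.mem_map.1 hf
      exact Tw.Primitive.eval hg primitive_multiGen _

end Independence

section Independence
variable {N : ℕ}

/-- Separation of an ordered monomial from the monomials of smaller or equal length. -/
theorem CartanData.exists_specialization {J : Type} [LinearOrder J] {A : ℕ → ℕ → ℤ} {d : ℕ → ℕ}
    (h : CartanData (N + 1) A d) (P : ℕ → Bool → ℤ) (τ : J → BrTree) (S : J → Finset (Site N))
    (hS : ∀ p, (S p).Nonempty) (hself : ∀ p, (τ p).eval (chainGen A d P N) (S p) ≠ 0)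
    (hsep : ∀ p p', (τ p).eval (chainGen A d P N) (S p') ≠ 0 → (τ p).deg = (τ p').deg → p = p')
    {m : ℕ} {h₀ : J →₀ ℕ} (hm₀ : (sortList h₀).length = m) (K : Type) [Field K] [Algebra ℚ K]
    [Algebra (MvPolynomial (Fin m) ℚ) K] [IsScalarTower ℚ (MvPolynomial (Fin m) ℚ) K]
    [FaithfulSMul (MvPolynomial (Fin m) ℚ) K] :
    ∃ (M : Type) (_ : AddCommGroup M) (_ : Module RH M) (F : YA (N + 1) A d →ₗ[RH] M) (ψ : M →+ ℚ),
      (∀ p : M, hbar • p = 0 → p = 0) ∧ (∀ (c : RH) (p : M), ψ (c • p) = c.coeff 0 * ψ p) ∧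
      ψ (F (ordMon (fun p => (τ p).eval (gy1 (N + 1) A d)) h₀)) ≠ 0 ∧
      ∀ h', h' ≠ h₀ → (sortList h').length ≤ (sortList h₀).length →
        ψ (F (ordMon (fun p => (τ p).eval (gy1 (N + 1) A d)) h')) = 0 := by
  subst hm₀
  let m := (sortList h₀).length
  let L : Fin m → J := (sortList h₀).get
  let ζ : Fin m → K := fun q => algebraMap (MvPolynomial (Fin m) ℚ) K (MvPolynomial.X q)
  have hinj : Function.Injective (algebraMap (MvPolynomial (Fin m) ℚ) K) :=
    FaithfulSMul.algebraMap_injective _ _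
  have hζ : Function.Injective ζ := hinj.comp MvPolynomial.X_injective
  obtain ⟨Φ, hΦ⟩ := h.exists_multi P hζ
  obtain ⟨ρ, hρ⟩ := LinearMap.exists_leftInverse_of_injective
    (IsScalarTower.toAlgHom ℚ (MvPolynomial (Fin m) ℚ) K).toLinearMap
    (LinearMap.ker_eq_bot.2 hinj)
  let B : Finset (Fin m × Site N) := Tw.block (fun q => S (L q)) Finset.univ
  let e : Fin m →₀ ℕ := ∑ q, Finsupp.single q (τ (L q)).deg
  let F : YA (N + 1) A d →ₗ[RH] PowerSeries K :=
    { toFun := fun x => Φ x B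
      map_add' := fun x y => by rw [map_add]; rfl
      map_smul' := fun c x => by rw [map_smul]; rfl }
  let ψ : PowerSeries K →+ ℚ :=
    { toFun := fun p => (ρ (PowerSeries.constantCoeff p)).coeff e
      map_zero' := by rw [map_zero, map_zero, MvPolynomial.coeff_zero]
      map_add' := fun x y => by rw [map_add, map_add, MvPolynomial.coeff_add] }
  have hF : ∀ h', PowerSeries.constantCoeff (F (ordMon (fun p => (τ p).eval (gy1 (N + 1) A d)) h')) =
      ((sortList h').map fun p => (τ p).eval (multiGen A d P ζ)).prod B := by
    intro h'
    let G := (Tw.map PowerSeries.constantCoeff (multiTwist (N := N) A d P ζ)).comp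
      (Φ : YA (N + 1) A d →+* _)
    have : G (ordMon (fun p => (τ p).eval (gy1 (N + 1) A d)) h') =
        ((sortList h').map fun p => (τ p).eval (multiGen A d P ζ)).prod := by
      rw [ordMon_eq_prod, map_list_prod, List.map_map]
      congr 2
      funext p
      refine (BrTree.map_eval G (gy1 (N + 1) A d) (τ p)).trans ?_
      congr 1
      funext i r
      exact congrArg (Tw.map PowerSeries.constantCoeff (multiTwist (N := N) A d P ζ)) (hΦ i r)
    exact congrFun this B
  have hψ : ∀ h', (sortList h').length = m → (∃ c : ℕ,
      ψ (F (ordMon (fun p => (τ p).eval (gy1 (N + 1) A d)) h')) =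
        (∏ q, ((τ (L q)).eval (chainGen A d P N) (S (L q)) : ℚ)) * c ∧ (c ≠ 0 ↔ h' = h₀)) := by
    intro h' hm
    have hcard : (Finset.univ : Finset (Fin m)).card = (sortList h').length := by
      rw [Finset.card_univ, Fintype.card_fin, hm]
    obtain ⟨c, hc, hc'⟩ := exists_coeff_blockPoly (fun p => (τ p).deg)
      (fun p q => ((τ p).eval (chainGen A d P N) (S (L q)) : ℤ)) (L := L)
      (fun p q hne hw => hsep _ _ (fun h₁ => hne (by rw [h₁, Int.cast_zero])) hw) _ _ hcard
    refine ⟨c, ?_, ?_⟩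
    · change (ρ (PowerSeries.constantCoeff _)).coeff e = _
      rw [hF, prod_eval_multiGen_block τ (fun q => hS (L q)) _ _ hcard, ← hc]
      exact congrArg _ (LinearMap.congr_fun hρ _)
    · rw [hc', coe_sortList, show (Finset.univ : Finset (Fin m)).val.map L = sortList h₀ from ?_,
        coe_sortList]
      · exact (Function.LeftInverse.injective Finsupp.toMultiset_toFinsupp).eq_iff
      · rw [Fin.univ_val_map, List.ofFn_get]
  refine ⟨PowerSeries K, inferInstance, inferInstance, F, ψ, fun p hp => ?_, fun c p => ?_, ?_,
    fun h' hne hle => ?_⟩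
  · rw [Algebra.smul_def, PowerSeries.algebraMap_apply', hbar, Polynomial.coe_X,
      PowerSeries.map_X] at hp
    exact (mul_eq_zero.1 hp).resolve_left PowerSeries.X_ne_zero
  · change (ρ (PowerSeries.constantCoeff (c • p))).coeff e = c.coeff 0 * (ρ _).coeff e
    rw [Algebra.smul_def, PowerSeries.algebraMap_apply', map_mul,
      ← PowerSeries.coeff_zero_eq_constantCoeff_apply, PowerSeries.coeff_map, Polynomial.coeff_coe,
      ← Algebra.smul_def, map_smul, MvPolynomial.coeff_smul, smul_eq_mul]
  · obtain ⟨c, hc, hc'⟩ := hψ h₀ rfl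
    rw [hc]
    refine mul_ne_zero (Finset.prod_ne_zero_iff.2 fun q _ => ?_) (Nat.cast_ne_zero.2 (hc'.2 rfl))
    exact Int.cast_ne_zero.2 (hself (L q))
  · rcases hle.eq_or_lt with hm | hlt
    · obtain ⟨c, hc, hc'⟩ := hψ h' hm
      rw [hc, of_not_not (mt hc'.1 hne), Nat.cast_zero, mul_zero]
    · change (ρ (PowerSeries.constantCoeff _)).coeff e = 0
      rw [hF]
      convert MvPolynomial.coeff_zero e
      convert map_zero ρ
      by_contra h₀
      have h₁ := Tw.card_image_le_of_prod_ne_zero ?_ h₀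
      · have h₂ : B.image Prod.fst = Finset.univ := by
          refine Finset.eq_univ_of_forall fun q => ?_
          obtain ⟨u, hu⟩ := hS (L q)
          exact Finset.mem_image.2 ⟨(q, u), Tw.mem_block.2 ⟨Finset.mem_univ q, hu⟩, rfl⟩
        rw [h₂, Finset.card_univ, Fintype.card_fin, List.length_map] at h₁
        exact absurd h₁ (not_le.2 hlt)
      · intro f hf
        obtain ⟨p, _, rfl⟩ := List.mem_map.1 hf
        exact Tw.Primitive.eval (fun a b hab => by
          rw [constantCoeff_multiTwist A d P hζ, if_neg hab]) primitive_multiGen _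

/-- Ordered monomials are independent when the root vectors are separated by their degrees and
their values on suitable sets of sites of a chain. -/
theorem CartanData.linearIndependent_ordMon {J : Type} [LinearOrder J] {A : ℕ → ℕ → ℤ} {d : ℕ → ℕ}
    (h : CartanData (N + 1) A d) (P : ℕ → Bool → ℤ) (τ : J → BrTree) (S : J → Finset (Site N))
    (hS : ∀ p, (S p).Nonempty) (hself : ∀ p, (τ p).eval (chainGen A d P N) (S p) ≠ 0)
    (hsep : ∀ p p', (τ p).eval (chainGen A d P N) (S p') ≠ 0 → (τ p).deg = (τ p').deg → p = p') :
    LinearIndependent RH (ordMon fun p => (τ p).eval (gy1 (N + 1) A d)) := by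
  refine linearIndependent_of_specialization _ (fun h => (sortList h).length) fun h₀ => ?_
  exact h.exists_specialization P τ S hS hself hsep rfl
    (FractionRing (MvPolynomial (Fin (sortList h₀).length) ℚ))

end Independence

/-! ### The theorem of Poincaré, Birkhoff and Witt -/

section BasisC
variable {N : ℕ}

theorem eval_chainC_rootSetC_ne_zero {τ : BrTree} {β : PosRootC (N + 1)} {s : ℕ}
    (hτ : τ.Represents (N + 1) (aC (N + 1)) fun _ _ g => canonC g (N + 1) (ri β) (rt β) s) :
    τ.eval (chainC N) (rootSetC N β) ≠ 0 := by
  have hne := canonC_rootSetC_ne_zero β s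
  rcases hτ _ _ ((cartanData_C (N + 1)).currentRel (paramC N)) with h | h
  · rw [h]; exact hne
  · rw [h, Tw.neg_apply]; exact neg_ne_zero.2 hne

theorem eq_of_eval_chainC_rootSetC_ne_zero {τ : BrTree} {β γ : PosRootC (N + 1)} {s : ℕ}
    (hτ : τ.Represents (N + 1) (aC (N + 1)) fun _ _ g => canonC g (N + 1) (ri β) (rt β) s)
    (hne : τ.eval (chainC N) (rootSetC N γ) ≠ 0) : β = γ := by
  have hne' : canonC (chainC N) (N + 1) (ri β) (rt β) s (rootSetC N γ) ≠ 0 := by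
    rcases hτ _ _ ((cartanData_C (N + 1)).currentRel (paramC N)) with h | h
    · rwa [h] at hne
    · rw [h, Tw.neg_apply] at hne
      exact neg_ne_zero.1 hne
  refine nuC_injective fun c => ?_
  rw [← homog_canonC β s _ hne' c, ← homog_canonC γ 0 _ (canonC_rootSetC_ne_zero γ 0) c]

theorem rootSetC_nonempty (β : PosRootC (N + 1)) : (rootSetC N β).Nonempty := by
  rw [Finset.nonempty_iff_ne_empty]
  intro h
  have := homog_canonC β 0 _ (canonC_rootSetC_ne_zero β 0) (ri β)
  rw [h, Finset.filter_empty, Finset.card_empty] at this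
  exact nuC_ri_ne_zero β this.symm

theorem basis_ordMonC (hN : 1 ≤ N) {X : PosRootC (N + 1) × ℕ → YC (N + 1)}
    (hX : ∀ p, IsRVYC p.1 p.2 (X p)) :
    LinearIndependent RH (fun h : Lex (PosRootC (N + 1) × ℕ) →₀ ℕ =>
      ordMon (fun p => X (ofLex p)) h) ∧
    Submodule.span RH (Set.range (fun h : Lex (PosRootC (N + 1) × ℕ) →₀ ℕ =>
      ordMon (fun p => X (ofLex p)) h)) = ⊤ := by
  choose τ hdeg heval hτ using fun p : Lex (PosRootC (N + 1) × ℕ) => (hX (ofLex p)).exists_tree hN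
  obtain rfl : X = fun p => (τ (toLex p)).eval (genYC (N + 1)) := funext fun p =>
    (heval (toLex p)).symm
  refine ⟨?_, ?_⟩
  · refine (cartanData_C (N + 1)).linearIndependent_ordMon (paramC N) τ
      (fun p => rootSetC N (ofLex p).1) (fun p => rootSetC_nonempty _)
      (fun p => eval_chainC_rootSetC_ne_zero (hτ p)) fun p p' hne hd => ?_
    rw [hdeg, hdeg] at hd
    exact ofLex.injective (Prod.ext (eq_of_eval_chainC_rootSetC_ne_zero (hτ p) hne) hd)
  · exact span_ordMonC hN yangRel_gy1
      (fun i r hi => gy1_eq_zero (n := N + 1) (A := aC (N + 1)) (Dd := dC (N + 1)) r hi)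
      exists_mem_loopFil_gy1 τ hτ

end BasisC

section BasisD
variable {N : ℕ}

theorem eval_chainD_rootSetD_ne_zero (hN : 2 ≤ N) {τ : BrTree} {β : PosRootD (N + 1)} {s : ℕ}
    (hτ : τ.Represents (N + 1) (aD (N + 1)) fun _ _ g => canonD g (N + 1) (riD β) (rtD β) s) :
    τ.eval (chainD N) (rootSetD N β) ≠ 0 := by
  have hne := canonD_rootSetD_ne_zero hN β s
  rcases hτ _ _ ((cartanData_D (N + 1)).currentRel (paramD N)) with h | h
  · rw [h]; exact hne
  · rw [h, Tw.neg_apply]; exact neg_ne_zero.2 hne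

theorem eq_of_eval_chainD_rootSetD_ne_zero (hN : 2 ≤ N) {τ : BrTree} {β γ : PosRootD (N + 1)} {s : ℕ}
    (hτ : τ.Represents (N + 1) (aD (N + 1)) fun _ _ g => canonD g (N + 1) (riD β) (rtD β) s)
    (hne : τ.eval (chainD N) (rootSetD N γ) ≠ 0) : β = γ := by
  have hne' : canonD (chainD N) (N + 1) (riD β) (rtD β) s (rootSetD N γ) ≠ 0 := by
    rcases hτ _ _ ((cartanData_D (N + 1)).currentRel (paramD N)) with h | h
    · rwa [h] at hne
    · rw [h, Tw.neg_apply] at hne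
      exact neg_ne_zero.1 hne
  refine nuD_injective fun c => ?_
  rw [← homog_canonD hN β s _ hne' c, ← homog_canonD hN γ 0 _ (canonD_rootSetD_ne_zero hN γ 0) c]

theorem rootSetD_nonempty (hN : 2 ≤ N) (β : PosRootD (N + 1)) : (rootSetD N β).Nonempty := by
  rw [Finset.nonempty_iff_ne_empty]
  intro h
  have := homog_canonD hN β 0 _ (canonD_rootSetD_ne_zero hN β 0) (riD β)
  rw [h, Finset.filter_empty, Finset.card_empty] at this
  exact nuD_ri_ne_zero β this.symm

theorem basis_ordMonD (hN : 2 ≤ N) {X : PosRootD (N + 1) × ℕ → YD (N + 1)}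
    (hX : ∀ p, IsRVYD p.1 p.2 (X p)) :
    LinearIndependent RH (fun h : Lex (PosRootD (N + 1) × ℕ) →₀ ℕ =>
      ordMon (fun p => X (ofLex p)) h) ∧
    Submodule.span RH (Set.range (fun h : Lex (PosRootD (N + 1) × ℕ) →₀ ℕ =>
      ordMon (fun p => X (ofLex p)) h)) = ⊤ := by
  choose τ hdeg heval hτ using fun p : Lex (PosRootD (N + 1) × ℕ) => (hX (ofLex p)).exists_tree hN
  obtain rfl : X = fun p => (τ (toLex p)).eval (genYD (N + 1)) := funext fun p =>
    (heval (toLex p)).symm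
  refine ⟨?_, ?_⟩
  · refine (cartanData_D (N + 1)).linearIndependent_ordMon (paramD N) τ
      (fun p => rootSetD N (ofLex p).1) (fun p => rootSetD_nonempty hN _)
      (fun p => eval_chainD_rootSetD_ne_zero hN (hτ p)) fun p p' hne hd => ?_
    rw [hdeg, hdeg] at hd
    exact ofLex.injective (Prod.ext (eq_of_eval_chainD_rootSetD_ne_zero hN (hτ p) hne) hd)
  · exact span_ordMonD hN yangRel_gy1
      (fun i r hi => gy1_eq_zero (n := N + 1) (A := aD (N + 1)) (Dd := dD (N + 1)) r hi)
      exists_mem_loopFil_gy1 τ hτ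

end BasisD

/-- **PBW basis of `Y_ħ^>(g)` for arbitrary root vectors `X_{β,s}`** (`g` of type `C_n` with
`n ≥ 2`, or of type `D_n` with `n ≥ 4`): for any choice of the decompositions used in
defining the root vectors `X_{β,s}`, the ordered monomials `{X_h}_{h∈𝓗}` form a basis of
`Y_ħ^>(g)` as a `ℚ[ħ]`-module. -/
theorem yangian_pbw_general (n : ℕ) :
    (2 ≤ n → ∀ X : PosRootC n × ℕ → YC n, (∀ p, IsRVYC p.1 p.2 (X p)) →
      LinearIndependent RH (fun h : Lex (PosRootC n × ℕ) →₀ ℕ =>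
        ordMon (fun p => X (ofLex p)) h) ∧
      Submodule.span RH (Set.range (fun h : Lex (PosRootC n × ℕ) →₀ ℕ =>
        ordMon (fun p => X (ofLex p)) h)) = ⊤) ∧
    (4 ≤ n → ∀ X : PosRootD n × ℕ → YD n, (∀ p, IsRVYD p.1 p.2 (X p)) →
      LinearIndependent RH (fun h : Lex (PosRootD n × ℕ) →₀ ℕ =>
        ordMon (fun p => X (ofLex p)) h) ∧
      Submodule.span RH (Set.range (fun h : Lex (PosRootD n × ℕ) →₀ ℕ =>
        ordMon (fun p => X (ofLex p)) h)) = ⊤) := by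
  constructor
  · intro hn X hX
    obtain ⟨N, rfl⟩ : ∃ N, n = N + 1 := ⟨n - 1, by omega⟩
    exact basis_ordMonC (by omega) hX
  · intro hn X hX
    obtain ⟨N, rfl⟩ : ∃ N, n = N + 1 := ⟨n - 1, by omega⟩
    exact basis_ordMonD (by omega) hX
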